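/- Assume Conditions (a) and (b) and Condition P. Then for every η > 0 there exists ε₀ > 0 such that for every ε ∈ (0, ε₀): limsup_{n→∞} | (1/n)·log( Σ_{m ∈ 𝒩^ε(n(n))} |𝒞c_m| / |𝒞_m| ) + K(p) | ≤ η. If additionally Condition (c) holds, then the same conclusion holds with the ratio |𝒮c_m|/|𝒮_m| in place of |𝒞c_m|/|𝒞_m|. -/

import Mathlib

namespace PaperCM

noncomputable section

/-- Number of vertices of a type sequence. -/
def numV (m : ℕ →₀ ℕ) : ℕ := m.sum fun _ c => c

/-- Total degree of a type sequence. -/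
def totalDeg (m : ℕ →₀ ℕ) : ℕ := m.sum fun i c => i * c

/-- The nondecreasing degree sequence associated with a type sequence:
`degOf m i` is the least `j` with `m 1 + ⋯ + m j ≥ i + 1` (vertices `0`-indexed). -/
def degOf (m : ℕ →₀ ℕ) (i : ℕ) : ℕ :=
  sInf {j : ℕ | i < ∑ k ∈ Finset.Icc 1 j, m k}

/-- The half-edges of a type sequence: pairs `(v, j)` with `j < d_v`. -/
abbrev HalfEdges (m : ℕ →₀ ℕ) := Σ v : Fin (numV m), Fin (degOf m (v : ℕ))

/-- A configuration: a perfect matching of the half-edges, encoded as a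
fixed-point free involution. -/
def IsConfig (m : ℕ →₀ ℕ) (f : HalfEdges m → HalfEdges m) : Prop :=
  Function.Involutive f ∧ ∀ x, f x ≠ x

/-- Adjacency in the multigraph induced by a configuration. -/
def adj (m : ℕ →₀ ℕ) (f : HalfEdges m → HalfEdges m) (u v : Fin (numV m)) : Prop :=
  ∃ (j : Fin (degOf m (u : ℕ))) (j' : Fin (degOf m (v : ℕ))), f ⟨u, j⟩ = ⟨v, j'⟩

/-- The multigraph of the configuration is connected. -/
def IsConn (m : ℕ →₀ ℕ) (f : HalfEdges m → HalfEdges m) : Prop :=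
  ∀ u v : Fin (numV m), Relation.ReflTransGen (adj m f) u v

/-- The configuration is simple: no self-loops and no multiple edges. -/
def IsSimple (m : ℕ →₀ ℕ) (f : HalfEdges m → HalfEdges m) : Prop :=
  (∀ x : HalfEdges m, (f x).1 ≠ x.1) ∧
    ∀ x y : HalfEdges m, x.1 = y.1 → (f x).1 = (f y).1 → x = y ∨ x = f y

/-- The vertex set of the component of `v`. -/
def component (m : ℕ →₀ ℕ) (f : HalfEdges m → HalfEdges m) (v : Fin (numV m)) :
    Set (Fin (numV m)) :=
  {u | Relation.ReflTransGen (adj m f) v u}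

/-- The type of the component of `v`: the number of its vertices of each degree. -/
def compType (m : ℕ →₀ ℕ) (f : HalfEdges m → HalfEdges m) (v : Fin (numV m)) (i : ℕ) : ℕ :=
  Set.ncard {u : Fin (numV m) | u ∈ component m f v ∧ degOf m (u : ℕ) = i}

/-- The configuration has a component with type `m'`. -/
def HasCompOfType (m : ℕ →₀ ℕ) (f : HalfEdges m → HalfEdges m) (m' : ℕ →₀ ℕ) : Prop :=
  ∃ v : Fin (numV m), ∀ i, compType m f v i = m' i

/-- `v` is the minimal representative of its component. -/
def IsRep (m : ℕ →₀ ℕ) (f : HalfEdges m → HalfEdges m) (v : Fin (numV m)) : Prop :=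
  ∀ u ∈ component m f v, v ≤ u

/-- Number of components of the configuration whose type lies in `𝒩`. -/
def numCompIn (m : ℕ →₀ ℕ) (f : HalfEdges m → HalfEdges m) (𝒩 : Set (ℕ →₀ ℕ)) : ℕ :=
  Set.ncard {v : Fin (numV m) | IsRep m f v ∧ ∃ m' ∈ 𝒩, ∀ i, compType m f v i = m' i}

/-- `|𝒞_m|`: the number of configurations with type `m`. -/
def cC (m : ℕ →₀ ℕ) : ℕ := Set.ncard {f | IsConfig m f}
/-- `|𝒞c_m|`: the number of connected configurations with type `m`. -/
def cCc (m : ℕ →₀ ℕ) : ℕ := Set.ncard {f | IsConfig m f ∧ IsConn m f}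
/-- `|𝒮_m|`: the number of simple configurations with type `m`. -/
def cS (m : ℕ →₀ ℕ) : ℕ := Set.ncard {f | IsConfig m f ∧ IsSimple m f}
/-- `|𝒮c_m|`: the number of connected simple configurations with type `m`. -/
def cSc (m : ℕ →₀ ℕ) : ℕ := Set.ncard {f | IsConfig m f ∧ IsSimple m f ∧ IsConn m f}
/-- `|𝒞_m^{m'}|`: configurations with type `m` having a component of type `m'`. -/
def cCcomp (m m' : ℕ →₀ ℕ) : ℕ := Set.ncard {f | IsConfig m f ∧ HasCompOfType m f m'}
/-- `|𝒮_m^{m'}|`. -/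
def cScomp (m m' : ℕ →₀ ℕ) : ℕ :=
  Set.ncard {f | IsConfig m f ∧ IsSimple m f ∧ HasCompOfType m f m'}
/-- `|𝒞_m^{𝒩}|`: configurations with type `m` having a component whose type lies in `𝒩`. -/
def cCcompSet (m : ℕ →₀ ℕ) (𝒩 : Set (ℕ →₀ ℕ)) : ℕ :=
  Set.ncard {f | IsConfig m f ∧ ∃ m' ∈ 𝒩, HasCompOfType m f m'}
/-- `|𝒮_m^{𝒩}|`. -/
def cScompSet (m : ℕ →₀ ℕ) (𝒩 : Set (ℕ →₀ ℕ)) : ℕ :=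
  Set.ncard {f | IsConfig m f ∧ IsSimple m f ∧ ∃ m' ∈ 𝒩, HasCompOfType m f m'}

/-- The type sequence `n(n) = (n_i(n))_{i ≥ 1}` of the degree sequence `d(n)`. -/
def typeOf (d : (n : ℕ) → Fin n → ℕ) (n : ℕ) : ℕ →₀ ℕ :=
  ∑ j : Fin n, Finsupp.single (d n j) 1

/-- The total degree `ℓ_n = Σ_i i·n_i = Σ_j d_j(n)`. -/
def ℓTot (d : (n : ℕ) → Fin n → ℕ) (n : ℕ) : ℕ := ∑ j : Fin n, d n j

/-- The set `𝒩^ε(n)` of type sequences approximating `n` from below. -/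
def Neps (ε : ℝ) (nn : ℕ →₀ ℕ) : Set (ℕ →₀ ℕ) :=
  {m | m ≤ nn ∧ (1 - ε) * (totalDeg nn : ℝ) < (totalDeg m : ℝ)}

/-- `β(p)`: the solution in `(0,1)` of the fixed-point equation
`Σ_k k p_k = (1-β²) Σ_k k p_k/(1-β^k)`. -/
def betaOf (p : ℕ → ℝ) : ℝ :=
  sInf {β : ℝ | β ∈ Set.Ioo 0 1 ∧
    ∑' k : ℕ, (k : ℝ) * p k = (1 - β ^ 2) * ∑' k : ℕ, (k : ℝ) * p k / (1 - β ^ k)}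

/-- The exponential rate `K(p)`. -/
def Kof (p : ℕ → ℝ) : ℝ :=
  (∑' k : ℕ, (k : ℝ) * p k) / 2 * Real.log (1 - betaOf p ^ 2)
    - ∑' k : ℕ, p k * Real.log (1 - betaOf p ^ k)

end

end PaperCM

namespace PaperCM

section Matchings

variable {α : Type*}

/-- `f` is a perfect matching of the finite set `S`, encoded as an involution
which moves exactly the points of `S`. -/
def IsMatchingOn (S : Finset α) (f : α → α) : Prop :=
  (∀ a, f (f a) = a) ∧ ∀ a, f a ≠ a ↔ a ∈ S

open Classical in
/-- Add the pair `{x, y}` to a matching. -/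
noncomputable def addPair (x y : α) (f : α → α) : α → α :=
  fun a => if a = x then y else if a = y then x else f a

open Classical in
/-- The number of perfect matchings of `S` with property `P`. -/
noncomputable def matchCount [Fintype α] (S : Finset α) (P : (α → α) → Prop) : ℕ :=
  (Finset.univ.filter fun f : α → α => IsMatchingOn S f ∧ P f).card

lemma IsMatchingOn.apply_mem {S : Finset α} {f : α → α} (hf : IsMatchingOn S f) {a : α}
    (ha : a ∈ S) : f a ∈ S := by
  rw [← hf.2, hf.1]
  exact ((hf.2 a).2 ha).symm

lemma IsMatchingOn.apply_ne {S : Finset α} {f : α → α} (hf : IsMatchingOn S f) {a : α}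
    (ha : a ∈ S) : f a ≠ a := (hf.2 a).2 ha

lemma IsMatchingOn.apply_of_notMem {S : Finset α} {f : α → α} (hf : IsMatchingOn S f) {a : α}
    (ha : a ∉ S) : f a = a := by
  by_contra h
  exact ha ((hf.2 a).1 h)

lemma addPair_left (x y : α) (f : α → α) : addPair x y f x = y := by simp [addPair]

lemma addPair_right (x y : α) (f : α → α) : addPair x y f y = x := by
  by_cases h : y = x <;> simp [addPair, h]

lemma addPair_of_ne {x y a : α} (f : α → α) (hx : a ≠ x) (hy : a ≠ y) :
    addPair x y f a = f a := by simp [addPair, hx, hy]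

variable [DecidableEq α]

lemma addPair_isMatchingOn {S : Finset α} {x y : α} {f : α → α} (hx : x ∈ S) (hy : y ∈ S)
    (hxy : y ≠ x) (hf : IsMatchingOn ((S.erase x).erase y) f) :
    IsMatchingOn S (addPair x y f) := by
  have key : ∀ a, a ≠ x → a ≠ y → f a ≠ x ∧ f a ≠ y := by
    intro a hax hay
    by_cases ha : a ∈ (S.erase x).erase y
    · have := hf.apply_mem ha
      simp only [Finset.mem_erase] at this
      exact ⟨this.2.1, this.1⟩
    · rw [hf.apply_of_notMem ha]; exact ⟨hax, hay⟩
  constructor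
  · intro a
    by_cases hax : a = x
    · subst hax; rw [addPair_left, addPair_right]
    by_cases hay : a = y
    · subst hay; rw [addPair_right, addPair_left]
    rw [addPair_of_ne f hax hay, addPair_of_ne f (key a hax hay).1 (key a hax hay).2, hf.1]
  · intro a
    by_cases hax : a = x
    · subst hax; simp [addPair_left, hxy, hx]
    by_cases hay : a = y
    · subst hay; simp [addPair_right, Ne.symm hxy, hy]
    rw [addPair_of_ne f hax hay, hf.2]
    simp [hax, hay]

lemma exists_eq_addPair {S : Finset α} {x : α} {f : α → α} (hx : x ∈ S)
    (hf : IsMatchingOn S f) :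
    ∃ g, IsMatchingOn ((S.erase x).erase (f x)) g ∧ f = addPair x (f x) g := by
  classical
  refine ⟨fun a => if a = x ∨ a = f x then a else f a, ⟨fun a => ?_, fun a => ?_⟩, ?_⟩
  · dsimp only
    by_cases h : a = x ∨ a = f x
    · simp [h]
    · have h' : ¬ (f a = x ∨ f a = f x) := by
        rintro (h1 | h1)
        · exact h (Or.inr (by rw [← h1, hf.1]))
        · exact h (Or.inl (by rw [← hf.1 a, h1, hf.1]))
      rw [if_neg h, if_neg h', hf.1]
  · dsimp only
    by_cases h : a = x ∨ a = f x
    · rcases h with h | h <;> simp [h]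
    · rw [if_neg h, hf.2]
      push Not at h
      simp [h]
  · funext a
    by_cases hax : a = x
    · subst hax; rw [addPair_left]
    by_cases hay : a = f x
    · subst hay; rw [addPair_right, hf.1]
    rw [addPair_of_ne _ hax hay]
    simp [hax, hay]

lemma addPair_inj {S : Finset α} {x y y' : α} {f f' : α → α}
    (hf : IsMatchingOn ((S.erase x).erase y) f) (hf' : IsMatchingOn ((S.erase x).erase y') f')
    (h : addPair x y f = addPair x y' f') : y = y' ∧ f = f' := by
  have hy : y = y' := by
    have := congrFun h x
    rwa [addPair_left, addPair_left] at this
  subst hy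
  refine ⟨rfl, funext fun a => ?_⟩
  by_cases hax : a = x
  · rw [hf.apply_of_notMem (by simp [hax]), hf'.apply_of_notMem (by simp [hax])]
  by_cases hay : a = y
  · rw [hf.apply_of_notMem (by simp [hay]), hf'.apply_of_notMem (by simp [hay])]
  have := congrFun h a
  rwa [addPair_of_ne _ hax hay, addPair_of_ne _ hax hay] at this

variable [Fintype α]

/-- Lower bound for the number of matchings by the number of ways to match one given point. -/
lemma card_mul_le_matchCount {S Y : Finset α} {x : α} (hx : x ∈ S)
    (hY : ∀ y ∈ Y, y ∈ S ∧ y ≠ x) {N : ℕ} {P : (α → α) → Prop} (P' : α → (α → α) → Prop)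
    (hN : ∀ y ∈ Y, N ≤ matchCount ((S.erase x).erase y) (P' y))
    (himp : ∀ y ∈ Y, ∀ f, IsMatchingOn ((S.erase x).erase y) f → P' y f → P (addPair x y f)) :
    Y.card * N ≤ matchCount S P := by
  classical
  calc Y.card * N ≤ ∑ y ∈ Y, matchCount ((S.erase x).erase y) (P' y) := by
        rw [← smul_eq_mul]; exact Finset.card_nsmul_le_sum _ _ _ hN
    _ = (Y.sigma fun y => Finset.univ.filter fun f : α → α =>
          IsMatchingOn ((S.erase x).erase y) f ∧ P' y f).card := by
        rw [Finset.card_sigma]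
        refine Finset.sum_congr rfl fun y _ => ?_
        unfold matchCount
        congr!
    _ ≤ matchCount S P := by
        unfold matchCount
        refine Finset.card_le_card_of_injOn (fun z => addPair x z.1 z.2) ?_ ?_
        · rintro ⟨y, f⟩ h
          simp only [Finset.coe_sigma, Set.mem_sigma_iff, Finset.mem_coe, Finset.mem_filter,
            Finset.mem_univ, true_and] at h ⊢
          exact ⟨addPair_isMatchingOn hx (hY y h.1).1 (hY y h.1).2 h.2.1,
            himp y h.1 f h.2.1 h.2.2⟩
        · rintro ⟨y, f⟩ h ⟨y', f'⟩ h' heq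
          simp only [Finset.coe_sigma, Set.mem_sigma_iff, Finset.mem_coe, Finset.mem_filter,
            Finset.mem_univ, true_and] at h h'
          obtain ⟨rfl, rfl⟩ := addPair_inj h.2.1 h'.2.1 heq
          rfl

lemma matchCount_le_sum {S : Finset α} {x : α} (hx : x ∈ S) :
    matchCount S (fun _ => True) ≤
      ∑ y ∈ S.erase x, matchCount ((S.erase x).erase y) (fun _ => True) := by
  classical
  unfold matchCount
  refine (Finset.card_le_card (t := (S.erase x).biUnion fun y =>
    (Finset.univ.filter fun f : α → α =>
      IsMatchingOn ((S.erase x).erase y) f ∧ True).image (addPair x y)) ?_).trans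
      (Finset.card_biUnion_le.trans (Finset.sum_le_sum fun y _ => ?_))
  · intro f hf
    simp only [Finset.mem_filter, Finset.mem_univ, true_and, and_true] at hf
    obtain ⟨g, hg, hfg⟩ := exists_eq_addPair hx hf
    simp only [Finset.mem_biUnion, Finset.mem_image, Finset.mem_filter, Finset.mem_univ,
      true_and, and_true]
    exact ⟨f x, Finset.mem_erase.2 ⟨hf.apply_ne hx, hf.apply_mem hx⟩, g, hg, hfg.symm⟩
  · refine Finset.card_image_le.trans (le_of_eq ?_)
    congr!

open scoped Nat in
/-- The number of perfect matchings of a set of even size. -/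
lemma matchCount_true_of_even (S : Finset α) (hS : Even S.card) :
    matchCount S (fun _ => True) = (S.card - 1)‼ := by
  induction hn : S.card using Nat.strong_induction_on generalizing S with
  | _ n ih =>
    rcases S.eq_empty_or_nonempty with rfl | ⟨x, hx⟩
    · subst hn
      unfold matchCount
      simp only [Finset.card_empty]
      rw [Finset.card_eq_one.2]
      · simp
      refine ⟨id, ?_⟩
      ext f
      simp only [IsMatchingOn, Finset.notMem_empty, iff_false, not_not, and_true,
        Finset.mem_filter, Finset.mem_univ, true_and, Finset.mem_singleton]
      constructor
      · rintro ⟨-, h⟩; funext a; exact h a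
      · rintro rfl; simp
    · have hpos : 0 < S.card := Finset.card_pos.2 ⟨x, hx⟩
      have hcard : ∀ y ∈ S.erase x, ((S.erase x).erase y).card = n - 2 := by
        intro y hy
        rw [Finset.card_erase_of_mem hy, Finset.card_erase_of_mem hx, hn]
        rfl
      have hn2 : 2 ≤ n := by
        rcases hS with ⟨k, hk⟩; omega
      have hih : ∀ y ∈ S.erase x,
          matchCount ((S.erase x).erase y) (fun _ => True) = (n - 2 - 1)‼ := by
        intro y hy
        refine ih (n - 2) (by omega) _ ?_ (hcard y hy)
        rw [hcard y hy]
        rw [hn] at hS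
        rcases hS with ⟨k, hk⟩
        exact ⟨k - 1, by omega⟩
      have hval : (n - 1)‼ = (n - 1) * (n - 2 - 1)‼ := by
        rcases hn2.eq_or_lt with h | h
        · subst h; simp
        · obtain ⟨k, rfl⟩ := Nat.exists_eq_add_of_lt h
          rw [show 2 + k + 1 - 1 = k + 2 by omega, Nat.doubleFactorial_add_two,
            show 2 + k + 1 - 2 - 1 = k by omega]
      have hce : (S.erase x).card = n - 1 := by rw [Finset.card_erase_of_mem hx, hn]
      apply le_antisymm
      · refine (matchCount_le_sum hx).trans ?_
        rw [Finset.sum_congr rfl hih, Finset.sum_const, hce, smul_eq_mul, hval]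
      · rw [hval, ← hce]
        refine card_mul_le_matchCount hx (Y := S.erase x) ?_ (fun _ _ => True) ?_ ?_
        · intro y hy; rw [Finset.mem_erase] at hy; exact ⟨hy.2, hy.1⟩
        · intro y hy; exact (hih y hy).ge
        · intros; trivial

set_option linter.unusedSectionVars false in
lemma matchCount_of_odd (S : Finset α) (hS : Odd S.card) (P : (α → α) → Prop) :
    matchCount S P = 0 := by
  classical
  unfold matchCount
  refine Finset.card_eq_zero.2 (Finset.filter_eq_empty_iff.2 ?_)
  rintro f - ⟨hf, -⟩
  have h0 : (∑ _a ∈ S, (1 : ZMod 2)) = 0 :=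
    Finset.sum_involution (fun a _ => f a) (fun a _ => by decide)
      (fun a ha _ => hf.apply_ne ha) (fun a ha => hf.apply_mem ha) (fun a _ => hf.1 a)
  rw [Finset.sum_const, nsmul_one, ZMod.natCast_eq_zero_iff_even] at h0
  exact (Nat.not_even_iff_odd.2 hS) h0

set_option linter.unusedSectionVars false in
lemma matchCount_mono {S : Finset α} {P Q : (α → α) → Prop}
    (h : ∀ f, IsMatchingOn S f → P f → Q f) : matchCount S P ≤ matchCount S Q := by
  unfold matchCount
  exact Finset.card_le_card fun f hf => by
    simp only [Finset.mem_filter, Finset.mem_univ, true_and] at hf ⊢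
    exact ⟨hf.1, h f hf.1 hf.2⟩

end Matchings

end PaperCM

namespace PaperCM

section Phases

variable {α V W : Type*}

/-- Connectivity of the graph on the classes of `κ` induced by the matching `f` of `S`. -/
def IsConnOn (κ : α → W) (S : Finset α) (f : α → α) : Prop :=
  ∀ c : W → Prop, (∀ h ∈ S, c (κ h) → c (κ (f h))) →
    ∀ h ∈ S, ∀ h' ∈ S, c (κ h) → c (κ h')

/-- The matching `f` of `S` induces neither loops nor multiple edges on the classes of `π`. -/
def IsSimpleOn (π : α → V) (S : Finset α) (f : α → α) : Prop :=
  (∀ h ∈ S, π (f h) ≠ π h) ∧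
    ∀ h ∈ S, ∀ h' ∈ S, π h = π h' → π (f h) = π (f h') → h = h'

variable [DecidableEq α]

lemma mem_erase_erase {S : Finset α} {x y a : α} :
    a ∈ (S.erase x).erase y ↔ a ∈ S ∧ a ≠ x ∧ a ≠ y := by
  simp only [Finset.mem_erase]; tauto

lemma isConnOn_addPair {S : Finset α} {x y : α} {f : α → α} {κ κ' : α → W}
    (hx : x ∈ S) (hy : y ∈ S)
    (hκ : ∀ h, κ' h = κ h ∨ (κ' h = κ x ∧ κ h = κ y))
    (hne : ∀ h ∈ (S.erase x).erase y, ∃ h₀ ∈ (S.erase x).erase y,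
      κ' h₀ = κ x ∨ κ' h₀ = κ y)
    (hconn : IsConnOn κ' ((S.erase x).erase y) f) :
    IsConnOn κ S (addPair x y f) := by
  intro c hc
  have hxy : c (κ x) ↔ c (κ y) := by
    constructor
    · intro h; simpa [addPair_left] using hc x hx h
    · intro h; simpa [addPair_right] using hc y hy h
  have hcc : ∀ h, c (κ' h) ↔ c (κ h) := by
    intro h
    rcases hκ h with h1 | ⟨h1, h2⟩
    · rw [h1]
    · rw [h1, h2, hxy]
  have hstep : ∀ h ∈ (S.erase x).erase y, c (κ' h) → c (κ' (f h)) := by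
    intro h hh h1
    obtain ⟨hS, h2, h3⟩ := mem_erase_erase.1 hh
    have := hc h hS ((hcc h).1 h1)
    rw [addPair_of_ne f h2 h3] at this
    exact (hcc _).2 this
  have hconst := hconn c hstep
  have hall : ∀ h ∈ S, c (κ h) ↔ c (κ x) := by
    intro h hh
    by_cases h1 : h = x
    · rw [h1]
    by_cases h2 : h = y
    · rw [h2, hxy]
    have hm : h ∈ (S.erase x).erase y := mem_erase_erase.2 ⟨hh, h1, h2⟩
    obtain ⟨h₀, hm₀, h₀x⟩ := hne h hm
    have e1 : c (κ' h₀) ↔ c (κ x) := by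
      rcases h₀x with h3 | h3
      · rw [h3]
      · rw [h3, hxy]
    rw [← hcc h, ← e1]
    exact ⟨hconst h hm h₀ hm₀, hconst h₀ hm₀ h hm⟩
  intro h hh h' hh' h1
  exact (hall h' hh').2 ((hall h hh).1 h1)

/-- The adjacency relation after adding an edge. -/
def addEdge (Adj : V → V → Prop) (v w : V) : V → V → Prop :=
  fun a b => Adj a b ∨ (a = v ∧ b = w) ∨ (a = w ∧ b = v)

lemma isSimpleOn_addPair {S : Finset α} {x y : α} {f : α → α} {π : α → V}
    {Adj : V → V → Prop} (hsymm : ∀ a b, Adj a b → Adj b a)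
    (hπ : π y ≠ π x) (hadj : ¬ Adj (π x) (π y))
    (h1 : IsSimpleOn π ((S.erase x).erase y) f)
    (h2 : ∀ h ∈ (S.erase x).erase y, ¬ addEdge Adj (π x) (π y) (π h) (π (f h))) :
    IsSimpleOn π S (addPair x y f) ∧ ∀ h ∈ S, ¬ Adj (π h) (π (addPair x y f h)) := by
  refine ⟨⟨?_, ?_⟩, ?_⟩
  · intro h hh
    by_cases hx : h = x
    · subst hx; rwa [addPair_left]
    by_cases hy : h = y
    · subst hy; rw [addPair_right]; exact hπ.symm
    rw [addPair_of_ne f hx hy]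
    exact h1.1 h (mem_erase_erase.2 ⟨hh, hx, hy⟩)
  · have aux : ∀ h ∈ (S.erase x).erase y, (π h = π x → π (f h) ≠ π y) ∧
        (π h = π y → π (f h) ≠ π x) := by
      intro h hh
      refine ⟨fun h3 h4 => h2 h hh (Or.inr (Or.inl ⟨h3, h4⟩)),
        fun h3 h4 => h2 h hh (Or.inr (Or.inr ⟨h3, h4⟩))⟩
    intro h hh h' hh' e1 e2
    by_cases hx : h = x
    · subst hx
      by_cases hx' : h' = h
      · exact hx'.symm
      by_cases hy' : h' = y
      · subst hy'; exact absurd e1.symm hπ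
      rw [addPair_left, addPair_of_ne f hx' hy'] at e2
      exact absurd e2.symm ((aux h' (mem_erase_erase.2 ⟨hh', hx', hy'⟩)).1 e1.symm)
    by_cases hy : h = y
    · subst hy
      by_cases hy' : h' = h
      · exact hy'.symm
      by_cases hx' : h' = x
      · subst hx'; exact absurd e1 hπ
      rw [addPair_right, addPair_of_ne f hx' hy'] at e2
      exact absurd e2.symm ((aux h' (mem_erase_erase.2 ⟨hh', hx', hy'⟩)).2 e1.symm)
    have hm := mem_erase_erase.2 ⟨hh, hx, hy⟩
    rw [addPair_of_ne f hx hy] at e2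
    by_cases hx' : h' = x
    · subst hx'
      rw [addPair_left] at e2
      exact absurd e2 ((aux h hm).1 e1)
    by_cases hy' : h' = y
    · subst hy'
      rw [addPair_right] at e2
      exact absurd e2 ((aux h hm).2 e1)
    rw [addPair_of_ne f hx' hy'] at e2
    exact h1.2 h hm h' (mem_erase_erase.2 ⟨hh', hx', hy'⟩) e1 e2
  · intro h hh
    by_cases hx : h = x
    · subst hx; rwa [addPair_left]
    by_cases hy : h = y
    · subst hy; rw [addPair_right]; exact fun h3 => hadj (hsymm _ _ h3)
    rw [addPair_of_ne f hx hy]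
    exact fun h3 => h2 h (mem_erase_erase.2 ⟨hh, hx, hy⟩) (Or.inl h3)

variable [Fintype α]

lemma one_le_matchCount_empty {P : (α → α) → Prop} (hP : P id) : 1 ≤ matchCount ∅ P := by
  classical
  unfold matchCount
  refine Finset.card_pos.2 ⟨id, ?_⟩
  simp [IsMatchingOn, hP]

open scoped Nat in
/-- If every class has at least two points, except for a root class with at least one, then
a non-negligible proportion of the matchings is connected. -/
lemma le_matchCount_isConnOn (S : Finset α) (κ : α → W) (ρ : W) (hS : Even S.card)
    (hroot : S.Nonempty → ∃ h ∈ S, κ h = ρ)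
    (hoth : ∀ h ∈ S, κ h ≠ ρ → ∃ h' ∈ S, h' ≠ h ∧ κ h' = κ h) :
    (S.card - 2)‼ ≤ matchCount S (IsConnOn κ S) := by
  classical
  induction hn : S.card using Nat.strong_induction_on generalizing S κ with
  | _ n ih =>
    rcases S.eq_empty_or_nonempty with rfl | hne
    · subst hn
      simpa using one_le_matchCount_empty (P := IsConnOn κ ∅) (by intro c _ h hh; simp at hh)
    obtain ⟨x, hx, hxρ⟩ := hroot hne
    have hpos : 0 < S.card := Finset.card_pos.2 hne
    have hn2 : 2 ≤ n := by
      rcases hS with ⟨k, hk⟩; omega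
    let Y := (S.erase x).filter fun y => ¬ (κ y = ρ ∧ 2 < S.card ∧
      ∀ w ∈ S, κ w = ρ → w = x ∨ w = y)
    have hYS : ∀ y ∈ Y, y ∈ S ∧ y ≠ x := by
      intro y hy
      simp only [Y, Finset.mem_filter, Finset.mem_erase] at hy
      exact ⟨hy.1.2, hy.1.1⟩
    have hYcard : (n = 2 → Y.card = 1) ∧ n - 2 ≤ Y.card := by
      have h1 : Y.card + ((S.erase x).filter fun y => (κ y = ρ ∧ 2 < S.card ∧
          ∀ w ∈ S, κ w = ρ → w = x ∨ w = y)).card = n - 1 := by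
        rw [add_comm, Finset.card_filter_add_card_filter_not, Finset.card_erase_of_mem hx, hn]
      have h2 : ((S.erase x).filter fun y => (κ y = ρ ∧ 2 < S.card ∧
          ∀ w ∈ S, κ w = ρ → w = x ∨ w = y)).card ≤ 1 := by
        rw [Finset.card_le_one]
        intro a ha b hb
        simp only [Finset.mem_filter, Finset.mem_erase] at ha hb
        rcases hb.2.2.2 a ha.1.2 ha.2.1 with h | h
        · exact absurd h ha.1.1
        · exact h
      refine ⟨fun h => ?_, by omega⟩
      have h3 : ((S.erase x).filter fun y => (κ y = ρ ∧ 2 < S.card ∧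
          ∀ w ∈ S, κ w = ρ → w = x ∨ w = y)).card = 0 := by
        rw [Finset.card_eq_zero, Finset.filter_eq_empty_iff]
        intro a _ h4
        omega
      omega
    have hval : (n - 2)‼ ≤ Y.card * (n - 2 - 2)‼ := by
      rcases hn2.eq_or_lt with h | h
      · subst h; simp [hYcard.1 rfl]
      · have : (n - 2)‼ = (n - 2) * (n - 2 - 2)‼ := by
          have h4 : 4 ≤ n := by rcases hS with ⟨k, hk⟩; omega
          obtain ⟨k, rfl⟩ := Nat.exists_eq_add_of_le h4
          rw [show 4 + k - 2 = k + 2 by omega, Nat.doubleFactorial_add_two]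
          rfl
        rw [this]
        exact Nat.mul_le_mul_right _ hYcard.2
    refine hval.trans ?_
    let κ' : α → α → W := fun y h => if κ h = κ y then ρ else κ h
    have hrt : ∀ y ∈ Y, ((S.erase x).erase y).Nonempty →
        ∃ h ∈ (S.erase x).erase y, κ' y h = ρ := by
      intro y hy hne'
      by_cases hyρ : κ y = ρ
      · simp only [Y, Finset.mem_filter, Finset.mem_erase] at hy
        have h2 : 2 < S.card := by
          have h5 := Finset.card_pos.2 hne'
          rw [Finset.card_erase_of_mem (Finset.mem_erase.2 hy.1),
            Finset.card_erase_of_mem hx] at h5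
          omega
        have h3 := hy.2
        push Not at h3
        obtain ⟨w, hw, hwρ, hwx, hwy⟩ := h3 hyρ h2
        exact ⟨w, mem_erase_erase.2 ⟨hw, hwx, hwy⟩, by simp [κ', hwρ]⟩
      · obtain ⟨h', hh', hne'', hk⟩ := hoth y (hYS y hy).1 hyρ
        refine ⟨h', mem_erase_erase.2 ⟨hh', ?_, hne''⟩, by simp [κ', hk]⟩
        rintro rfl
        exact hyρ (hk.symm.trans hxρ)
    refine card_mul_le_matchCount hx hYS (fun y => IsConnOn (κ' y) ((S.erase x).erase y)) ?_ ?_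
    · intro y hy
      have hc : ((S.erase x).erase y).card = n - 2 := by
        rw [Finset.card_erase_of_mem (Finset.mem_erase.2 ⟨(hYS y hy).2, (hYS y hy).1⟩),
          Finset.card_erase_of_mem hx, hn]
        rfl
      refine ih (n - 2) (by omega) _ (κ' y) ?_ (hrt y hy) ?_ hc
      · rw [hc, ← hn]
        rcases hS with ⟨k, hk⟩
        exact ⟨k - 1, by omega⟩
      · intro h hh hρ
        obtain ⟨hhS, hhx, hhy⟩ := mem_erase_erase.1 hh
        have h1 : κ h ≠ κ y := fun h1 => hρ (by simp [κ', h1])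
        have h2 : κ' y h = κ h := by simp [κ', h1]
        rw [h2] at hρ
        obtain ⟨h', hh', hne', hk⟩ := hoth h hhS hρ
        refine ⟨h', mem_erase_erase.2 ⟨hh', ?_, ?_⟩, hne', ?_⟩
        · rintro rfl; exact hρ (hk ▸ hxρ)
        · rintro rfl; exact h1 hk.symm
        · simp [κ', hk]
    · intro y hy f hf hP
      refine isConnOn_addPair hx (hYS y hy).1 (κ' := κ' y) ?_ ?_ hP
      · intro h
        by_cases h1 : κ h = κ y
        · right; simp [κ', h1, hxρ]
        · left; simp [κ', h1]
      · intro h hh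
        obtain ⟨h₀, hm, he⟩ := hrt y hy ⟨h, hh⟩
        exact ⟨h₀, hm, Or.inl (he.trans hxρ.symm)⟩

end Phases

section Greedy

variable {α V W : Type*} [DecidableEq α]

/-- The property of matchings which the greedy exploration is meant to produce. -/
def IsGoodOn (B : Prop) (π : α → V) (κ : α → W) (Adj : V → V → Prop) (S : Finset α)
    (f : α → α) : Prop :=
  (B → IsConnOn κ S f) ∧ IsSimpleOn π S f ∧ ∀ h ∈ S, ¬ Adj (π h) (π (f h))

lemma isGoodOn_addPair {B : Prop} {S : Finset α} {x y : α} {f : α → α} {π : α → V}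
    {κ κ' : α → W} {Adj : V → V → Prop} (hx : x ∈ S) (hy : y ∈ S)
    (hκ : ∀ h, κ' h = κ h ∨ (κ' h = κ x ∧ κ h = κ y))
    (hne : B → ∀ h ∈ (S.erase x).erase y, ∃ h₀ ∈ (S.erase x).erase y,
      κ' h₀ = κ x ∨ κ' h₀ = κ y)
    (hsymm : ∀ a b, Adj a b → Adj b a) (hπ : π y ≠ π x) (hadj : ¬ Adj (π x) (π y))
    (h : IsGoodOn B π κ' (addEdge Adj (π x) (π y)) ((S.erase x).erase y) f) :
    IsGoodOn B π κ Adj S (addPair x y f) :=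
  ⟨fun hB => isConnOn_addPair hx hy hκ (hne hB) (h.1 hB),
    isSimpleOn_addPair hsymm hπ hadj h.2.1 h.2.2⟩

open Classical in
/-- The invariants of the greedy exploration with reserved points `Sr`, unexplored points `Su`,
current classes `κ`, current adjacency `Adj`. -/
structure ExplorationState (π : α → V) (κ₀ : α → W) (ρ : W) (Δ : ℕ) (Sr Su : Finset α)
    (κ : α → W) (Adj : V → V → Prop) : Prop where
  disj : Disjoint Su Sr
  root : Su.Nonempty → ∃ h ∈ Su, κ h = ρ
  other : ∀ h ∈ Su, κ h ≠ ρ → ∃ h' ∈ Su, h' ≠ h ∧ κ h' = κ h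
  res : ∀ h ∈ Sr, κ h = κ₀ h ∧ κ h ≠ ρ ∧ ∀ h' ∈ Su, κ h ≠ κ h' ∧ π h ≠ π h'
  symm : ∀ a b, Adj a b → Adj b a
  resAdj : ∀ h ∈ Sr, ∀ a, ¬ Adj (π h) a
  deg : ∀ v, (Su.filter fun h => π h = v).card ≤ Δ ∧
    ∃ N : Finset V, (∀ w, Adj v w → w ∈ N) ∧
      N.card + (Su.filter fun h => π h = v).card ≤ Δ

lemma ExplorationState.step {π : α → V} {κ₀ κ : α → W} {ρ : W} {Δ : ℕ} {Sr Su : Finset α}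
    {Adj : V → V → Prop} (st : ExplorationState π κ₀ ρ Δ Sr Su κ Adj) {x y : α}
    (hx : x ∈ Su) (hxρ : κ x = ρ) (hy : y ∈ Su) (hπ : π y ≠ π x)
    (hroot : κ y = ρ → ∃ w ∈ Su, κ w = ρ ∧ w ≠ x ∧ w ≠ y) {κ' : α → W}
    (h1 : ∀ h, κ h = κ y → κ' h = ρ) (h2 : ∀ h, κ h ≠ κ y → κ' h = κ h) :
    ExplorationState π κ₀ ρ Δ Sr ((Su.erase x).erase y) κ' (addEdge Adj (π x) (π y)) := by
  classical
  have hsub : (Su.erase x).erase y ⊆ Su :=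
    (Finset.erase_subset _ _).trans (Finset.erase_subset _ _)
  have hxy : y ≠ x := fun h => hπ (h ▸ rfl)
  refine ⟨st.disj.mono_left hsub, ?_, ?_, ?_, ?_, ?_, ?_⟩
  · intro _
    by_cases hyρ : κ y = ρ
    · obtain ⟨w, hw, hwρ, hwx, hwy⟩ := hroot hyρ
      exact ⟨w, mem_erase_erase.2 ⟨hw, hwx, hwy⟩, h1 w (hwρ.trans hyρ.symm)⟩
    · obtain ⟨h', hh', hne, hk⟩ := st.other y hy hyρ
      refine ⟨h', mem_erase_erase.2 ⟨hh', ?_, hne⟩, h1 h' hk⟩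
      rintro rfl
      exact hyρ (hk.symm.trans hxρ)
  · intro h hh hρ
    obtain ⟨hhS, hhx, hhy⟩ := mem_erase_erase.1 hh
    have h3 : κ h ≠ κ y := fun h3 => hρ (h1 h h3)
    have h4 := h2 h h3
    rw [h4] at hρ
    obtain ⟨h', hh', hne', hk⟩ := st.other h hhS hρ
    refine ⟨h', mem_erase_erase.2 ⟨hh', ?_, ?_⟩, hne', ?_⟩
    · rintro rfl; exact hρ (hk ▸ hxρ)
    · rintro rfl; exact h3 hk.symm
    · rw [h4, h2 h' (hk ▸ h3), hk]
  · intro h hh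
    obtain ⟨e1, e2, e3⟩ := st.res h hh
    have e4 := h2 h (e3 y hy).1
    refine ⟨e4.trans e1, e4 ▸ e2, fun h' hh' => ⟨?_, (e3 h' (hsub hh')).2⟩⟩
    rw [e4]
    by_cases e5 : κ h' = κ y
    · rw [h1 h' e5]; exact e2
    · rw [h2 h' e5]; exact (e3 h' (hsub hh')).1
  · rintro a b (h | ⟨rfl, rfl⟩ | ⟨rfl, rfl⟩)
    · exact Or.inl (st.symm _ _ h)
    · exact Or.inr (Or.inr ⟨rfl, rfl⟩)
    · exact Or.inr (Or.inl ⟨rfl, rfl⟩)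
  · rintro h hh a (h3 | ⟨h3, -⟩ | ⟨h3, -⟩)
    · exact st.resAdj h hh a h3
    · exact ((st.res h hh).2.2 x hx).2 h3
    · exact ((st.res h hh).2.2 y hy).2 h3
  · intro v
    obtain ⟨g1, N, g2, g3⟩ := st.deg v
    have hmono : ((Su.erase x).erase y).filter (fun h => π h = v) ⊆
        Su.filter (fun h => π h = v) := Finset.filter_subset_filter _ hsub
    refine ⟨(Finset.card_le_card hmono).trans g1, ?_⟩
    by_cases hvx : v = π x
    · refine ⟨insert (π y) N, ?_, ?_⟩
      · rintro w (h | ⟨-, rfl⟩ | ⟨h, -⟩)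
        · exact Finset.mem_insert_of_mem (g2 w h)
        · exact Finset.mem_insert_self _ _
        · exact absurd (h.symm.trans hvx) hπ
      · have : (((Su.erase x).erase y).filter (fun h => π h = v)).card + 1 ≤
            (Su.filter (fun h => π h = v)).card := by
          apply Nat.succ_le_of_lt
          apply Finset.card_lt_card
          refine ⟨hmono, fun h => ?_⟩
          have := h (Finset.mem_filter.2 ⟨hx, hvx.symm⟩)
          simp at this
        have := Finset.card_insert_le (π y) N
        omega
    by_cases hvy : v = π y
    · refine ⟨insert (π x) N, ?_, ?_⟩
      · rintro w (h | ⟨h, -⟩ | ⟨-, rfl⟩)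
        · exact Finset.mem_insert_of_mem (g2 w h)
        · exact absurd h hvx
        · exact Finset.mem_insert_self _ _
      · have : (((Su.erase x).erase y).filter (fun h => π h = v)).card + 1 ≤
            (Su.filter (fun h => π h = v)).card := by
          apply Nat.succ_le_of_lt
          apply Finset.card_lt_card
          refine ⟨hmono, fun h => ?_⟩
          have := h (Finset.mem_filter.2 ⟨hy, hvy.symm⟩)
          simp at this
        have := Finset.card_insert_le (π x) N
        omega
    · refine ⟨N, ?_, ?_⟩
      · rintro w (h | ⟨h, -⟩ | ⟨h, -⟩)
        · exact g2 w h
        · exact absurd h hvx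
        · exact absurd h hvy
      · have := Finset.card_le_card hmono
        omega

variable [Fintype α]

open Classical in
/-- The number of admissible partners in the greedy exploration. -/
lemma ExplorationState.card_partners {π : α → V} {κ₀ κ : α → W} {ρ : W} {Δ : ℕ}
    {Sr Su : Finset α} {Adj : V → V → Prop} (st : ExplorationState π κ₀ ρ Δ Sr Su κ Adj)
    {x : α} (hx : x ∈ Su) :
    Su.card ≤ (Su.filter fun y => π y ≠ π x ∧ ¬ Adj (π x) (π y) ∧
      ¬ (κ y = ρ ∧ ∀ w ∈ Su, κ w = ρ → w = x ∨ w = y)).card + (1 + Δ + Δ ^ 2) := by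
  have hcover : Su ⊆ (Su.filter fun y => π y ≠ π x ∧ ¬ Adj (π x) (π y) ∧
      ¬ (κ y = ρ ∧ ∀ w ∈ Su, κ w = ρ → w = x ∨ w = y)) ∪
      ((Su.filter fun y => y ≠ x ∧ κ y = ρ ∧ ∀ w ∈ Su, κ w = ρ → w = x ∨ w = y) ∪
      (Su.filter fun y => π y = π x) ∪ (Su.filter fun y => Adj (π x) (π y))) := by
    intro y hy
    simp only [Finset.mem_union, Finset.mem_filter, hy, true_and]
    by_cases h1 : y = x
    · subst h1; tauto
    · tauto
  have hA : (Su.filter fun y => y ≠ x ∧ κ y = ρ ∧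
      ∀ w ∈ Su, κ w = ρ → w = x ∨ w = y).card ≤ 1 := by
    rw [Finset.card_le_one]
    intro a ha b hb
    simp only [Finset.mem_filter] at ha hb
    rcases hb.2.2.2 a ha.1 ha.2.2.1 with h | h
    · exact absurd h ha.2.1
    · exact h
  have hB := (st.deg (π x)).1
  have hC : (Su.filter fun y => Adj (π x) (π y)).card ≤ Δ ^ 2 := by
    obtain ⟨-, N, g2, g3⟩ := st.deg (π x)
    have hs : (Su.filter fun y => Adj (π x) (π y)) ⊆
        N.biUnion fun w => Su.filter fun h => π h = w := by
      intro y hy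
      simp only [Finset.mem_filter, Finset.mem_biUnion] at hy ⊢
      exact ⟨π y, g2 _ hy.2, hy.1, rfl⟩
    calc _ ≤ _ := Finset.card_le_card hs
      _ ≤ N.card * Δ := Finset.card_biUnion_le_card_mul _ _ _ fun w _ => (st.deg w).1
      _ ≤ Δ * Δ := Nat.mul_le_mul_right _ (by omega)
      _ = Δ ^ 2 := (sq Δ).symm
  have h1 := Finset.card_le_card hcover
  have h2 := Finset.card_union_le (Su.filter fun y => π y ≠ π x ∧ ¬ Adj (π x) (π y) ∧
      ¬ (κ y = ρ ∧ ∀ w ∈ Su, κ w = ρ → w = x ∨ w = y))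
      ((Su.filter fun y => y ≠ x ∧ κ y = ρ ∧ ∀ w ∈ Su, κ w = ρ → w = x ∨ w = y) ∪
      (Su.filter fun y => π y = π x) ∪ (Su.filter fun y => Adj (π x) (π y)))
  have h3 := Finset.card_union_le
      ((Su.filter fun y => y ≠ x ∧ κ y = ρ ∧ ∀ w ∈ Su, κ w = ρ → w = x ∨ w = y) ∪
      (Su.filter fun y => π y = π x)) (Su.filter fun y => Adj (π x) (π y))
  have h4 := Finset.card_union_le
      (Su.filter fun y => y ≠ x ∧ κ y = ρ ∧ ∀ w ∈ Su, κ w = ρ → w = x ∨ w = y)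
      (Su.filter fun y => π y = π x)
  omega

/-- The greedy exploration: all but `R` of the unreserved points are matched among themselves. -/
lemma le_matchCount_of_exploration (B : Prop) (π : α → V) (κ₀ : α → W) (ρ : W) (Δ R N : ℕ)
    (Sr : Finset α)
    (hend : ∀ Su κ Adj, ExplorationState π κ₀ ρ Δ Sr Su κ Adj → Su.card = R →
      N ≤ matchCount (Su ∪ Sr) (IsGoodOn B π κ Adj (Su ∪ Sr)))
    (k : ℕ) (Su : Finset α) (κ : α → W) (Adj : V → V → Prop)
    (st : ExplorationState π κ₀ ρ Δ Sr Su κ Adj) (hcard : Su.card = R + 2 * k) :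
    (∏ i ∈ Finset.range k, (R + 2 * i - (Δ + Δ ^ 2))) * N ≤
      matchCount (Su ∪ Sr) (IsGoodOn B π κ Adj (Su ∪ Sr)) := by
  classical
  induction k generalizing Su κ Adj with
  | zero => simpa using hend Su κ Adj st (by simpa using hcard)
  | succ k ih =>
    have hne : Su.Nonempty := by
      rw [← Finset.card_pos]; omega
    obtain ⟨x, hx, hxρ⟩ := st.root hne
    let Y := Su.filter fun y => π y ≠ π x ∧ ¬ Adj (π x) (π y) ∧
      ¬ (κ y = ρ ∧ ∀ w ∈ Su, κ w = ρ → w = x ∨ w = y)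
    have hY : ∀ y ∈ Y, y ∈ Su ∧ π y ≠ π x ∧ ¬ Adj (π x) (π y) ∧
        (κ y = ρ → ∃ w ∈ Su, κ w = ρ ∧ w ≠ x ∧ w ≠ y) := by
      intro y hy
      simp only [Y, Finset.mem_filter] at hy
      refine ⟨hy.1, hy.2.1, hy.2.2.1, fun h => ?_⟩
      have h3 := hy.2.2.2
      push Not at h3
      exact h3 h
    have hYne : ∀ y ∈ Y, y ≠ x := fun y hy h => (hY y hy).2.1 (h ▸ rfl)
    have hYcard : R + 2 * k - (Δ + Δ ^ 2) ≤ Y.card := by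
      have := st.card_partners hx
      change _ ≤ Y.card + _ at this
      omega
    rw [Finset.prod_range_succ, mul_comm (∏ i ∈ Finset.range k, _), mul_assoc]
    refine (Nat.mul_le_mul_right _ hYcard).trans ?_
    let κ' : α → α → W := fun y h => if κ h = κ y then ρ else κ h
    have hst : ∀ y ∈ Y, ExplorationState π κ₀ ρ Δ Sr ((Su.erase x).erase y) (κ' y)
        (addEdge Adj (π x) (π y)) := fun y hy =>
      st.step hx hxρ (hY y hy).1 (hY y hy).2.1 (hY y hy).2.2.2
        (fun h h1 => by simp [κ', h1]) (fun h h1 => by simp [κ', h1])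
    have hset : ∀ y ∈ Y, ((Su ∪ Sr).erase x).erase y = (Su.erase x).erase y ∪ Sr := by
      intro y hy
      ext a
      have hxr : x ∉ Sr := Finset.disjoint_left.1 st.disj hx
      have hyr : y ∉ Sr := Finset.disjoint_left.1 st.disj (hY y hy).1
      simp only [Finset.mem_erase, Finset.mem_union]
      constructor
      · tauto
      · rintro (h | h)
        · tauto
        · refine ⟨?_, ?_, Or.inr h⟩
          · rintro rfl; exact hyr h
          · rintro rfl; exact hxr h
    have hcard' : ∀ y ∈ Y, ((Su.erase x).erase y).card = R + 2 * k := by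
      intro y hy
      rw [Finset.card_erase_of_mem (Finset.mem_erase.2 ⟨hYne y hy, (hY y hy).1⟩),
        Finset.card_erase_of_mem hx]
      omega
    have hxS : x ∈ Su ∪ Sr := Finset.mem_union_left _ hx
    refine card_mul_le_matchCount hxS (Y := Y)
      (fun y hy => ⟨Finset.mem_union_left _ (hY y hy).1, hYne y hy⟩)
      (fun y => IsGoodOn B π (κ' y) (addEdge Adj (π x) (π y)) (((Su ∪ Sr).erase x).erase y))
      ?_ ?_
    · intro y hy
      rw [hset y hy]
      exact ih _ _ _ (hst y hy) (hcard' y hy)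
    · intro y hy f hf hP
      refine isGoodOn_addPair hxS (Finset.mem_union_left _ (hY y hy).1) ?_ ?_ st.symm
        (hY y hy).2.1 (hY y hy).2.2.1 hP
      · intro h
        by_cases h1 : κ h = κ y
        · right; simp [κ', h1, hxρ]
        · left; simp [κ', h1]
      · intro _ h _
        have hne' : ((Su.erase x).erase y).Nonempty := by
          by_cases hyρ : κ y = ρ
          · obtain ⟨w, hw, -, h2, h3⟩ := (hY y hy).2.2.2 hyρ
            exact ⟨w, mem_erase_erase.2 ⟨hw, h2, h3⟩⟩
          · obtain ⟨h', hh', hne, hk⟩ := st.other y (hY y hy).1 hyρ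
            refine ⟨h', mem_erase_erase.2 ⟨hh', ?_, hne⟩⟩
            rintro rfl
            exact hyρ (hk.symm.trans hxρ)
        obtain ⟨h₀, hm, he⟩ := (hst y hy).root hne'
        rw [hset y hy]
        exact ⟨h₀, Finset.mem_union_left _ hm, Or.inl (he.trans hxρ.symm)⟩

end Greedy

section Reserve

variable {α V W : Type*} [DecidableEq α]

/-- The invariants of the phase in which the unreserved points `Su` are matched with the
reserved points `Sr`; the siblings under `τ` of matched reserved points are collected in `Sd`. -/
structure ReserveState (π : α → V) (τ : α → α) (ρ : W) (Sr Su Sd : Finset α)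
    (κ : α → W) (Adj : V → V → Prop) : Prop where
  disjUR : Disjoint Su Sr
  disjDR : Disjoint Sd Sr
  disjUD : Disjoint Su Sd
  sib : ∀ h ∈ Sr, τ h ∈ Sr ∧ τ h ≠ h ∧ τ (τ h) = h ∧ π (τ h) = π h ∧ κ (τ h) = κ h
  sibπ : ∀ h ∈ Sr, ∀ h' ∈ Sr, π h = π h' → h' = h ∨ h' = τ h
  sibκ : ∀ h ∈ Sr, ∀ h' ∈ Sr, κ h = κ h' → h' = h ∨ h' = τ h
  card : Sr.card = 2 * Su.card
  res : ∀ h ∈ Sr, κ h ≠ ρ ∧ ∀ h' ∈ Su ∪ Sd, κ h ≠ κ h' ∧ π h ≠ π h'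
  root : (Su ∪ Sd).Nonempty → ∃ h ∈ Su ∪ Sd, κ h = ρ
  other : ∀ h ∈ Su ∪ Sd, κ h ≠ ρ → ∃ h' ∈ Su ∪ Sd, h' ≠ h ∧ κ h' = κ h
  inj : ∀ h ∈ Sd, ∀ h' ∈ Sd, π h = π h' → h = h'
  sep : ∀ h ∈ Su, ∀ h' ∈ Sd, π h ≠ π h'
  symm : ∀ a b, Adj a b → Adj b a
  resAdj : ∀ h ∈ Sr, ∀ a, ¬ Adj (π h) a
  doneAdj : ∀ h ∈ Sd, ∀ h' ∈ Sd, ¬ Adj (π h) (π h')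

lemma ReserveState.step {π : α → V} {τ : α → α} {ρ : W} {Sr Su Sd : Finset α} {κ κ' : α → W}
    {Adj : V → V → Prop} (st : ReserveState π τ ρ Sr Su Sd κ Adj) {x y : α} (hx : x ∈ Su)
    (hy : y ∈ Sr) (h1 : κ' (τ y) = κ x) (h2 : ∀ h, h ≠ τ y → κ' h = κ h) :
    ReserveState π τ ρ ((Sr.erase y).erase (τ y)) (Su.erase x) (insert (τ y) Sd) κ'
      (addEdge Adj (π x) (π y)) := by
  obtain ⟨s1, s2, s3, s4, s5⟩ := st.sib y hy
  have hτU : τ y ∉ Su := fun h => Finset.disjoint_left.1 st.disjUR h s1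
  have hτD : τ y ∉ Sd := fun h => Finset.disjoint_left.1 st.disjDR h s1
  have hxD : x ∉ Sd := Finset.disjoint_left.1 st.disjUD hx
  have hxτ : x ≠ τ y := fun h => hτU (h ▸ hx)
  have hT : ∀ h, h ∈ Su.erase x ∪ insert (τ y) Sd ↔ h = τ y ∨ (h ∈ Su ∪ Sd ∧ h ≠ x) := by
    intro h
    simp only [Finset.mem_union, Finset.mem_erase, Finset.mem_insert]
    constructor
    · rintro (h | h | h)
      · exact Or.inr ⟨Or.inl h.2, h.1⟩
      · exact Or.inl h
      · exact Or.inr ⟨Or.inr h, fun h3 => hxD (h3 ▸ h)⟩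
    · tauto
  have hUD : ∀ h ∈ Su ∪ Sd, h ≠ τ y := by
    rintro h hh rfl
    rcases Finset.mem_union.1 hh with h | h
    · exact hτU h
    · exact hτD h
  have hπr : ∀ h ∈ (Sr.erase y).erase (τ y), π h ≠ π y ∧ κ h ≠ κ y := by
    intro h hh
    obtain ⟨a1, a2, a3⟩ := mem_erase_erase.1 hh
    constructor
    · intro h4
      rcases st.sibπ y hy h a1 h4.symm with h5 | h5
      · exact a2 h5
      · exact a3 h5
    · intro h4
      rcases st.sibκ y hy h a1 h4.symm with h5 | h5
      · exact a2 h5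
      · exact a3 h5
  have hr : ∀ h ∈ (Sr.erase y).erase (τ y), h ∈ Sr ∧ κ' h = κ h := fun h hh => by
    obtain ⟨a1, a2, a3⟩ := mem_erase_erase.1 hh
    exact ⟨a1, h2 h a3⟩
  refine ⟨?_, ?_, ?_, ?_, ?_, ?_, ?_, ?_, ?_, ?_, ?_, ?_, ?_, ?_, ?_⟩
  · rw [Finset.disjoint_left]
    intro h hh hh'
    exact Finset.disjoint_left.1 st.disjUR (Finset.mem_of_mem_erase hh) (hr h hh').1
  · rw [Finset.disjoint_left]
    intro h hh hh'
    rcases Finset.mem_insert.1 hh with rfl | h3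
    · simp at hh'
    · exact Finset.disjoint_left.1 st.disjDR h3 (hr h hh').1
  · rw [Finset.disjoint_left]
    intro h hh hh'
    have h4 := Finset.mem_of_mem_erase hh
    rcases Finset.mem_insert.1 hh' with rfl | h3
    · exact hτU h4
    · exact Finset.disjoint_left.1 st.disjUD h4 h3
  · intro h hh
    obtain ⟨a1, a2, a3⟩ := mem_erase_erase.1 hh
    obtain ⟨t1, t2, t3, t4, t5⟩ := st.sib h a1
    have e1 : τ h ≠ y := fun e => a3 (by rw [← e, t3])
    have e2 : τ h ≠ τ y := fun e => a2 (by rw [← t3, e, s3])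
    exact ⟨mem_erase_erase.2 ⟨t1, e1, e2⟩, t2, t3, t4, by rw [h2 _ e2, h2 _ a3, t5]⟩
  · intro h hh h' hh'
    exact st.sibπ h (hr h hh).1 h' (hr h' hh').1
  · intro h hh h' hh'
    rw [(hr h hh).2, (hr h' hh').2]
    exact st.sibκ h (hr h hh).1 h' (hr h' hh').1
  · rw [Finset.card_erase_of_mem (Finset.mem_erase.2 ⟨s2, s1⟩), Finset.card_erase_of_mem hy,
      Finset.card_erase_of_mem hx, st.card]
    omega
  · intro h hh
    obtain ⟨a1, a2⟩ := hr h hh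
    obtain ⟨b1, b2⟩ := st.res h a1
    refine ⟨a2 ▸ b1, fun h' hh' => ?_⟩
    rw [a2]
    rcases (hT h').1 hh' with rfl | ⟨h3, -⟩
    · rw [h1, s4]
      exact ⟨(b2 x (Finset.mem_union_left _ hx)).1, (hπr h hh).1⟩
    · rw [h2 h' (hUD h' h3)]
      exact b2 h' h3
  · intro _
    obtain ⟨h, hh, hρ⟩ := st.root ⟨x, Finset.mem_union_left _ hx⟩
    by_cases hhx : h = x
    · exact ⟨τ y, (hT _).2 (Or.inl rfl), by rw [h1, ← hhx, hρ]⟩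
    · exact ⟨h, (hT _).2 (Or.inr ⟨hh, hhx⟩), by rw [h2 h (hUD h hh), hρ]⟩
  · intro h hh hρ
    rcases (hT h).1 hh with rfl | ⟨h3, hhx⟩
    · rw [h1] at hρ
      obtain ⟨h', hh', hne, hk⟩ := st.other x (Finset.mem_union_left _ hx) hρ
      exact ⟨h', (hT _).2 (Or.inr ⟨hh', hne⟩), hUD h' hh', by rw [h1, h2 h' (hUD h' hh'), hk]⟩
    · rw [h2 h (hUD h h3)] at hρ
      obtain ⟨h', hh', hne, hk⟩ := st.other h h3 hρ
      by_cases hhx' : h' = x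
      · exact ⟨τ y, (hT _).2 (Or.inl rfl), (hUD h h3).symm,
          by rw [h1, ← hhx', h2 h (hUD h h3), hk]⟩
      · exact ⟨h', (hT _).2 (Or.inr ⟨hh', hhx'⟩), hne,
          by rw [h2 h (hUD h h3), h2 h' (hUD h' hh'), hk]⟩
  · intro h hh h' hh' he
    rcases Finset.mem_insert.1 hh with rfl | h3 <;> rcases Finset.mem_insert.1 hh' with h4 | h4
    · exact h4.symm
    · exact absurd he ((st.res _ s1).2 h' (Finset.mem_union_right _ h4)).2
    · rw [h4] at he
      exact absurd he.symm ((st.res _ s1).2 h (Finset.mem_union_right _ h3)).2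
    · exact st.inj h h3 h' h4 he
  · intro h hh h' hh' he
    have h5 := Finset.mem_of_mem_erase hh
    rcases Finset.mem_insert.1 hh' with rfl | h4
    · exact ((st.res _ s1).2 h (Finset.mem_union_left _ h5)).2 he.symm
    · exact st.sep h h5 h' h4 he
  · rintro a b (h | ⟨rfl, rfl⟩ | ⟨rfl, rfl⟩)
    · exact Or.inl (st.symm _ _ h)
    · exact Or.inr (Or.inr ⟨rfl, rfl⟩)
    · exact Or.inr (Or.inl ⟨rfl, rfl⟩)
  · rintro h hh a (h3 | ⟨h3, -⟩ | ⟨h3, -⟩)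
    · exact st.resAdj h (hr h hh).1 a h3
    · exact ((st.res h (hr h hh).1).2 x (Finset.mem_union_left _ hx)).2 h3
    · exact (hπr h hh).1 h3
  · intro h hh h' hh' hadj
    have hnx : ∀ w ∈ insert (τ y) Sd, π w ≠ π x := by
      intro w hw he
      rcases Finset.mem_insert.1 hw with rfl | h4
      · exact ((st.res _ s1).2 x (Finset.mem_union_left _ hx)).2 he
      · exact st.sep x hx w h4 he.symm
    rcases hadj with h3 | ⟨h3, -⟩ | ⟨-, h3⟩
    · rcases Finset.mem_insert.1 hh with rfl | h4
      · exact st.resAdj _ s1 _ h3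
      rcases Finset.mem_insert.1 hh' with rfl | h5
      · exact st.resAdj _ s1 _ (st.symm _ _ h3)
      · exact st.doneAdj h h4 h' h5 h3
    · exact hnx h hh h3
    · exact hnx h' hh' h3

variable [Fintype α]

open scoped Nat in
/-- Matching the unreserved points with reserved points, and then the siblings of the latter
among themselves. -/
lemma le_matchCount_of_reserve (B : Prop) (π : α → V) (τ : α → α) (ρ : W) (k : ℕ)
    (Sr Su Sd : Finset α) (κ : α → W) (Adj : V → V → Prop)
    (st : ReserveState π τ ρ Sr Su Sd κ Adj) (hk : Su.card = k)
    (heven : Even (Su.card + Sd.card)) :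
    (2 * k)‼ * (Su.card + Sd.card - 2)‼ ≤
      matchCount (Su ∪ Sr ∪ Sd) (IsGoodOn B π κ Adj (Su ∪ Sr ∪ Sd)) := by
  classical
  induction k generalizing Sr Su Sd κ Adj with
  | zero =>
    have hU : Su = ∅ := Finset.card_eq_zero.1 hk
    have hR : Sr = ∅ := Finset.card_eq_zero.1 (by rw [st.card, hk])
    subst hU; subst hR
    simp only [Finset.empty_union, Finset.card_empty, zero_add,
      Nat.doubleFactorial, one_mul] at heven ⊢
    have h1 := le_matchCount_isConnOn Sd κ ρ heven (by simpa using st.root)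
      (by simpa using st.other)
    refine h1.trans (matchCount_mono fun f hf hc => ⟨fun _ => hc, ⟨?_, ?_⟩, ?_⟩)
    · intro h hh he
      exact hf.apply_ne hh (st.inj _ (hf.apply_mem hh) _ hh he)
    · intro h hh h' hh' he _
      exact st.inj _ hh _ hh' he
    · intro h hh
      exact st.doneAdj h hh _ (hf.apply_mem hh)
  | succ k ih =>
    obtain ⟨x, hx⟩ : Su.Nonempty := by rw [← Finset.card_pos]; omega
    rw [show 2 * (k + 1) = 2 * k + 2 by ring, Nat.doubleFactorial_add_two, mul_assoc]
    have hcY : Sr.card = 2 * k + 2 := by rw [st.card, hk]; ring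
    rw [← hcY]
    have hxR : x ∉ Sr := Finset.disjoint_left.1 st.disjUR hx
    have hxD : x ∉ Sd := Finset.disjoint_left.1 st.disjUD hx
    let κ' : α → α → W := fun y h => if h = τ y then κ x else κ h
    have hxS : x ∈ Su ∪ Sr ∪ Sd := by simp [hx]
    have hset : ∀ y ∈ Sr, ((Su ∪ Sr ∪ Sd).erase x).erase y =
        Su.erase x ∪ (Sr.erase y).erase (τ y) ∪ insert (τ y) Sd := by
      intro y hy
      obtain ⟨s1, s2, -⟩ := st.sib y hy
      have hyU : y ∉ Su := fun h => Finset.disjoint_left.1 st.disjUR h hy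
      have hyD : y ∉ Sd := fun h => Finset.disjoint_left.1 st.disjDR h hy
      ext a
      simp only [Finset.mem_erase, Finset.mem_union, Finset.mem_insert]
      constructor
      · tauto
      · rintro ((h | h) | h | h)
        · exact ⟨fun e => hyU (e ▸ h.2), h.1, Or.inl (Or.inl h.2)⟩
        · exact ⟨h.2.1, fun e => hxR (e ▸ h.2.2), Or.inl (Or.inr h.2.2)⟩
        · exact ⟨h ▸ s2, fun e => hxR (e ▸ h ▸ s1), Or.inl (Or.inr (h ▸ s1))⟩
        · exact ⟨fun e => hyD (e ▸ h), fun e => hxD (e ▸ h), Or.inr h⟩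
    have hst : ∀ y ∈ Sr, ReserveState π τ ρ ((Sr.erase y).erase (τ y)) (Su.erase x)
        (insert (τ y) Sd) (κ' y) (addEdge Adj (π x) (π y)) := fun y hy =>
      st.step hx hy (by simp [κ']) (fun h h1 => by simp [κ', h1])
    refine card_mul_le_matchCount hxS (Y := Sr)
      (fun y hy => ⟨by simp [hy], fun e => hxR (e ▸ hy)⟩)
      (fun y => IsGoodOn B π (κ' y) (addEdge Adj (π x) (π y)) (((Su ∪ Sr ∪ Sd).erase x).erase y))
      ?_ ?_
    · intro y hy
      obtain ⟨s1, s2, -⟩ := st.sib y hy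
      have hτD : τ y ∉ Sd := fun h => Finset.disjoint_left.1 st.disjDR h s1
      have hc1 : (Su.erase x).card = k := by rw [Finset.card_erase_of_mem hx, hk]; rfl
      have hc2 : (Su.erase x).card + (insert (τ y) Sd).card = Su.card + Sd.card := by
        rw [hc1, Finset.card_insert_of_notMem hτD, hk]; ring
      rw [hset y hy, ← hc2]
      exact ih _ _ _ _ _ (hst y hy) hc1 (hc2 ▸ heven)
    · intro y hy f hf hP
      obtain ⟨s1, s2, s3, s4, s5⟩ := st.sib y hy
      refine isGoodOn_addPair hxS (by simp [hy]) ?_ ?_ st.symm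
        ((st.res y hy).2 x (Finset.mem_union_left _ hx)).2
        (fun h => st.resAdj y hy _ (st.symm _ _ h)) hP
      · intro h
        by_cases h1 : h = τ y
        · right; simp [κ', h1, s5]
        · left; simp [κ', h1]
      · intro _ h _
        refine ⟨τ y, ?_, Or.inl (by simp [κ'])⟩
        rw [hset y hy]; simp

open scoped Nat in
/-- Matching unreserved points with reserved points lying on distinct vertices. -/
lemma le_matchCount_of_leaves (π : α → V) (κ : α → W) (k : ℕ) (Sr Su : Finset α)
    (Adj : V → V → Prop) (hdisj : Disjoint Su Sr) (hU : Su.card = k) (hR : Sr.card = k)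
    (hinj : ∀ h ∈ Sr, ∀ h' ∈ Sr, π h = π h' → h = h')
    (hsep : ∀ h ∈ Su, ∀ h' ∈ Sr, π h ≠ π h') (hsymm : ∀ a b, Adj a b → Adj b a)
    (hadj : ∀ h ∈ Sr, ∀ a, ¬ Adj (π h) a) :
    k ! ≤ matchCount (Su ∪ Sr) (IsGoodOn False π κ Adj (Su ∪ Sr)) := by
  classical
  induction k generalizing Sr Su Adj with
  | zero =>
    rw [Finset.card_eq_zero] at hU hR
    subst hU; subst hR
    simpa using one_le_matchCount_empty (P := IsGoodOn False π κ Adj ∅)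
      ⟨fun h => h.elim, ⟨by simp, by simp⟩, by simp⟩
  | succ k ih =>
    obtain ⟨x, hx⟩ : Su.Nonempty := by rw [← Finset.card_pos]; omega
    rw [Nat.factorial_succ, ← hR]
    have hxR : x ∉ Sr := Finset.disjoint_left.1 hdisj hx
    have hxS : x ∈ Su ∪ Sr := by simp [hx]
    have hset : ∀ y ∈ Sr, ((Su ∪ Sr).erase x).erase y = Su.erase x ∪ Sr.erase y := by
      intro y hy
      have hyU : y ∉ Su := fun h => Finset.disjoint_left.1 hdisj h hy
      ext a
      simp only [Finset.mem_erase, Finset.mem_union]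
      constructor
      · tauto
      · rintro (h | h)
        · exact ⟨fun e => hyU (e ▸ h.2), h.1, Or.inl h.2⟩
        · exact ⟨h.1, fun e => hxR (e ▸ h.2), Or.inr h.2⟩
    refine card_mul_le_matchCount hxS (Y := Sr)
      (fun y hy => ⟨by simp [hy], fun e => hxR (e ▸ hy)⟩)
      (fun y => IsGoodOn False π κ (addEdge Adj (π x) (π y)) (((Su ∪ Sr).erase x).erase y))
      ?_ ?_
    · intro y hy
      rw [hset y hy]
      refine ih _ _ _ (hdisj.mono (Finset.erase_subset _ _) (Finset.erase_subset _ _)) ?_ ?_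
        ?_ ?_ ?_ ?_
      · rw [Finset.card_erase_of_mem hx, hU]; rfl
      · rw [Finset.card_erase_of_mem hy, hR]; rfl
      · intro h hh h' hh'
        exact hinj h (Finset.mem_of_mem_erase hh) h' (Finset.mem_of_mem_erase hh')
      · intro h hh h' hh'
        exact hsep h (Finset.mem_of_mem_erase hh) h' (Finset.mem_of_mem_erase hh')
      · rintro a b (h | ⟨rfl, rfl⟩ | ⟨rfl, rfl⟩)
        · exact Or.inl (hsymm _ _ h)
        · exact Or.inr (Or.inr ⟨rfl, rfl⟩)
        · exact Or.inr (Or.inl ⟨rfl, rfl⟩)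
      · rintro h hh a (h3 | ⟨h3, -⟩ | ⟨h3, -⟩)
        · exact hadj h (Finset.mem_of_mem_erase hh) a h3
        · exact hsep x hx h (Finset.mem_of_mem_erase hh) h3.symm
        · exact (Finset.mem_erase.1 hh).1 (hinj h (Finset.mem_of_mem_erase hh) y hy h3)
    · intro y hy f hf hP
      exact isGoodOn_addPair hxS (by simp [hy]) (fun h => Or.inl rfl) (fun h => h.elim) hsymm
        (hsep x hx y hy).symm (fun h => hadj y hy _ (hsymm _ _ h)) hP

end Reserve

section Core

variable {α V : Type*} [DecidableEq α] [Fintype α]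

open Classical in
open scoped Nat in
/-- Lower bound for the number of simple connected matchings when every vertex has at least two
points and `R` vertices have exactly two points. -/
lemma le_matchCount_core (π : α → V) (τ : α → α) (Δ R k : ℕ) (Sr Su : Finset α)
    (hdisj : Disjoint Su Sr)
    (hsib : ∀ h ∈ Sr, τ h ∈ Sr ∧ τ h ≠ h ∧ τ (τ h) = h ∧ π (τ h) = π h)
    (hsibπ : ∀ h ∈ Sr, ∀ h' ∈ Sr, π h = π h' → h' = h ∨ h' = τ h)
    (hsep : ∀ h ∈ Su, ∀ h' ∈ Sr, π h ≠ π h')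
    (hother : ∀ h ∈ Su, ∃ h' ∈ Su, h' ≠ h ∧ π h' = π h)
    (hdeg : ∀ v, (Su.filter fun h => π h = v).card ≤ Δ)
    (hSr : Sr.card = 2 * R) (hSu : Su.card = R + 2 * k) (hR : Even R) (hR0 : 0 < R) :
    (∏ i ∈ Finset.range k, (R + 2 * i - (Δ + Δ ^ 2))) * ((2 * R)‼ * (R - 2)‼) ≤
      matchCount (Su ∪ Sr) fun f => IsConnOn π (Su ∪ Sr) f ∧ IsSimpleOn π (Su ∪ Sr) f := by
  obtain ⟨r, hr⟩ : Su.Nonempty := by rw [← Finset.card_pos]; omega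
  refine (le_matchCount_of_exploration True π π (π r) Δ R ((2 * R)‼ * (R - 2)‼) Sr ?_ k Su π
    (fun _ _ => False) ?_ hSu).trans (matchCount_mono fun f _ h => ⟨h.1 trivial, h.2.1⟩)
  · intro Su' κ Adj st hcard
    have h1 := le_matchCount_of_reserve True π τ (π r) R Sr Su' ∅ κ Adj ?_ hcard (by simpa [hcard])
    · simpa [hcard] using h1
    refine ⟨st.disj, by simp, by simp, ?_, hsibπ, ?_, by rw [hSr, hcard], ?_, ?_, ?_, by simp,
      by simp, st.symm, st.resAdj, by simp⟩
    · intro h hh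
      obtain ⟨a, b, c, e⟩ := hsib h hh
      exact ⟨a, b, c, e, by rw [(st.res h hh).1, (st.res _ a).1, e]⟩
    · intro h hh h' hh' he
      rw [(st.res h hh).1, (st.res _ hh').1] at he
      exact hsibπ h hh h' hh' he
    · intro h hh
      simpa using (st.res h hh).2
    · simpa using st.root
    · simpa using st.other
  · refine ⟨hdisj, fun _ => ⟨r, hr, rfl⟩, fun h hh _ => hother h hh, ?_, by simp, by simp, ?_⟩
    · intro h hh
      exact ⟨rfl, fun e => hsep r hr h hh e.symm, fun h' hh' =>
        ⟨fun e => hsep h' hh' h hh e.symm, fun e => hsep h' hh' h hh e.symm⟩⟩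
    · intro v
      exact ⟨hdeg v, ∅, by simp, by simpa using hdeg v⟩

end Core

section Forest

variable {α V : Type*}

/-- `h` is the only alive point of its vertex. -/
def IsUp (π : α → V) (A : Finset α) (h : α) : Prop :=
  h ∈ A ∧ ∀ h' ∈ A, π h' = π h → h' = h

/-- The set of dead points (the complement of `A`) is determined by the matching `f`, given the
dead points outside `S`. -/
def DeadDetermined (π : α → V) (A S : Finset α) (f : α → α) : Prop :=
  (∀ h ∈ S, IsUp π A (f h) → h ∉ A) ∧
  ∀ c : α → Prop, (∀ h, h ∉ S → h ∉ A → c h) →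
    (∀ h ∈ S, (∀ h', π h' = π (f h) → h' ≠ f h → c h') → c h) → ∀ h ∈ S, h ∉ A → c h

/-- The invariants of the phase in which the dead points `D` are matched with the points `U`
that are alone alive at their vertex, `C` being the set of the other alive points. -/
structure ForestState (π : α → V) (A C U D : Finset α) : Prop where
  up : ∀ h ∈ U, IsUp π A h
  core : ∀ h ∈ C, h ∈ A ∧ ∀ h', IsUp π A h' → π h ≠ π h'
  dead : ∀ h ∈ D, h ∉ A
  vert : ∀ h ∈ D, (∃ h' ∈ U, π h' = π h) ∨ ∃ h' ∈ C, π h' = π h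
  card : U.card = D.card
  root : U.Nonempty → ∃ h ∈ D, ∃ h' ∈ C, π h' = π h

variable [DecidableEq α]

lemma ForestState.exists_free {π : α → V} {A C U D : Finset α} (st : ForestState π A C U D)
    (hU : U.Nonempty) : ∃ x ∈ U, ∀ h ∈ D, π h ≠ π x := by
  classical
  by_contra! hcon
  choose! g hg using hcon
  obtain ⟨r, hr, c, hc, hcr⟩ := st.root hU
  have h1 : U.image g ⊆ D.erase r := by
    intro h hh
    obtain ⟨x, hx, rfl⟩ := Finset.mem_image.1 hh
    refine Finset.mem_erase.2 ⟨?_, (hg x hx).1⟩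
    intro e
    have := (hg x hx).2
    rw [e] at this
    exact (st.core c hc).2 x (st.up x hx) (hcr.trans this)
  have h2 : (U.image g).card = U.card := by
    refine Finset.card_image_of_injOn fun x hx x' hx' e => ?_
    have e2 : π x = π x' := by rw [← (hg x hx).2, ← (hg x' hx').2, e]
    exact (st.up x' hx').2 x (st.up x hx).1 e2
  have h3 := Finset.card_le_card h1
  have h4 := Finset.card_erase_lt_of_mem hr
  have := st.card
  omega

lemma ForestState.step {π : α → V} {A C U D : Finset α} (st : ForestState π A C U D) {x y : α}
    (hx : x ∈ U) (hxD : ∀ h ∈ D, π h ≠ π x) (hy : y ∈ D)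
    (hroot : (U.erase x).Nonempty → ∃ h ∈ D, h ≠ y ∧ ∃ h' ∈ C, π h' = π h) :
    ForestState π A C (U.erase x) (D.erase y) := by
  refine ⟨fun h hh => st.up h (Finset.mem_of_mem_erase hh), st.core,
    fun h hh => st.dead h (Finset.mem_of_mem_erase hh), ?_, ?_, ?_⟩
  · intro h hh
    have hD := Finset.mem_of_mem_erase hh
    rcases st.vert h hD with ⟨h', h1, h2⟩ | h3
    · refine Or.inl ⟨h', Finset.mem_erase.2 ⟨?_, h1⟩, h2⟩
      rintro rfl
      exact hxD h hD h2.symm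
    · exact Or.inr h3
  · rw [Finset.card_erase_of_mem hx, Finset.card_erase_of_mem hy, st.card]
  · intro hne
    obtain ⟨h, h1, h2, h3⟩ := hroot hne
    exact ⟨h, Finset.mem_erase.2 ⟨h2, h1⟩, h3⟩

lemma deadDetermined_addPair {π : α → V} {A S : Finset α} {x y : α} {f : α → α}
    (hup : IsUp π A x) (hy : y ∉ A) (hy' : y ∈ S) (hS : ∀ h ∈ S, h ∉ A → π h ≠ π x)
    (hf : DeadDetermined π A ((S.erase x).erase y) f) :
    DeadDetermined π A S (addPair x y f) := by
  refine ⟨?_, ?_⟩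
  · intro h hh hu
    by_cases h1 : h = x
    · rw [h1, addPair_left] at hu; exact absurd hu.1 hy
    by_cases h2 : h = y
    · rwa [h2]
    rw [addPair_of_ne f h1 h2] at hu
    exact hf.1 h (mem_erase_erase.2 ⟨hh, h1, h2⟩) hu
  · intro c hc1 hc2
    have hcy : c y := by
      refine hc2 y hy' fun h' h1 h2 => ?_
      rw [addPair_right] at h1 h2
      have h3 : h' ∉ A := fun h3 => h2 (hup.2 h' h3 h1)
      exact hc1 h' (fun h4 => hS h' h4 h3 h1) h3
    intro h hh hA
    by_cases h2 : h = y
    · rwa [h2]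
    have hne : h ≠ x := fun e => hA (e ▸ hup.1)
    refine hf.2 c ?_ ?_ h (mem_erase_erase.2 ⟨hh, hne, h2⟩) hA
    · intro w hw hwA
      by_cases hwS : w ∈ S
      · rw [mem_erase_erase] at hw
        have : w ≠ x := fun e => hwA (e ▸ hup.1)
        have : w = y := by tauto
        rwa [this]
      · exact hc1 w hwS hwA
    · intro w hw h3
      obtain ⟨a1, a2, a3⟩ := mem_erase_erase.1 hw
      refine hc2 w a1 ?_
      rwa [addPair_of_ne f a2 a3]

variable [Fintype α]

open scoped Nat in
/-- Matching the dead points with the points alone alive at their vertex. -/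
lemma le_matchCount_of_forest {π : α → V} {A C : Finset α} {N : ℕ}
    (hN : N ≤ matchCount C fun f => IsConnOn π C f ∧ IsSimpleOn π C f) (u : ℕ) (U D : Finset α)
    (st : ForestState π A C U D) (hu : U.card = u) :
    (u - 1)! * N ≤ matchCount (C ∪ U ∪ D) fun f => (IsConnOn π (C ∪ U ∪ D) f ∧
      IsSimpleOn π (C ∪ U ∪ D) f) ∧ DeadDetermined π A (C ∪ U ∪ D) f := by
  classical
  induction u generalizing U D with
  | zero =>
    have hD : D.card = 0 := by rw [← st.card, hu]
    rw [Finset.card_eq_zero] at hu hD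
    subst hu; subst hD
    simp only [Finset.union_empty, Nat.zero_sub, Nat.factorial_zero, one_mul]
    refine hN.trans (matchCount_mono fun f hf h => ⟨h, ?_, ?_⟩)
    · intro h hh hup
      exact absurd rfl ((st.core _ (hf.apply_mem hh)).2 _ hup)
    · intro c _ _ h hh hA
      exact absurd (st.core h hh).1 hA
  | succ u ih =>
    have hUne : U.Nonempty := by rw [← Finset.card_pos]; omega
    obtain ⟨x, hx, hxD⟩ := st.exists_free hUne
    obtain ⟨r, hr, hrC⟩ := st.root hUne
    have hup := st.up x hx
    have hxC : ∀ h ∈ C, π h ≠ π x := fun h hh => (st.core h hh).2 x hup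
    have hxA : x ∉ D := fun h => st.dead x h hup.1
    have hxS : ∀ h ∈ C ∪ U ∪ D, π h = π x → h = x := by
      intro h hh he
      simp only [Finset.mem_union] at hh
      rcases hh with (hh | hh) | hh
      · exact absurd he (hxC h hh)
      · exact hup.2 h (st.up h hh).1 he
      · exact absurd he (hxD h hh)
    have hmem : x ∈ C ∪ U ∪ D := by simp [hx]
    let Y := if u = 0 then D else
      if ∃ h ∈ D, h ≠ r ∧ ∃ h' ∈ C, π h' = π h then D else D.erase r
    have hYD : ∀ y ∈ Y, y ∈ D := by
      intro y hy
      dsimp only [Y] at hy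
      split_ifs at hy
      · exact hy
      · exact hy
      · exact Finset.mem_of_mem_erase hy
    have hYcard : u ! ≤ Y.card * (u - 1)! := by
      rcases u with _ | u
      · have : Y = D := by simp [Y]
        rw [this, ← st.card, hu]; simp
      · have : u + 1 ≤ Y.card := by
          have h1 := st.card
          have h2 := Finset.card_erase_of_mem hr
          dsimp only [Y]
          split_ifs <;> omega
        rw [Nat.factorial_succ]
        exact Nat.mul_le_mul_right _ this
    have hst : ∀ y ∈ Y, ForestState π A C (U.erase x) (D.erase y) := by
      intro y hy
      refine st.step hx hxD (hYD y hy) fun hne => ?_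
      have hu0 : u ≠ 0 := by
        rintro rfl
        rw [← Finset.card_pos, Finset.card_erase_of_mem hx, hu] at hne
        simp at hne
      by_cases hex : ∃ h ∈ D, h ≠ r ∧ ∃ h' ∈ C, π h' = π h
      · by_cases hyr : y = r
        · rw [hyr]; exact hex
        · exact ⟨r, hr, fun e => hyr e.symm, hrC⟩
      · simp only [Y, hu0, hex, if_false] at hy
        exact ⟨r, hr, fun e => (Finset.mem_erase.1 hy).1 e.symm, hrC⟩
    have hset : ∀ y ∈ Y, ((C ∪ U ∪ D).erase x).erase y = C ∪ U.erase x ∪ D.erase y := by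
      intro y hy
      have hyA := st.dead y (hYD y hy)
      ext a
      simp only [Finset.mem_erase, Finset.mem_union]
      constructor
      · tauto
      · rintro ((h | h) | h)
        · exact ⟨fun e => hyA (e ▸ (st.core a h).1), fun e => hxC a h (e ▸ rfl),
            Or.inl (Or.inl h)⟩
        · exact ⟨fun e => hyA (e ▸ (st.up a h.2).1), h.1, Or.inl (Or.inr h.2)⟩
        · exact ⟨h.1, fun e => hxA (e ▸ h.2), Or.inr h.2⟩
    rw [Nat.add_sub_cancel]
    refine (Nat.mul_le_mul_right N hYcard).trans ?_
    rw [mul_assoc]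
    have hyx : ∀ y ∈ Y, π y ≠ π x := fun y hy => hxD y (hYD y hy)
    refine card_mul_le_matchCount hmem (Y := Y)
      (fun y hy => ⟨by simp [hYD y hy], fun e => hyx y hy (e ▸ rfl)⟩)
      (fun y f => (IsConnOn π (((C ∪ U ∪ D).erase x).erase y) f ∧
        IsSimpleOn π (((C ∪ U ∪ D).erase x).erase y) f) ∧
        DeadDetermined π A (((C ∪ U ∪ D).erase x).erase y) f) ?_ ?_
    · intro y hy
      rw [hset y hy]
      exact ih _ _ (hst y hy) (by rw [Finset.card_erase_of_mem hx, hu]; rfl)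
    · intro y hy f hf hP
      have hyS : y ∈ C ∪ U ∪ D := by simp [hYD y hy]
      refine ⟨⟨isConnOn_addPair hmem hyS (fun _ => Or.inl rfl) ?_ hP.1.1, ?_⟩, ?_⟩
      · intro h _
        obtain ⟨h', hh', he⟩ : ∃ h' ∈ C ∪ U, π h' = π y := by
          rcases st.vert y (hYD y hy) with ⟨h', h1, h2⟩ | ⟨h', h1, h2⟩
          · exact ⟨h', by simp [h1], h2⟩
          · exact ⟨h', by simp [h1], h2⟩
        refine ⟨h', mem_erase_erase.2 ⟨by simp at hh' ⊢; tauto, ?_, ?_⟩, Or.inr he⟩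
        · rintro rfl; exact hyx y hy he.symm
        · rintro rfl
          have hA := st.dead h' (hYD h' hy)
          rcases Finset.mem_union.1 hh' with h3 | h3
          · exact hA (st.core h' h3).1
          · exact hA (st.up h' h3).1
      · refine (isSimpleOn_addPair (Adj := fun _ _ => False) (by simp) (hyx y hy) (by simp)
          hP.1.2 ?_).1
        rintro h hh (h3 | ⟨h3, -⟩ | ⟨-, h3⟩)
        · exact h3
        · obtain ⟨a1, a2, -⟩ := mem_erase_erase.1 hh
          exact a2 (hxS h a1 h3)
        · obtain ⟨a1, a2, -⟩ := mem_erase_erase.1 (hf.apply_mem hh)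
          exact a2 (hxS _ a1 h3)
      · refine deadDetermined_addPair hup (st.dead y (hYD y hy)) hyS ?_ hP.2
        intro h hh hA he
        exact hA (hxS h hh he ▸ hup.1)

/-- Different sets of alive points produce different matchings. -/
lemma card_mul_le_matchCount_of_deadDetermined {π : α → V} {P : (α → α) → Prop} {M : ℕ}
    (𝒜 : Finset (Finset α)) (hne : ∀ A ∈ 𝒜, ∀ h, ∃ h' ∈ A, π h' = π h)
    (hM : ∀ A ∈ 𝒜, M ≤ matchCount Finset.univ fun f => P f ∧ DeadDetermined π A Finset.univ f) :
    𝒜.card * M ≤ matchCount Finset.univ P := by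
  classical
  have hle : ∀ f : α → α, IsMatchingOn Finset.univ f → ∀ A ∈ 𝒜, ∀ A' ∈ 𝒜,
      DeadDetermined π A Finset.univ f → DeadDetermined π A' Finset.univ f →
      ∀ h, h ∉ A → h ∉ A' := by
    intro f hf A hA A' hA' h1 h2 h hh
    refine h1.2 (fun h => h ∉ A') (by simp) ?_ h (Finset.mem_univ _) hh
    intro w _ hw
    refine h2.1 w (Finset.mem_univ _) ?_
    have hall : ∀ h' ∈ A', π h' = π (f w) → h' = f w := by
      intro h' hh' he
      by_contra hcon
      exact hw h' he hcon hh'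
    obtain ⟨h', hh', he⟩ := hne A' hA' (f w)
    exact ⟨hall h' hh' he ▸ hh', hall⟩
  calc 𝒜.card * M ≤ ∑ A ∈ 𝒜, matchCount Finset.univ
        (fun f => P f ∧ DeadDetermined π A Finset.univ f) := by
        rw [← smul_eq_mul]; exact Finset.card_nsmul_le_sum _ _ _ hM
    _ = (𝒜.biUnion fun A => Finset.univ.filter fun f : α → α =>
          IsMatchingOn Finset.univ f ∧ P f ∧ DeadDetermined π A Finset.univ f).card := by
        rw [Finset.card_biUnion]
        · refine Finset.sum_congr rfl fun A _ => ?_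
          unfold matchCount
          congr!
        · intro A hA A' hA' hAA
          refine Finset.disjoint_left.2 fun f hf hf' => hAA ?_
          simp only [Finset.mem_filter, Finset.mem_univ, true_and] at hf hf'
          ext h
          constructor
          · intro h3
            by_contra h4
            exact hle f hf.1 A' hA' A hA hf'.2.2 hf.2.2 h h4 h3
          · intro h3
            by_contra h4
            exact hle f hf.1 A hA A' hA' hf.2.2 hf'.2.2 h h4 h3
    _ ≤ matchCount Finset.univ P := by
        unfold matchCount
        refine Finset.card_le_card fun f hf => ?_
        simp only [Finset.mem_biUnion, Finset.mem_filter, Finset.mem_univ, true_and] at hf ⊢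
        obtain ⟨A, -, h1, h2, -⟩ := hf
        exact ⟨h1, h2⟩

end Forest

section Degrees

lemma degOf_eq_iff (m : ℕ →₀ ℕ) (i k : ℕ) :
    degOf m i = k + 1 ↔ ∑ j ∈ Finset.Icc 1 k, m j ≤ i ∧ i < ∑ j ∈ Finset.Icc 1 (k + 1), m j := by
  unfold degOf
  constructor
  · intro h
    have hne : {j : ℕ | i < ∑ k ∈ Finset.Icc 1 j, m k}.Nonempty := by
      apply Nat.nonempty_of_pos_sInf
      omega
    refine ⟨?_, ?_⟩
    · by_contra! hlt
      have := Nat.sInf_le (s := {j : ℕ | i < ∑ k ∈ Finset.Icc 1 j, m k}) hlt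
      omega
    · have := Nat.sInf_mem hne
      rw [h] at this
      exact this
  · rintro ⟨h1, h2⟩
    refine le_antisymm (Nat.sInf_le h2) ?_
    refine le_csInf ⟨_, h2⟩ fun j hj => ?_
    by_contra! hlt
    have hj' : i < ∑ k ∈ Finset.Icc 1 j, m k := hj
    have : ∑ k ∈ Finset.Icc 1 j, m k ≤ ∑ k ∈ Finset.Icc 1 k, m k :=
      Finset.sum_le_sum_of_subset (Finset.Icc_subset_Icc_right (by omega))
    omega

lemma sum_Icc_le_numV (m : ℕ →₀ ℕ) (k : ℕ) : ∑ j ∈ Finset.Icc 1 k, m j ≤ numV m := by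
  classical
  unfold numV Finsupp.sum
  rw [← Finset.sum_filter_ne_zero]
  refine Finset.sum_le_sum_of_subset fun j hj => ?_
  simp only [Finset.mem_filter] at hj
  simpa using hj.2

lemma exists_sum_Icc_eq_numV (m : ℕ →₀ ℕ) (h0 : m 0 = 0) :
    ∃ k, ∑ j ∈ Finset.Icc 1 k, m j = numV m := by
  classical
  refine ⟨m.support.sup id, le_antisymm (sum_Icc_le_numV m _) ?_⟩
  unfold numV Finsupp.sum
  refine Finset.sum_le_sum_of_subset fun j hj => ?_
  rw [Finset.mem_Icc]
  refine ⟨?_, Finset.le_sup (f := id) hj⟩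
  rcases Nat.eq_zero_or_pos j with rfl | h
  · simp [h0] at hj
  · exact h

lemma degOf_pos (m : ℕ →₀ ℕ) (h0 : m 0 = 0) (i : Fin (numV m)) : 0 < degOf m i := by
  obtain ⟨k, hk⟩ := exists_sum_Icc_eq_numV m h0
  rw [Nat.pos_iff_ne_zero]
  intro h
  unfold degOf at h
  have hne : {j : ℕ | (i : ℕ) < ∑ k ∈ Finset.Icc 1 j, m k}.Nonempty := ⟨k, by
    show (i : ℕ) < _
    rw [hk]; exact i.2⟩
  have := Nat.sInf_mem hne
  rw [h] at this
  simp at this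

lemma card_degOf_eq (m : ℕ →₀ ℕ) (h0 : m 0 = 0) (k : ℕ) :
    (Finset.univ.filter fun i : Fin (numV m) => degOf m i = k).card = m k := by
  rcases k with _ | k
  · rw [h0, Finset.card_eq_zero, Finset.filter_eq_empty_iff]
    intro i _
    exact (degOf_pos m h0 i).ne'
  · have h1 : (Finset.univ.filter fun i : Fin (numV m) => degOf m i = k + 1).map
        Fin.valEmbedding =
        Finset.Ico (∑ j ∈ Finset.Icc 1 k, m j) (∑ j ∈ Finset.Icc 1 (k + 1), m j) := by
      ext i
      simp only [Finset.mem_map, Finset.mem_filter, Finset.mem_univ, true_and, degOf_eq_iff,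
        Finset.mem_Ico, Fin.valEmbedding_apply]
      constructor
      · rintro ⟨a, h, rfl⟩; exact h
      · intro h
        exact ⟨⟨i, h.2.trans_le (sum_Icc_le_numV m _)⟩, h, rfl⟩
    rw [← Finset.card_map Fin.valEmbedding, h1, Nat.card_Ico,
      Finset.sum_Icc_succ_top (by omega)]
    omega

lemma exists_degOf_equiv {V : Type*} [Fintype V] (δ : V → ℕ) (hδ : ∀ v, 0 < δ v)
    (m : ℕ →₀ ℕ) (hm : m = ∑ v, Finsupp.single (δ v) 1) :
    ∃ e : V ≃ Fin (numV m), ∀ v, degOf m (e v) = δ v := by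
  classical
  have hval : ∀ k, m k = (Finset.univ.filter fun v => δ v = k).card := by
    intro k
    rw [hm, Finsupp.finsetSum_apply, Finset.card_filter]
    exact Finset.sum_congr rfl fun v _ => by rw [Finsupp.single_apply]
  have h0 : m 0 = 0 := by
    rw [hval, Finset.card_eq_zero, Finset.filter_eq_empty_iff]
    exact fun v _ => (hδ v).ne'
  have hfib : ∀ k, Nonempty ({v // δ v = k} ≃ {i : Fin (numV m) // degOf m i = k}) := by
    intro k
    rw [← Fintype.card_eq, Fintype.card_subtype, Fintype.card_subtype, card_degOf_eq m h0, hval]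
  let e := fun k => (hfib k).some
  refine ⟨(Equiv.sigmaFiberEquiv δ).symm.trans ((Equiv.sigmaCongrRight e).trans
    (Equiv.sigmaFiberEquiv fun i : Fin (numV m) => degOf m i)), fun v => ?_⟩
  exact (e (δ v) ⟨v, rfl⟩).2

end Degrees

section Transfer

lemma matchCount_congr_equiv {α β : Type*} [Fintype α] [Fintype β] (e : α ≃ β)
    {P : (α → α) → Prop} {Q : (β → β) → Prop}
    (h : ∀ f, P f ↔ Q fun b => e (f (e.symm b))) :
    matchCount Finset.univ P = matchCount Finset.univ Q := by
  classical
  unfold matchCount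
  refine Finset.card_equiv (e.arrowCongr e) fun f => ?_
  have h1 : (e.arrowCongr e) f = fun b => e (f (e.symm b)) := rfl
  rw [h1, Finset.mem_filter, Finset.mem_filter, ← h f]
  simp only [Finset.mem_univ, true_and, IsMatchingOn, iff_true, Equiv.symm_apply_apply]
  refine and_congr_left fun _ => and_congr ?_ ?_
  · constructor
    · intro h b; rw [h]; simp
    · intro h a
      have := h (e a)
      simpa using this
  · constructor
    · intro h b hb
      exact h (e.symm b) (e.injective (by rw [hb, Equiv.apply_symm_apply]))
    · intro h a ha
      exact h (e a) (by simp [ha])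

lemma isMatchingOn_univ {m : ℕ →₀ ℕ} {f : HalfEdges m → HalfEdges m} :
    IsMatchingOn Finset.univ f ↔ IsConfig m f := by
  simp [IsMatchingOn, IsConfig, Function.Involutive]

lemma ncard_config (m : ℕ →₀ ℕ) (P : (HalfEdges m → HalfEdges m) → Prop) :
    Set.ncard {f | IsConfig m f ∧ P f} = matchCount Finset.univ P := by
  classical
  unfold matchCount
  rw [← Set.ncard_coe_finset]
  congr 1
  ext f
  simp [isMatchingOn_univ]

lemma isSimple_iff {m : ℕ →₀ ℕ} {f : HalfEdges m → HalfEdges m} :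
    IsSimple m f ↔ IsSimpleOn Sigma.fst Finset.univ f := by
  unfold IsSimple IsSimpleOn
  simp only [Finset.mem_univ, true_imp_iff]
  refine and_congr_right fun h1 => forall_congr' fun x => forall_congr' fun y =>
    imp_congr_right fun h2 => imp_congr_right fun h3 => ?_
  refine or_iff_left ?_
  rintro rfl
  exact h1 _ h2

lemma isConn_iff {m : ℕ →₀ ℕ} (h0 : m 0 = 0) {f : HalfEdges m → HalfEdges m} :
    IsConn m f ↔ IsConnOn Sigma.fst Finset.univ f := by
  unfold IsConn IsConnOn
  simp only [Finset.mem_univ, true_imp_iff]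
  constructor
  · intro h c hc x y hx
    have hall : ∀ w, Relation.ReflTransGen (adj m f) x.1 w → c w := by
      intro w hw
      induction hw with
      | refl => exact hx
      | tail _ h2 ih =>
        obtain ⟨j, j', hj⟩ := h2
        have h3 := hc ⟨_, j⟩ ih
        rwa [hj] at h3
    exact hall _ (h x.1 y.1)
  · intro h u v
    have := h (fun w => Relation.ReflTransGen (adj m f) u w) ?_ ⟨u, 0, degOf_pos m h0 u⟩
      ⟨v, 0, degOf_pos m h0 v⟩ Relation.ReflTransGen.refl
    · exact this
    · intro x hx
      exact hx.tail ⟨x.2, (f x).2, rfl⟩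

lemma cC_eq (m : ℕ →₀ ℕ) : cC m = matchCount (α := HalfEdges m) Finset.univ fun _ => True := by
  rw [← ncard_config]; simp [cC]

lemma cCc_eq (m : ℕ →₀ ℕ) (h0 : m 0 = 0) :
    cCc m = matchCount (α := HalfEdges m) Finset.univ (IsConnOn Sigma.fst Finset.univ) := by
  rw [← ncard_config]
  simp only [cCc, isConn_iff h0]

lemma cS_eq (m : ℕ →₀ ℕ) :
    cS m = matchCount (α := HalfEdges m) Finset.univ (IsSimpleOn Sigma.fst Finset.univ) := by
  rw [← ncard_config]
  unfold cS
  congr 1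
  ext f
  exact and_congr_right fun _ => isSimple_iff

lemma cSc_eq (m : ℕ →₀ ℕ) (h0 : m 0 = 0) :
    cSc m = matchCount (α := HalfEdges m) Finset.univ
      fun f => IsConnOn Sigma.fst Finset.univ f ∧ IsSimpleOn Sigma.fst Finset.univ f := by
  rw [← ncard_config]
  unfold cSc
  congr 1
  ext f
  exact and_congr_right fun _ => by rw [isSimple_iff, isConn_iff h0, and_comm]

lemma isConnOn_conj_iff {α β V W : Type*} [Fintype α] [Fintype β] (E : α ≃ β) (e : V ≃ W)
    {π : α → V} {π' : β → W} (hE : ∀ a, π' (E a) = e (π a)) {f : α → α} :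
    IsConnOn π Finset.univ f ↔ IsConnOn π' Finset.univ fun b => E (f (E.symm b)) := by
  have hE' : ∀ b, π (E.symm b) = e.symm (π' b) := fun b => by
    rw [Equiv.eq_symm_apply, ← hE, Equiv.apply_symm_apply]
  unfold IsConnOn
  simp only [Finset.mem_univ, true_imp_iff]
  constructor
  · intro h c hc x y hx
    have := h (fun v => c (e v)) ?_ (E.symm x) (E.symm y)
    · simp only [hE', Equiv.apply_symm_apply] at this
      exact this hx
    · intro a ha
      have := hc (E a) (by rwa [hE])
      simpa [hE] using this
  · intro h c hc x y hx
    have := h (fun v => c (e.symm v)) ?_ (E x) (E y)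
    · simp only [hE, Equiv.symm_apply_apply] at this
      exact this hx
    · intro a ha
      have := hc (E.symm a) (by rwa [hE'])
      simpa [hE] using this

lemma isSimpleOn_conj_iff {α β V W : Type*} [Fintype α] [Fintype β] (E : α ≃ β) (e : V ≃ W)
    {π : α → V} {π' : β → W} (hE : ∀ a, π' (E a) = e (π a)) {f : α → α} :
    IsSimpleOn π Finset.univ f ↔ IsSimpleOn π' Finset.univ fun b => E (f (E.symm b)) := by
  unfold IsSimpleOn
  simp only [Finset.mem_univ, true_imp_iff]
  rw [← E.forall_congr_right (q := fun h => π' _ ≠ π' h),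
    ← E.forall_congr_right (q := fun h => ∀ h', π' h = π' h' → _ → _)]
  simp only [hE, Equiv.symm_apply_apply, ne_eq, EmbeddingLike.apply_eq_iff_eq]
  refine and_congr_right fun _ => forall_congr' fun x => ?_
  rw [← E.forall_congr_right]
  simp only [hE, Equiv.symm_apply_apply, EmbeddingLike.apply_eq_iff_eq]

lemma cSc_eq_matchCount {V : Type*} [Fintype V] (δ : V → ℕ) (hδ : ∀ v, 0 < δ v)
    (m : ℕ →₀ ℕ) (hm : m = ∑ v, Finsupp.single (δ v) 1) :
    cSc m = matchCount (α := Σ v, Fin (δ v)) Finset.univ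
      fun f => IsConnOn Sigma.fst Finset.univ f ∧ IsSimpleOn Sigma.fst Finset.univ f := by
  classical
  obtain ⟨e, he⟩ := exists_degOf_equiv δ hδ m hm
  have h0 : m 0 = 0 := by
    rw [hm, Finsupp.finsetSum_apply]
    exact Finset.sum_eq_zero fun v _ => Finsupp.single_eq_of_ne (hδ v).ne
  rw [cSc_eq m h0]
  symm
  let E : (Σ v, Fin (δ v)) ≃ HalfEdges m :=
    Equiv.sigmaCongr e fun v => finCongr (he v).symm
  have hE : ∀ a, (E a).1 = e a.1 := fun a => rfl
  refine matchCount_congr_equiv E fun f => ?_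
  exact and_congr (isConnOn_conj_iff E e hE) (isSimpleOn_conj_iff E e hE)

lemma sum_degOf {M : Type*} [AddCommMonoid M] (m : ℕ →₀ ℕ) (h0 : m 0 = 0) (g : ℕ → M) :
    ∑ v : Fin (numV m), g (degOf m v) = m.sum fun k c => c • g k := by
  classical
  have hmem : ∀ v : Fin (numV m), degOf m v ∈ m.support := by
    intro v
    rw [Finsupp.mem_support_iff, ← card_degOf_eq m h0]
    exact Finset.card_ne_zero_of_mem (by simp : v ∈ _)
  rw [← Finset.sum_fiberwise_of_maps_to (fun v _ => hmem v)]
  refine Finset.sum_congr rfl fun k _ => ?_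
  rw [Finset.sum_congr rfl (g := fun _ => g k) (fun v hv => by rw [(Finset.mem_filter.1 hv).2]),
    Finset.sum_const, card_degOf_eq m h0]

lemma card_halfEdges (m : ℕ →₀ ℕ) (h0 : m 0 = 0) :
    Fintype.card (HalfEdges m) = totalDeg m := by
  rw [Fintype.card_sigma]
  simp only [Fintype.card_fin]
  rw [sum_degOf m h0 (fun k => k)]
  unfold totalDeg
  exact Finsupp.sum_congr fun k _ => by rw [smul_eq_mul, mul_comm]

open scoped Nat in
lemma cC_of_even (m : ℕ →₀ ℕ) (h0 : m 0 = 0) (hm : Even (totalDeg m)) :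
    cC m = (totalDeg m - 1)‼ := by
  classical
  rw [cC_eq, matchCount_true_of_even, Finset.card_univ, card_halfEdges m h0]
  rwa [Finset.card_univ, card_halfEdges m h0]

lemma cCc_le_cC (m : ℕ →₀ ℕ) : cCc m ≤ cC m :=
  Set.ncard_le_ncard (fun _ h => h.1) (Set.toFinite _)

lemma cSc_le_cCc (m : ℕ →₀ ℕ) : cSc m ≤ cCc m :=
  Set.ncard_le_ncard (fun _ h => ⟨h.1, h.2.2⟩) (Set.toFinite _)

lemma cSc_le_cS (m : ℕ →₀ ℕ) : cSc m ≤ cS m :=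
  Set.ncard_le_ncard (fun _ h => ⟨h.1, h.2.1⟩) (Set.toFinite _)

lemma cS_le_cC (m : ℕ →₀ ℕ) : cS m ≤ cC m :=
  Set.ncard_le_ncard (fun _ h => h.1) (Set.toFinite _)

lemma cC_of_odd (m : ℕ →₀ ℕ) (h0 : m 0 = 0) (hm : Odd (totalDeg m)) : cC m = 0 := by
  classical
  rw [cC_eq, matchCount_of_odd]
  rwa [Finset.card_univ, card_halfEdges m h0]

end Transfer

end PaperCM

namespace PaperCM

section Products

open scoped Nat

lemma doubleFactorial_pred_le (n : ℕ) : (n - 1)‼ ≤ n‼ := by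
  induction n using Nat.twoStepInduction with
  | zero => rfl
  | one => simp [Nat.doubleFactorial]
  | more n ih _ =>
    rw [Nat.doubleFactorial_add_two]
    rcases n with _ | n
    · simp [Nat.doubleFactorial]
    · rw [show n + 1 + 2 - 1 = n + 2 by omega, Nat.doubleFactorial_add_two]
      exact Nat.mul_le_mul (by omega) ih

lemma doubleFactorial_odd_split (a k : ℕ) :
    (2 * a + 2 * k - 1)‼ = (∏ i ∈ Finset.range k, (2 * a + 2 * i + 1)) * (2 * a - 1)‼ := by
  induction k with
  | zero => simp
  | succ k ih =>
    rw [Finset.prod_range_succ, mul_comm (∏ i ∈ Finset.range k, _), mul_assoc, ← ih]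
    rcases Nat.eq_zero_or_pos (2 * a + 2 * k) with h | h
    · rw [show 2 * a + 2 * (k + 1) - 1 = 1 by omega, show 2 * a + 2 * k - 1 = 0 by omega, h]
      rfl
    · obtain ⟨j, hj⟩ : ∃ j, 2 * a + 2 * k = j + 1 := ⟨2 * a + 2 * k - 1, by omega⟩
      rw [show 2 * a + 2 * (k + 1) - 1 = j + 2 by omega, Nat.doubleFactorial_add_two, hj]
      rfl

lemma prod_shift (a k s : ℕ) :
    (∏ i ∈ Finset.range k, (a + 2 * i)) * ∏ i ∈ Finset.range s, (a + 2 * (k + i)) =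
      (∏ i ∈ Finset.range s, (a + 2 * i)) * ∏ i ∈ Finset.range k, (a + 2 * (s + i)) := by
  rw [← Finset.prod_range_add, ← Finset.prod_range_add, add_comm]

lemma prod_greedy_ge (R R' b k L : ℕ) (hb : 2 * b + 2 ≤ R) (hR' : R' ≤ 2 * R)
    (hL : R + R' + 2 * k ≤ L) :
    R ^ (2 * R) * ∏ i ∈ Finset.range k, (R + R' + 2 * i + 1) ≤
      (∏ i ∈ Finset.range k, (R + 2 * i - b)) * (10 * L) ^ (2 * R) := by
  obtain ⟨a, ha⟩ : ∃ a, R = a + b := ⟨R - b, by omega⟩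
  have e : ∀ i ∈ Finset.range k, R + 2 * i - b = a + 2 * i := fun i _ => by omega
  rw [Finset.prod_congr rfl e]
  have h1 : ∏ i ∈ Finset.range (2 * R), (a + 2 * (k + i)) ≤ (5 * L) ^ (2 * R) := by
    rw [← Finset.card_range (2 * R), ← Finset.prod_const, Finset.card_range]
    refine Finset.prod_le_prod' fun i hi => ?_
    rw [Finset.mem_range] at hi
    omega
  have h2 : a ^ (2 * R) ≤ ∏ i ∈ Finset.range (2 * R), (a + 2 * i) := by
    conv_lhs => rw [← Finset.card_range (2 * R), ← Finset.prod_const]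
    exact Finset.prod_le_prod' fun i hi => by omega
  have h3 : ∏ i ∈ Finset.range k, (R + R' + 2 * i + 1) ≤
      ∏ i ∈ Finset.range k, (a + 2 * (2 * R + i)) :=
    Finset.prod_le_prod' fun i hi => by omega
  calc R ^ (2 * R) * ∏ i ∈ Finset.range k, (R + R' + 2 * i + 1)
      ≤ (2 * a) ^ (2 * R) * ∏ i ∈ Finset.range k, (a + 2 * (2 * R + i)) :=
        Nat.mul_le_mul (Nat.pow_le_pow_left (by omega) _) h3
    _ = 2 ^ (2 * R) * (a ^ (2 * R) * ∏ i ∈ Finset.range k, (a + 2 * (2 * R + i))) := by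
        rw [mul_pow, mul_assoc]
    _ ≤ 2 ^ (2 * R) * ((∏ i ∈ Finset.range (2 * R), (a + 2 * i)) *
          ∏ i ∈ Finset.range k, (a + 2 * (2 * R + i))) := by gcongr
    _ = 2 ^ (2 * R) * ((∏ i ∈ Finset.range k, (a + 2 * i)) *
          ∏ i ∈ Finset.range (2 * R), (a + 2 * (k + i))) := by rw [prod_shift]
    _ ≤ 2 ^ (2 * R) * ((∏ i ∈ Finset.range k, (a + 2 * i)) * (5 * L) ^ (2 * R)) := by gcongr
    _ = (∏ i ∈ Finset.range k, (a + 2 * i)) * (10 * L) ^ (2 * R) := by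
        rw [show 10 * L = 2 * (5 * L) by ring, mul_pow 2 (5 * L)]; ring

lemma pow_self_le_factorial (r : ℕ) : r ^ r ≤ 3 ^ r * r ! := by
  have h := Real.pow_div_factorial_le_exp (r : ℝ) (by positivity) r
  rw [div_le_iff₀ (by positivity)] at h
  have h2 : Real.exp r ≤ 3 ^ r := by
    rw [← Real.exp_one_pow]
    exact pow_le_pow_left₀ (Real.exp_pos 1).le (Real.exp_one_lt_d9.le.trans (by norm_num)) _
  have h3 : (r : ℝ) ^ r ≤ 3 ^ r * r ! := h.trans (by gcongr)
  exact_mod_cast h3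

lemma doubleFactorial_three_mul_le (r : ℕ) (hr : 0 < r) :
    (2 * (3 * r) - 1)‼ ≤ 6 ^ (2 * r) * ((2 * (2 * r))‼ * (2 * r - 2)‼) := by
  obtain ⟨q, rfl⟩ : ∃ q, r = q + 1 := ⟨r - 1, by omega⟩
  have h1 := doubleFactorial_odd_split (2 * (q + 1)) (q + 1)
  rw [show 2 * (2 * (q + 1)) + 2 * (q + 1) = 2 * (3 * (q + 1)) by ring] at h1
  rw [h1]
  have h2 : ∏ i ∈ Finset.range (q + 1), (2 * (2 * (q + 1)) + 2 * i + 1) ≤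
      (6 * (q + 1)) ^ (q + 1) := by
    conv_rhs => rw [← Finset.card_range (q + 1), ← Finset.prod_const, Finset.card_range]
    refine Finset.prod_le_prod' fun i hi => ?_
    rw [Finset.mem_range] at hi
    omega
  have h3 : (2 * (2 * (q + 1)) - 1)‼ ≤ (2 * (2 * (q + 1)))‼ :=
    doubleFactorial_pred_le _
  have h4 : (6 * (q + 1)) ^ (q + 1) ≤ 6 ^ (2 * (q + 1)) * (2 * (q + 1) - 2)‼ := by
    have h5 : (2 * (q + 1) - 2)‼ = 2 ^ q * q ! := by
      rw [show 2 * (q + 1) - 2 = 2 * q by omega, Nat.doubleFactorial_two_mul]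
    rw [h5, mul_pow]
    have h6 := pow_self_le_factorial (q + 1)
    have h7 : q + 1 ≤ 2 ^ (q + 1) := Nat.lt_two_pow_self.le
    have h8 : 1 ≤ 2 ^ q := Nat.one_le_two_pow
    calc 6 ^ (q + 1) * (q + 1) ^ (q + 1) ≤ 6 ^ (q + 1) * (3 ^ (q + 1) * (q + 1)!) := by gcongr
      _ = 6 ^ (q + 1) * 3 ^ (q + 1) * (q + 1) * q ! := by rw [Nat.factorial_succ]; ring
      _ ≤ 6 ^ (q + 1) * 3 ^ (q + 1) * 2 ^ (q + 1) * q ! := by gcongr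
      _ = 6 ^ (2 * (q + 1)) * (1 * q !) := by
          rw [mul_assoc (6 ^ (q + 1)), ← mul_pow, two_mul, pow_add]; ring
      _ ≤ _ := by gcongr
  calc _ ≤ (6 * (q + 1)) ^ (q + 1) * (2 * (2 * (q + 1)))‼ := Nat.mul_le_mul h2 h3
    _ ≤ (6 ^ (2 * (q + 1)) * (2 * (q + 1) - 2)‼) * (2 * (2 * (q + 1)))‼ := by gcongr
    _ = _ := by ring

end Products

section Simple

open scoped Nat

/-- A configuration with many leaves and without large degrees is simple with a probability
which is not too small. -/
lemma cC_le_cS (m : ℕ →₀ ℕ) (h0 : m 0 = 0) (Δ R : ℕ) (hΔ : ∀ k ∈ m.support, k ≤ Δ)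
    (hR : R ≤ m 1) (hb : 2 * (Δ + Δ ^ 2) + 2 ≤ R) (hL : 2 * R ≤ totalDeg m) :
    R ^ (2 * R) * cC m ≤ (20 * totalDeg m) ^ (2 * R) * cS m := by
  classical
  rcases (totalDeg m).even_or_odd with he | ho
  swap
  · rw [cC_of_odd m h0 ho]; simp
  obtain ⟨k, hk⟩ : ∃ k, totalDeg m = 2 * R + 2 * k := by
    obtain ⟨j, hj⟩ := he
    exact ⟨j - R, by omega⟩
  rw [← card_degOf_eq m h0] at hR
  obtain ⟨Λ, hΛ, hΛR⟩ := Finset.exists_subset_card_eq hR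
  let Sr : Finset (HalfEdges m) := Λ.sigma fun _ => Finset.univ
  have hSr : ∀ h : HalfEdges m, h ∈ Sr ↔ h.1 ∈ Λ := fun h => by simp [Sr]
  have hdeg1 : ∀ v ∈ Λ, degOf m v = 1 := fun v hv => (Finset.mem_filter.1 (hΛ hv)).2
  have hSrc : Sr.card = R := by
    rw [Finset.card_sigma, Finset.sum_congr rfl (g := fun _ => 1)]
    · simpa using hΛR
    · intro v hv; simp [hdeg1 v hv]
  have hinj : ∀ h ∈ Sr, ∀ h' : HalfEdges m, h.1 = h'.1 → h = h' := by
    rintro ⟨v, j⟩ hh ⟨v', j'⟩ he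
    dsimp only at he
    subst he
    congr 1
    have h1 := hdeg1 v ((hSr _).1 hh)
    have := j.2
    have := j'.2
    ext
    omega
  let Su : Finset (HalfEdges m) := Srᶜ
  have huniv : Su ∪ Sr = Finset.univ := by
    simp only [Su, Finset.union_comm, Finset.union_compl]
  have hdisj : Disjoint Su Sr := disjoint_compl_left
  have hSuc : Su.card = R + 2 * k := by
    have := Finset.card_union_of_disjoint hdisj
    rw [huniv, Finset.card_univ, card_halfEdges m h0, hSrc] at this
    omega
  have hdegle : ∀ v : Fin (numV m), degOf m v ≤ Δ := by
    intro v
    refine hΔ _ ?_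
    rw [Finsupp.mem_support_iff, ← card_degOf_eq m h0]
    exact Finset.card_ne_zero_of_mem (by simp : v ∈ _)
  have hcount : (∏ i ∈ Finset.range k, (R + 2 * i - (Δ + Δ ^ 2))) * R ! ≤ cS m := by
    rw [cS_eq]
    have h1 := le_matchCount_of_exploration False (Sigma.fst : HalfEdges m → Fin (numV m))
      (fun h => decide (h ∈ Sr)) false Δ R (R !) Sr ?_ k Su (fun h => decide (h ∈ Sr))
      (fun _ _ => False) ?_ hSuc
    · rw [huniv] at h1
      exact h1.trans (matchCount_mono fun f _ h => h.2.1)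
    · intro Su' κ Adj st hc
      exact le_matchCount_of_leaves _ _ _ _ _ _ st.disj hc hSrc
        (fun h hh h' _ he => hinj h hh h' he)
        (fun h hh h' hh' he => ((st.res h' hh').2.2 h hh).2 he.symm) st.symm st.resAdj
    · refine ⟨hdisj, ?_, ?_, ?_, by simp, by simp, ?_⟩
      · rintro ⟨h, hh⟩
        exact ⟨h, hh, by simpa [Su] using hh⟩
      · intro h hh hne
        simp [Su] at hh hne
        exact absurd hne hh
      · intro h hh
        refine ⟨rfl, by simp [hh], fun h' hh' => ?_⟩
        have h2 : h' ∉ Sr := by simpa [Su] using hh'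
        refine ⟨by simp [hh, h2], fun e => ?_⟩
        rw [hinj h hh h' e] at hh
        exact h2 hh
      · intro v
        have h3 : (Su.filter fun h => h.1 = v).card ≤ Δ := by
          refine le_trans ?_ (hdegle v)
          rw [← Finset.card_fin (degOf m v), ← Finset.card_map
            (⟨fun j => ⟨v, j⟩, fun j j' e => by simpa using e⟩ :
              Fin (degOf m v) ↪ HalfEdges m)]
          refine Finset.card_le_card ?_
          rintro ⟨w, j⟩ hj
          have := (Finset.mem_filter.1 hj).2
          dsimp only at this
          subst this
          exact Finset.mem_map.2 ⟨j, Finset.mem_univ _, rfl⟩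
        refine ⟨by convert h3, ∅, by simp, ?_⟩
        rw [Finset.card_empty, zero_add]
        convert h3
  have hsplit := doubleFactorial_odd_split R k
  rw [cC_of_even m h0 he, hk, hsplit]
  have hprod := prod_greedy_ge R R (Δ + Δ ^ 2) k (2 * R + 2 * k) hb (by omega) (by omega)
  have hfac : (2 * R - 1)‼ ≤ 2 ^ R * R ! := by
    rw [← Nat.doubleFactorial_two_mul]
    exact doubleFactorial_pred_le _
  calc R ^ (2 * R) * ((∏ i ∈ Finset.range k, (2 * R + 2 * i + 1)) * (2 * R - 1)‼)
      = (R ^ (2 * R) * ∏ i ∈ Finset.range k, (R + R + 2 * i + 1)) * (2 * R - 1)‼ := by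
        rw [← two_mul R, mul_assoc]
    _ ≤ ((∏ i ∈ Finset.range k, (R + 2 * i - (Δ + Δ ^ 2))) * (10 * (2 * R + 2 * k)) ^ (2 * R)) *
          (2 ^ R * R !) := Nat.mul_le_mul hprod hfac
    _ = (2 ^ R * (10 * (2 * R + 2 * k)) ^ (2 * R)) *
          ((∏ i ∈ Finset.range k, (R + 2 * i - (Δ + Δ ^ 2))) * R !) := by ring
    _ ≤ (2 ^ (2 * R) * (10 * (2 * R + 2 * k)) ^ (2 * R)) * cS m := by
        refine Nat.mul_le_mul (Nat.mul_le_mul_right _ ?_) hcount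
        exact Nat.pow_le_pow_right (by norm_num) (by omega)
    _ = _ := by rw [← mul_pow]; ring_nf

end Simple

end PaperCM

namespace PaperCM

section Components

variable {α β V W : Type*} [DecidableEq α] [Fintype α] [Fintype β]

lemma matchCount_univ_le_map (ι : β ↪ α) {P : (β → β) → Prop} {Q : (α → α) → Prop}
    (h : ∀ f g, (∀ b, g (ι b) = ι (f b)) → P f → Q g) :
    matchCount Finset.univ P ≤ matchCount (Finset.univ.map ι) Q := by
  classical
  unfold matchCount
  have hin : ∀ (f : β → β) b, Function.extend ι (ι ∘ f) id (ι b) = ι (f b) := fun f b =>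
    ι.injective.extend_apply _ _ _
  have hout : ∀ (f : β → β) a, (¬ ∃ b, ι b = a) → Function.extend ι (ι ∘ f) id a = a :=
    fun f a ha => Function.extend_apply' _ _ _ ha
  refine Finset.card_le_card_of_injOn (fun f => Function.extend ι (ι ∘ f) id) ?_ ?_
  · intro f hf
    simp only [Finset.coe_filter, Finset.mem_univ, true_and, Set.mem_ofPred_eq] at hf ⊢
    refine ⟨⟨fun a => ?_, fun a => ?_⟩, h f _ (hin f) hf.2⟩
    · by_cases ha : ∃ b, ι b = a
      · obtain ⟨b, rfl⟩ := ha
        rw [hin, hin, hf.1.1]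
      · rw [hout f a ha, hout f a ha]
    · by_cases ha : ∃ b, ι b = a
      · obtain ⟨b, rfl⟩ := ha
        rw [hin]
        simpa using hf.1.2 b
      · rw [hout f a ha]
        simpa using ha
  · intro f _ g _ hfg
    funext b
    have := congrFun hfg (ι b)
    dsimp only at this
    rw [hin, hin] at this
    exact ι.injective this

lemma matchCount_mul_le {S T : Finset α} (hST : Disjoint S T) {P Q : (α → α) → Prop}
    {X : (α → α) → Prop}
    (h : ∀ f g, IsMatchingOn S f → P f → Q g → (∀ a ∈ S, g a = f a) → X g)
    (hQ : ∀ g, Q g) :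
    matchCount S P * matchCount T Q ≤ matchCount (S ∪ T) X := by
  classical
  unfold matchCount
  rw [← Finset.card_product]
  have hS : ∀ f g : α → α, IsMatchingOn S f → IsMatchingOn T g → ∀ a ∈ S, f (g a) = f a :=
    fun f g _ hg a ha => by rw [hg.apply_of_notMem (Finset.disjoint_left.1 hST ha)]
  have hT : ∀ f g : α → α, IsMatchingOn S f → IsMatchingOn T g → ∀ a, a ∉ S → f (g a) = g a := by
    intro f g hf hg a ha
    by_cases haT : a ∈ T
    · rw [hf.apply_of_notMem (Finset.disjoint_right.1 hST (hg.apply_mem haT))]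
    · rw [hg.apply_of_notMem haT, hf.apply_of_notMem ha]
  refine Finset.card_le_card_of_injOn (fun z => z.1 ∘ z.2) ?_ ?_
  · rintro ⟨f, g⟩ hfg
    simp only [Finset.coe_product, Finset.coe_filter, Finset.mem_univ, true_and, Set.mem_prod,
      Set.mem_ofPred_eq] at hfg ⊢
    obtain ⟨⟨hf, hPf⟩, hg, -⟩ := hfg
    refine ⟨⟨fun a => ?_, fun a => ?_⟩, h f _ hf hPf (hQ _) (hS f g hf hg)⟩
    · by_cases ha : a ∈ S
      · rw [Function.comp_apply, Function.comp_apply, hS f g hf hg a ha,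
          hS f g hf hg _ (hf.apply_mem ha), hf.1]
      · rw [Function.comp_apply, Function.comp_apply, hT f g hf hg a ha]
        by_cases haT : a ∈ T
        · rw [hT f g hf hg _ (Finset.disjoint_right.1 hST (hg.apply_mem haT)), hg.1]
        · rw [hg.apply_of_notMem haT, hg.apply_of_notMem haT, hf.apply_of_notMem ha]
    · by_cases ha : a ∈ S
      · rw [Function.comp_apply, hS f g hf hg a ha, hf.2]
        simp [ha]
      · rw [Function.comp_apply, hT f g hf hg a ha, hg.2]
        simp [ha]
  · rintro ⟨f, g⟩ hfg ⟨f', g'⟩ hfg' he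
    simp only [Finset.coe_product, Finset.coe_filter, Finset.mem_univ, true_and, Set.mem_prod,
      Set.mem_ofPred_eq] at hfg hfg' he
    have he' : ∀ a, f (g a) = f' (g' a) := congrFun he
    refine Prod.ext (funext fun a => ?_) (funext fun a => ?_)
    · by_cases ha : a ∈ S
      · have := he' a
        rwa [hS f g hfg.1.1 hfg.2.1 a ha, hS f' g' hfg'.1.1 hfg'.2.1 a ha] at this
      · dsimp only
        rw [hfg.1.1.apply_of_notMem ha, hfg'.1.1.apply_of_notMem ha]
    · by_cases ha : a ∈ S
      · have hn := Finset.disjoint_left.1 hST ha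
        dsimp only
        rw [hfg.2.1.apply_of_notMem hn, hfg'.2.1.apply_of_notMem hn]
      · have := he' a
        rwa [hT f g hfg.1.1 hfg.2.1 a ha, hT f' g' hfg'.1.1 hfg'.2.1 a ha] at this

lemma sum_components_le [DecidableEq V] [Fintype V] (π : α → V) (hπ : Function.Surjective π)
    {N : ℕ} (𝒜 : Finset (Finset V)) (hne : ∀ A ∈ 𝒜, A.Nonempty)
    (hN : ∀ A ∈ 𝒜, N ≤ matchCount Finset.univ fun f => (∀ h, π h ∈ A → π (f h) ∈ A) ∧
      IsConnOn π (Finset.univ.filter fun h => π h ∈ A) f) :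
    𝒜.card * N ≤ Fintype.card V * matchCount (α := α) Finset.univ fun _ => True := by
  classical
  have key : ∀ A B : Finset V, ∀ f : α → α,
      IsConnOn π (Finset.univ.filter fun h => π h ∈ A) f → (∀ h, π h ∈ B → π (f h) ∈ B) →
      ∀ v ∈ A, v ∈ B → A ⊆ B := by
    intro A B f hA hB v hvA hvB w hw
    obtain ⟨x, rfl⟩ := hπ v
    obtain ⟨y, rfl⟩ := hπ w
    exact hA (fun u => u ∈ B) (fun h _ => hB h) x (by simpa using hvA) y (by simpa using hw) hvB
  rcases isEmpty_or_nonempty V with hV | hV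
  · have : 𝒜 = ∅ := by
      refine Finset.eq_empty_of_forall_notMem fun A hA => ?_
      obtain ⟨v, -⟩ := hne A hA
      exact hV.elim v
    simp [this]
  choose! g hg using hne
  calc 𝒜.card * N ≤ ∑ A ∈ 𝒜, matchCount Finset.univ fun f => (∀ h, π h ∈ A → π (f h) ∈ A) ∧
        IsConnOn π (Finset.univ.filter fun h => π h ∈ A) f := by
        rw [← smul_eq_mul]; exact Finset.card_nsmul_le_sum _ _ _ hN
    _ = (𝒜.sigma fun A => Finset.univ.filter fun f : α → α => IsMatchingOn Finset.univ f ∧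
          (∀ h, π h ∈ A → π (f h) ∈ A) ∧
          IsConnOn π (Finset.univ.filter fun h => π h ∈ A) f).card := by
        rw [Finset.card_sigma]
        refine Finset.sum_congr rfl fun A _ => ?_
        unfold matchCount
        congr!
    _ ≤ (Finset.univ ×ˢ Finset.univ.filter fun f : α → α =>
          IsMatchingOn Finset.univ f ∧ True : Finset (V × (α → α))).card := by
        refine Finset.card_le_card_of_injOn (fun z => (g z.1, z.2)) ?_ ?_
        · rintro ⟨A, f⟩ hz
          simp only [Finset.coe_sigma, Set.mem_sigma_iff, Finset.mem_coe, Finset.mem_filter,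
            Finset.mem_univ, true_and, Finset.mem_product, and_true] at hz ⊢
          exact hz.2.1
        · rintro ⟨A, f⟩ hz ⟨B, f'⟩ hz' he
          simp only [Finset.coe_sigma, Set.mem_sigma_iff, Finset.mem_coe, Finset.mem_filter,
            Finset.mem_univ, true_and, Prod.mk.injEq] at hz hz' he
          obtain ⟨hv, rfl⟩ := he
          have hAB : A = B := Finset.Subset.antisymm
            (key A B f hz.2.2.2 hz'.2.2.1 (g A) (hg A hz.1) (hv ▸ hg B hz'.1))
            (key B A f hz'.2.2.2 hz.2.2.1 (g A) (hv ▸ hg B hz'.1) (hg A hz.1))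
          rw [hAB]
    _ = _ := by
        rw [Finset.card_product, Finset.card_univ]
        unfold matchCount
        congr!

end Components

section VertexSets

open Classical in
/-- Number of vertex sets with a prescribed number of vertices of each degree. -/
lemma prod_choose_le_card {V : Type*} [Fintype V] (δ : V → ℕ) (m s : ℕ →₀ ℕ)
    (hδ : ∀ k, (Finset.univ.filter fun v => δ v = k).card = (m + s) k) :
    ∏ k ∈ (m + s).support, ((m + s) k).choose (m k) ≤
      (Finset.univ.filter fun A : Finset V => ∀ k, (A.filter fun v => δ v = k).card = m k).card := by
  classical
  have hcard : ((m + s).support.pi fun k =>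
      Finset.powersetCard (m k) (Finset.univ.filter fun v => δ v = k)).card
      = ∏ k ∈ (m + s).support, ((m + s) k).choose (m k) := by
    rw [Finset.card_pi]
    exact Finset.prod_congr rfl fun k _ => by rw [Finset.card_powersetCard, hδ]
  rw [← hcard]
  have hmemδ : ∀ v, δ v ∈ (m + s).support := by
    intro v
    rw [Finsupp.mem_support_iff, ← hδ]
    exact Finset.card_ne_zero_of_mem (by simp : v ∈ _)
  let F : (∀ k ∈ (m + s).support, Finset V) → Finset V := fun F =>
    Finset.univ.filter fun v => v ∈ F (δ v) (hmemδ v)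
  have hF : ∀ G ∈ (m + s).support.pi fun k =>
      Finset.powersetCard (m k) (Finset.univ.filter fun v => δ v = k),
      ∀ k hk, (F G).filter (fun v => δ v = k) = G k hk := by
    intro G hG k hk
    have h1 := (Finset.mem_powersetCard.1 (Finset.mem_pi.1 hG k hk)).1
    ext v
    simp only [F, Finset.mem_filter, Finset.mem_univ, true_and]
    constructor
    · rintro ⟨h, rfl⟩; exact h
    · intro h
      have : δ v = k := by simpa using h1 h
      subst this
      exact ⟨h, rfl⟩
  refine Finset.card_le_card_of_injOn F ?_ ?_
  · intro G hG
    rw [Finset.mem_coe] at hG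
    simp only [Finset.coe_filter, Finset.mem_univ, true_and, Set.mem_ofPred_eq]
    intro k
    by_cases hk : k ∈ (m + s).support
    · rw [hF G hG k hk]
      exact (Finset.mem_powersetCard.1 (Finset.mem_pi.1 hG k hk)).2
    · have h0 : (m + s) k = 0 := by simpa only [Finsupp.mem_support_iff, not_not] using hk
      have hm : m k = 0 := by
        rw [Finsupp.add_apply] at h0; omega
      rw [hm, Finset.card_eq_zero, Finset.filter_eq_empty_iff]
      rintro v _ rfl
      exact hk (hmemδ v)
  · intro G hG G' hG' he
    rw [Finset.mem_coe] at hG hG'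
    funext k hk
    rw [← hF G hG k hk, ← hF G' hG' k hk, he]

/-- Superposing a connected configuration and an arbitrary one. -/
lemma prod_choose_mul_le (m s : ℕ →₀ ℕ) (hm : m ≠ 0) (hm0 : m 0 = 0) (hs0 : s 0 = 0) :
    (∏ k ∈ (m + s).support, ((m + s) k).choose (m k)) * (cCc m * cC s) ≤
      numV (m + s) * cC (m + s) := by
  classical
  have h0 : (m + s) 0 = 0 := by simp [hm0, hs0]
  set M := m + s with hM
  have hπ : Function.Surjective (Sigma.fst : HalfEdges M → Fin (numV M)) := fun v =>
    ⟨⟨v, ⟨0, degOf_pos M h0 v⟩⟩, rfl⟩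
  have hN := sum_components_le (Sigma.fst : HalfEdges M → Fin (numV M)) hπ (N := cCc m * cC s)
    (Finset.univ.filter fun A : Finset (Fin (numV M)) =>
      ∀ k, (A.filter fun v : Fin (numV M) => degOf M v = k).card = m k) ?_ ?_
  · rw [← cC_eq, Fintype.card_fin] at hN
    refine le_trans (Nat.mul_le_mul_right _ ?_) hN
    exact prod_choose_le_card (fun v : Fin (numV M) => degOf M v) m s (card_degOf_eq M h0)
  · intro A hA
    by_contra hne
    rw [Finset.not_nonempty_iff_eq_empty] at hne
    subst hne
    apply hm
    ext k
    simpa using ((Finset.mem_filter.1 hA).2 k).symm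
  · intro A hA
    have hA' := (Finset.mem_filter.1 hA).2
    set S : Finset (HalfEdges M) := Finset.univ.filter fun h => h.1 ∈ A with hS
    have hAm : m = ∑ v : A, Finsupp.single (degOf M (v : Fin (numV M))) 1 := by
      ext k
      rw [Finsupp.finsetSum_apply, ← hA' k, Finset.card_filter]
      rw [← Finset.sum_coe_sort A]
      refine Finset.sum_congr rfl fun v _ => ?_
      rw [Finsupp.single_apply]
    obtain ⟨e, he⟩ := exists_degOf_equiv (fun v : A => degOf M (v : Fin (numV M)))
      (fun v => degOf_pos M h0 v) m hAm
    let ι : HalfEdges m ↪ HalfEdges M :=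
      ⟨fun x => ⟨e.symm x.1, ⟨x.2, by
        have := he (e.symm x.1)
        rw [Equiv.apply_symm_apply] at this
        rw [← this]; exact x.2.2⟩⟩, by
        rintro ⟨u, i⟩ ⟨v, j⟩ huv
        simp only [Sigma.mk.injEq] at huv
        obtain ⟨h1, h2⟩ := huv
        have huv : u = v := e.symm.injective (Subtype.ext h1)
        subst huv
        have h3 := eq_of_heq h2
        rw [Fin.mk.injEq] at h3
        exact congrArg _ (Fin.ext h3)⟩
    have hι : ∀ x, (ι x).1 = e.symm x.1 := fun x => rfl
    have hext : ∀ a b : HalfEdges M, a.1 = b.1 → (a.2 : ℕ) = b.2 → a = b := by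
      rintro ⟨u, i⟩ ⟨v, j⟩ h1 h2
      dsimp only at h1
      subst h1
      exact congrArg _ (Fin.ext h2)
    have hmap : Finset.univ.map ι = S := by
      ext ⟨v, i⟩
      simp only [Finset.mem_map, Finset.mem_univ, true_and, hS, Finset.mem_filter]
      constructor
      · rintro ⟨x, hx⟩
        have : (e.symm x.1 : Fin (numV M)) = v := congrArg Sigma.fst hx
        rw [← this]; exact (e.symm x.1).2
      · intro hv
        refine ⟨⟨e ⟨v, hv⟩, ⟨i, by rw [he ⟨v, hv⟩]; exact i.2⟩⟩, ?_⟩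
        refine hext _ _ ?_ rfl
        rw [hι]
        simp
    have h1 : cCc m ≤ matchCount S (fun f => IsConnOn Sigma.fst S f) := by
      rw [cCc_eq m hm0, ← hmap]
      refine matchCount_univ_le_map ι fun f g hfg hf => ?_
      intro c hc x hx y hy hcx
      obtain ⟨x, -, rfl⟩ := Finset.mem_map.1 hx
      obtain ⟨y, -, rfl⟩ := Finset.mem_map.1 hy
      refine hf (fun v => c (e.symm v)) ?_ x (Finset.mem_univ _) y (Finset.mem_univ _) hcx
      intro z _ hz
      have := hc (ι z) (Finset.mem_map_of_mem _ (Finset.mem_univ _)) hz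
      rw [hfg] at this
      exact this
    have hScard : S.card = totalDeg m := by
      rw [← hmap, Finset.card_map, Finset.card_univ, card_halfEdges m hm0]
    have hTcard : (Sᶜ).card = totalDeg s := by
      have h2 := Finset.card_add_card_compl S
      rw [card_halfEdges M h0, hScard] at h2
      have h3 : totalDeg M = totalDeg m + totalDeg s := by
        rw [hM]; unfold totalDeg
        exact Finsupp.sum_add_index' (by simp) (by intros; ring)
      omega
    have h2 : cC s ≤ matchCount Sᶜ (fun _ : HalfEdges M → HalfEdges M => True) := by
      rcases Nat.even_or_odd (totalDeg s) with hev | hodd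
      · rw [cC_of_even s hs0 hev, matchCount_true_of_even, hTcard]
        rwa [hTcard]
      · rw [cC_of_odd s hs0 hodd]
        exact Nat.zero_le _
    refine le_trans (Nat.mul_le_mul h1 h2) ?_
    have h3 := matchCount_mul_le (disjoint_compl_right (a := S)) (P := fun f => IsConnOn Sigma.fst S f)
      (Q := fun _ => True) (X := fun f => (∀ h : HalfEdges M, h.1 ∈ A → (f h).1 ∈ A) ∧
        IsConnOn Sigma.fst S f) ?_ (fun _ => trivial)
    · rwa [Finset.union_compl] at h3
    · intro f g hf hPf _ hgf
      refine ⟨fun h hh => ?_, fun c hc => hPf c fun h hh => ?_⟩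
      · have hhS : h ∈ S := by simp [hS, hh]
        rw [hgf h hhS]
        have := hf.apply_mem hhS
        simpa [hS] using this
      · have := hc h hh
        rwa [hgf h hh] at this

end VertexSets

end PaperCM

namespace PaperCM

section UpperBound

open scoped Nat

lemma doubleFactorial_add_le (a b : ℕ) :
    (2 * a + 2 * b - 1)‼ ≤ (2 * b + 1) * (a + b).choose b * ((2 * a - 1)‼ * (2 * b - 1)‼) := by
  induction b with
  | zero => simp
  | succ b ih =>
    have h1 : (2 * a + 2 * (b + 1) - 1)‼ = (2 * a + 2 * b + 1) * (2 * a + 2 * b - 1)‼ := by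
      rcases Nat.eq_zero_or_pos (2 * a + 2 * b) with h | h
      · have ha : a = 0 := by omega
        have hb : b = 0 := by omega
        subst ha hb; rfl
      · obtain ⟨c, hc⟩ : ∃ c, 2 * a + 2 * b = c + 1 := ⟨_, (Nat.succ_pred_eq_of_pos h).symm⟩
        rw [show 2 * a + 2 * (b + 1) - 1 = (c + 2) by omega, Nat.doubleFactorial_add_two,
          show 2 * a + 2 * b - 1 = c by omega, hc]
    have h2 : (2 * (b + 1) - 1)‼ = (2 * b + 1) * (2 * b - 1)‼ := by
      rcases b with _ | b
      · rfl
      · rw [show 2 * (b + 1 + 1) - 1 = (2 * b + 1) + 2 by omega, Nat.doubleFactorial_add_two,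
          show 2 * (b + 1) - 1 = 2 * b + 1 by omega]
        ring
    have h3 : (a + b + 1) * (a + b).choose b = (a + (b + 1)).choose (b + 1) * (b + 1) :=
      Nat.add_one_mul_choose_eq (a + b) b
    refine Nat.le_of_mul_le_mul_left ?_ (Nat.succ_pos b)
    calc (b + 1) * (2 * a + 2 * (b + 1) - 1)‼
        = ((b + 1) * (2 * a + 2 * b + 1)) * (2 * a + 2 * b - 1)‼ := by rw [h1]; ring
      _ ≤ ((2 * b + 3) * (a + b + 1)) *
          ((2 * b + 1) * (a + b).choose b * ((2 * a - 1)‼ * (2 * b - 1)‼)) := by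
          refine Nat.mul_le_mul ?_ ih
          nlinarith
      _ = (2 * b + 3) * ((a + b + 1) * (a + b).choose b) *
          ((2 * a - 1)‼ * ((2 * b + 1) * (2 * b - 1)‼)) := by ring
      _ = _ := by rw [h3, h2, Nat.succ_eq_add_one]; ring

lemma choose_mul_pow_le_one (a b : ℕ) {x : ℝ} (hx : 0 ≤ x) (hx1 : x ≤ 1) :
    ((a + b).choose b : ℝ) * x ^ b * (1 - x) ^ a ≤ 1 := by
  have h := add_pow x (1 - x) (a + b)
  rw [show x + (1 - x) = 1 by ring, one_pow] at h
  have hx' : 0 ≤ 1 - x := by linarith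
  refine le_trans (le_of_eq ?_) (le_of_le_of_eq (Finset.single_le_sum (f := fun m => x ^ m * (1 - x) ^ (a + b - m) *
    ((a + b).choose m : ℝ)) (fun i _ => by positivity) (Finset.mem_range.2 (by omega : b < a + b + 1))) h.symm)
  rw [Nat.add_sub_cancel]
  ring

lemma totalDeg_add (m s : ℕ →₀ ℕ) : totalDeg (m + s) = totalDeg m + totalDeg s := by
  unfold totalDeg
  exact Finsupp.sum_add_index' (by simp) (by intros; ring)

lemma numV_le_totalDeg (m : ℕ →₀ ℕ) (h0 : m 0 = 0) : numV m ≤ totalDeg m := by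
  unfold numV totalDeg
  refine Finset.sum_le_sum fun k hk => ?_
  rw [Finsupp.mem_support_iff] at hk
  have : k ≠ 0 := fun h => hk (h ▸ h0)
  exact Nat.le_mul_of_pos_left _ (Nat.pos_of_ne_zero this)

lemma prod_choose_subset_le (m s : ℕ →₀ ℕ) (T : Finset ℕ) :
    ∏ k ∈ T, ((m + s) k).choose (m k) ≤ ∏ k ∈ (m + s).support, ((m + s) k).choose (m k) := by
  classical
  rw [← Finset.prod_subset (Finset.inter_subset_left (s₁ := T) (s₂ := (m + s).support))]
  · refine Finset.prod_le_prod_of_subset_of_one_le' Finset.inter_subset_right fun k _ _ => ?_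
    exact Nat.choose_pos (by simp)
  · intro k hk hk'
    have h0 : (m + s) k = 0 := by
      by_contra h
      exact hk' (Finset.mem_inter.2 ⟨hk, Finsupp.mem_support_iff.2 h⟩)
    have : m k = 0 := by
      rw [Finsupp.add_apply] at h0; omega
    rw [h0, this]; rfl

lemma connRatio_mul_le_of_even (m s : ℕ →₀ ℕ) (hm : m ≠ 0) (hm0 : m 0 = 0) (hs0 : s 0 = 0)
    (hme : Even (totalDeg m)) (hse : Even (totalDeg s)) (T : Finset ℕ) {β : ℝ}
    (hβ0 : 0 ≤ β) (hβ1 : β ≤ 1) :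
    (cCc m : ℝ) / cC m * (∏ k ∈ T, (((m + s) k).choose (m k) : ℝ)) * β ^ totalDeg s *
      (1 - β ^ 2) ^ (totalDeg m / 2) ≤ (totalDeg m + totalDeg s) * (totalDeg s + 1) := by
  obtain ⟨a, ha⟩ := hme.two_dvd
  obtain ⟨b, hb⟩ := hse.two_dvd
  have h1 := prod_choose_mul_le m s hm hm0 hs0
  have h0 : (m + s) 0 = 0 := by simp [hm0, hs0]
  have hadd := totalDeg_add m s
  rw [cC_of_even (m + s) h0 (hadd ▸ hme.add hse), hadd, cC_of_even s hs0 hse] at h1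
  rw [cC_of_even m hm0 hme]
  rw [ha, hb] at h1 ⊢
  have h2 := doubleFactorial_add_le a b
  have h3 : numV (m + s) ≤ 2 * a + 2 * b := by
    have := numV_le_totalDeg (m + s) h0
    rwa [hadd, ha, hb] at this
  have hA : (0 : ℝ) < ((2 * a - 1)‼ : ℕ) := by exact_mod_cast Nat.doubleFactorial_pos _
  have hB : (0 : ℝ) < ((2 * b - 1)‼ : ℕ) := by exact_mod_cast Nat.doubleFactorial_pos _
  have h4 : (∏ k ∈ T, ((m + s) k).choose (m k)) * cCc m * (2 * b - 1)‼ ≤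
      ((2 * a + 2 * b) * ((2 * b + 1) * (a + b).choose b) * (2 * a - 1)‼) * (2 * b - 1)‼ := by
    calc (∏ k ∈ T, ((m + s) k).choose (m k)) * cCc m * (2 * b - 1)‼
        ≤ (∏ k ∈ (m + s).support, ((m + s) k).choose (m k)) * (cCc m * (2 * b - 1)‼) := by
          rw [mul_assoc]
          exact Nat.mul_le_mul_right _ (prod_choose_subset_le m s T)
      _ ≤ _ := h1
      _ ≤ (2 * a + 2 * b) * _ := Nat.mul_le_mul h3 h2
      _ = _ := by ring
  have h5 := Nat.le_of_mul_le_mul_right h4 (Nat.doubleFactorial_pos _)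
  have h5' : (∏ k ∈ T, (((m + s) k).choose (m k) : ℝ)) * cCc m ≤
      (2 * a + 2 * b) * ((2 * b + 1) * (a + b).choose b) * ((2 * a - 1)‼ : ℕ) := by
    exact_mod_cast h5
  have h6 := choose_mul_pow_le_one a b (x := β ^ 2) (by positivity) (by nlinarith)
  rw [show 2 * a / 2 = a by omega, div_mul_eq_mul_div, div_mul_eq_mul_div, div_mul_eq_mul_div,
    div_le_iff₀ hA, pow_mul]
  have hy : (0 : ℝ) ≤ (1 - β ^ 2) ^ a := pow_nonneg (by nlinarith) _
  calc (cCc m : ℝ) * (∏ k ∈ T, (((m + s) k).choose (m k) : ℝ)) * (β ^ 2) ^ b * (1 - β ^ 2) ^ a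
      ≤ (2 * a + 2 * b) * ((2 * b + 1) * (a + b).choose b) * ((2 * a - 1)‼ : ℕ) *
        (β ^ 2) ^ b * (1 - β ^ 2) ^ a := by
        rw [mul_comm (cCc m : ℝ)]; gcongr
    _ = (2 * a + 2 * b) * (2 * b + 1) * ((2 * a - 1)‼ : ℕ) *
        ((a + b).choose b * (β ^ 2) ^ b * (1 - β ^ 2) ^ a) := by ring
    _ ≤ (2 * a + 2 * b) * (2 * b + 1) * ((2 * a - 1)‼ : ℕ) * 1 := by gcongr
    _ = _ := by push_cast; ring

lemma connRatio_mul_le (m s : ℕ →₀ ℕ) (hm : m ≠ 0) (hm0 : m 0 = 0) (hs0 : s 0 = 0)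
    (T : Finset ℕ) {β : ℝ} (hβ0 : 0 ≤ β) (hβ1 : β ≤ 1) :
    (cCc m : ℝ) / cC m * (∏ k ∈ T, (((m + s) k).choose (m k) : ℝ)) * β ^ (totalDeg s + 1) *
      (1 - β ^ 2) ^ (totalDeg m / 2) ≤
      (totalDeg m + totalDeg s + 1) * (totalDeg s + 2) := by
  have hy : (0 : ℝ) ≤ (1 - β ^ 2) ^ (totalDeg m / 2) := pow_nonneg (by nlinarith) _
  rcases Nat.even_or_odd (totalDeg m) with hme | hmo
  · rcases Nat.even_or_odd (totalDeg s) with hse | hso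
    · refine le_trans ?_ (le_trans (connRatio_mul_le_of_even m s hm hm0 hs0 hme hse T hβ0 hβ1) ?_)
      · have : β ^ (totalDeg s + 1) ≤ β ^ totalDeg s := pow_le_pow_of_le_one hβ0 hβ1 (Nat.le_succ _)
        gcongr
      · have : (0 : ℝ) ≤ totalDeg m := by positivity
        have : (0 : ℝ) ≤ totalDeg s := by positivity
        exact mul_le_mul (by linarith) (by linarith) (by linarith) (by linarith)
    · have hs1 : totalDeg (s + Finsupp.single 1 1) = totalDeg s + 1 := by
        rw [totalDeg_add]; simp [totalDeg]
      have h := connRatio_mul_le_of_even m (s + Finsupp.single 1 1) hm hm0 (by simp [hs0]) hme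
        (by rw [hs1]; exact hso.add_one) T hβ0 hβ1
      rw [hs1] at h
      refine le_trans ?_ (h.trans (le_of_eq (by push_cast; ring)))
      have hle : ∀ k, ((m + s) k).choose (m k) ≤ ((m + (s + Finsupp.single 1 1) : ℕ →₀ ℕ) k).choose (m k) :=
        fun k => Nat.choose_le_choose _ (by simp only [Finsupp.add_apply]; omega)
      have : ∏ k ∈ T, (((m + s) k).choose (m k) : ℝ) ≤
          ∏ k ∈ T, (((m + (s + Finsupp.single 1 1) : ℕ →₀ ℕ) k).choose (m k) : ℝ) :=
        Finset.prod_le_prod (fun _ _ => by positivity) fun k _ => by exact_mod_cast hle k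
      gcongr
  · rw [cC_of_odd m hm0 hmo]
    simp only [Nat.cast_zero, div_zero, zero_mul]
    positivity

lemma tendsto_sum_choose_mul_pow (a : ℕ) {x : ℝ} (hx0 : 0 ≤ x) (hx1 : x < 1) :
    Filter.Tendsto (fun N => ∑ s ∈ Finset.range N, ((a + s).choose a : ℝ) * x ^ s) Filter.atTop
      (nhds (1 / (1 - x) ^ (a + 1))) := by
  have h := (hasSum_choose_mul_geometric_of_norm_lt_one a (r := x)
    (by rwa [Real.norm_eq_abs, abs_of_nonneg hx0])).tendsto_sum_nat
  simpa only [add_comm a] using h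

lemma exists_sq_mul_pow_le {q r : ℝ} (hq0 : 0 ≤ q) (hqr : q < r) :
    ∃ C : ℝ, 0 < C ∧ ∀ t : ℕ, ((t : ℝ) + 2) ^ 2 * q ^ t ≤ C * r ^ t := by
  have hr : 0 < r := lt_of_le_of_lt hq0 hqr
  have h2 := summable_pow_mul_geometric_of_norm_lt_one 2 (r := q / r) (by
    rw [Real.norm_eq_abs, abs_of_nonneg (by positivity), div_lt_one hr]; exact hqr)
  obtain ⟨C, hC⟩ := h2.tendsto_atTop_zero.bddAbove_range
  have hC' : ∀ t : ℕ, (t : ℝ) ^ 2 * (q / r) ^ t ≤ C := fun t => hC ⟨t, rfl⟩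
  have hC0 : 0 ≤ C := by simpa using hC' 0
  refine ⟨9 * C + 4, by positivity, fun t => ?_⟩
  have h3 : (q / r) ^ t ≤ 1 := pow_le_one₀ (by positivity) ((div_le_one hr).2 hqr.le)
  have h4 : (0 : ℝ) ≤ (q / r) ^ t := by positivity
  have h5 : q ^ t = (q / r) ^ t * r ^ t := by rw [← mul_pow, div_mul_cancel₀ _ hr.ne']
  rw [h5, ← mul_assoc]
  refine mul_le_mul_of_nonneg_right ?_ (by positivity)
  rcases t with _ | t
  · norm_num; linarith
  · have h6 : (((t + 1 : ℕ) : ℝ) + 2) ^ 2 ≤ 9 * ((t + 1 : ℕ) : ℝ) ^ 2 := by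
      push_cast
      have : (0 : ℝ) ≤ t := by positivity
      nlinarith
    calc (((t + 1 : ℕ) : ℝ) + 2) ^ 2 * (q / r) ^ (t + 1)
        ≤ 9 * ((t + 1 : ℕ) : ℝ) ^ 2 * (q / r) ^ (t + 1) := by gcongr
      _ ≤ 9 * C := by have := hC' (t + 1); linarith
      _ ≤ _ := by linarith

lemma exists_connRatio_le (D : ℕ) {β₁ β₂ : ℝ} (h1 : 0 < β₁) (h12 : β₁ < β₂) (h2 : β₂ < 1) :
    ∃ C : ℝ, 0 < C ∧ ∀ m : ℕ →₀ ℕ, m ≠ 0 → m 0 = 0 →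
      (cCc m : ℝ) / cC m * (1 - β₂ ^ 2) ^ (totalDeg m / 2) ≤
        C * (totalDeg m + 1) * ∏ i ∈ Finset.range D, (1 - β₁ ^ (i + 1)) ^ (m (i + 1) + 1) := by
  classical
  have hβ₂ : 0 < β₂ := h1.trans h12
  obtain ⟨r, hqr, hr1⟩ := exists_between ((div_lt_one hβ₂).2 h12)
  obtain ⟨C, hC0, hC⟩ := exists_sq_mul_pow_le (q := β₁ / β₂) (by positivity) hqr
  have hr0 : 0 < r := lt_trans (by positivity) hqr
  have hx : ∀ i : ℕ, β₁ ^ (i + 1) < 1 := fun i => pow_lt_one₀ h1.le (h12.trans h2) (by omega)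
  refine ⟨C / β₂ * (1 / (1 - r)) ^ D, by have : 0 < 1 - r := by linarith
                                         positivity, fun m hm hm0 => ?_⟩
  have hprod0 : 0 < ∏ i ∈ Finset.range D, (1 - β₁ ^ (i + 1)) ^ (m (i + 1) + 1) :=
    Finset.prod_pos fun i _ => pow_pos (by linarith [hx i]) _
  set F : ℝ := (cCc m : ℝ) / cC m * (1 - β₂ ^ 2) ^ (totalDeg m / 2) with hF
  have hlim : Filter.Tendsto (fun N => F * ∏ i ∈ Finset.range D,
      ∑ s ∈ Finset.range N, ((m (i + 1) + s).choose (m (i + 1)) : ℝ) * (β₁ ^ (i + 1)) ^ s)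
      Filter.atTop (nhds (F * ∏ i ∈ Finset.range D, 1 / (1 - β₁ ^ (i + 1)) ^ (m (i + 1) + 1))) :=
    (tendsto_finsetProd _ fun i _ =>
      tendsto_sum_choose_mul_pow _ (by positivity) (hx i)).const_mul _
  have hbound : ∀ N, F * ∏ i ∈ Finset.range D,
      ∑ s ∈ Finset.range N, ((m (i + 1) + s).choose (m (i + 1)) : ℝ) * (β₁ ^ (i + 1)) ^ s ≤
      C / β₂ * (1 / (1 - r)) ^ D * (totalDeg m + 1) := by
    intro N
    rw [← Fin.prod_univ_eq_prod_range (fun i => ∑ s ∈ Finset.range N,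
      ((m (i + 1) + s).choose (m (i + 1)) : ℝ) * (β₁ ^ (i + 1)) ^ s) D, Finset.prod_univ_sum,
      Finset.mul_sum]
    have hterm : ∀ s : Fin D → ℕ, F * ∏ i : Fin D,
        ((m ((i : ℕ) + 1) + s i).choose (m ((i : ℕ) + 1)) : ℝ) * (β₁ ^ ((i : ℕ) + 1)) ^ s i ≤
        C / β₂ * (totalDeg m + 1) * ∏ i : Fin D, r ^ s i := by
      intro s
      set S : ℕ →₀ ℕ := ∑ i : Fin D, Finsupp.single ((i : ℕ) + 1) (s i) with hS
      have hSi : ∀ i : Fin D, S ((i : ℕ) + 1) = s i := by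
        intro i
        rw [hS, Finsupp.finsetSum_apply, Finset.sum_eq_single i]
        · simp
        · intro j _ hj
          exact Finsupp.single_eq_of_ne (fun h => hj (Fin.ext (by omega)))
        · simp
      have hS0 : S 0 = 0 := by
        rw [hS, Finsupp.finsetSum_apply]
        exact Finset.sum_eq_zero fun i _ => Finsupp.single_eq_of_ne (by omega)
      have hSt : totalDeg S = ∑ i : Fin D, ((i : ℕ) + 1) * s i := by
        have : totalDeg S = ∑ i : Fin D, totalDeg (Finsupp.single ((i : ℕ) + 1) (s i)) := by
          rw [hS]
          exact map_sum (⟨⟨totalDeg, by simp [totalDeg]⟩, totalDeg_add⟩ : (ℕ →₀ ℕ) →+ ℕ) _ _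
        rw [this]
        exact Finset.sum_congr rfl fun i _ => by simp [totalDeg]
      let ψ : Fin D ↪ ℕ := ⟨fun i => (i : ℕ) + 1, fun i j h => Fin.ext (by
          dsimp only at h; omega)⟩
      have hψ : ∀ i, ψ i = (i : ℕ) + 1 := fun _ => rfl
      have h := connRatio_mul_le m S hm hm0 hS0 (Finset.univ.map ψ) hβ₂.le h2.le
      rw [Finset.prod_map] at h
      simp only [hψ, Finsupp.add_apply, hSi] at h
      set P : ℝ := ∏ i : Fin D, ((m ((i : ℕ) + 1) + s i).choose (m ((i : ℕ) + 1)) : ℝ) with hP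
      set t := totalDeg S with ht
      have e1 : ∏ i : Fin D, (β₁ ^ ((i : ℕ) + 1)) ^ s i = β₁ ^ t := by
        rw [hSt, ← Finset.prod_pow_eq_pow_sum]
        exact Finset.prod_congr rfl fun i _ => (pow_mul _ _ _).symm
      have e2 : r ^ t ≤ ∏ i : Fin D, r ^ s i := by
        rw [hSt, ← Finset.prod_pow_eq_pow_sum]
        refine Finset.prod_le_prod (fun _ _ => by positivity) fun i _ => ?_
        exact pow_le_pow_of_le_one hr0.le hr1.le (Nat.le_mul_of_pos_left _ (by omega))
      rw [Finset.prod_mul_distrib, e1, ← hP]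
      have e3 : β₁ ^ t = (β₁ / β₂) ^ t * (β₂ ^ (t + 1) / β₂) := by
        rw [pow_succ, mul_div_assoc, div_self hβ₂.ne', mul_one, ← mul_pow,
          div_mul_cancel₀ _ hβ₂.ne']
      have hq : (0 : ℝ) ≤ (β₁ / β₂) ^ t := by positivity
      calc F * (P * β₁ ^ t)
          = ((cCc m : ℝ) / cC m * P * β₂ ^ (t + 1) * (1 - β₂ ^ 2) ^ (totalDeg m / 2)) *
            ((β₁ / β₂) ^ t / β₂) := by rw [e3, hF]; ring
        _ ≤ ((totalDeg m + t + 1) * (t + 2)) * ((β₁ / β₂) ^ t / β₂) :=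
            mul_le_mul_of_nonneg_right h (by positivity)
        _ ≤ ((totalDeg m + 1) * (t + 2) ^ 2) * ((β₁ / β₂) ^ t / β₂) := by
            refine mul_le_mul_of_nonneg_right ?_ (by positivity)
            have h7 : (0 : ℝ) ≤ totalDeg m := by positivity
            have h8 : (0 : ℝ) ≤ t := by positivity
            nlinarith [mul_nonneg h7 h8]
        _ = (totalDeg m + 1) / β₂ * ((t + 2) ^ 2 * (β₁ / β₂) ^ t) := by ring
        _ ≤ (totalDeg m + 1) / β₂ * (C * r ^ t) := by
            have := hC t
            gcongr
        _ ≤ (totalDeg m + 1) / β₂ * (C * ∏ i : Fin D, r ^ s i) := by gcongr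
        _ = _ := by ring
    refine (Finset.sum_le_sum fun s _ => hterm s).trans ?_
    rw [← Finset.mul_sum, ← Finset.prod_univ_sum (fun _ : Fin D => Finset.range N)
      (fun _ j => r ^ j), Finset.prod_const, Finset.card_univ, Fintype.card_fin]
    have hg : ∑ j ∈ Finset.range N, r ^ j ≤ 1 / (1 - r) := by
      rw [one_div, ← tsum_geometric_of_lt_one hr0.le hr1]
      exact (summable_geometric_of_lt_one hr0.le hr1).sum_le_tsum _ fun _ _ => by positivity
    calc C / β₂ * (totalDeg m + 1) * (∑ j ∈ Finset.range N, r ^ j) ^ D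
        ≤ C / β₂ * (totalDeg m + 1) * (1 / (1 - r)) ^ D := by gcongr
      _ = _ := by ring
  have := le_of_tendsto' hlim hbound
  rw [Finset.prod_div_distrib, Finset.prod_const_one, mul_one_div, div_le_iff₀ hprod0] at this
  exact this

end UpperBound

end PaperCM

namespace PaperCM

section Labelled

variable {α V : Type*} [DecidableEq α] [Fintype α]

open Classical in
open scoped Nat in
/-- Connected simple matchings whose dead set is the complement of a given alive set `A`. -/
lemma le_matchCount_deadDetermined (π : α → V) (A : Finset α) (Rv : Finset V) (Δ R k u : ℕ)
    (hne : ∀ h, ∃ h' ∈ A, π h' = π h)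
    (hU : (Finset.univ.filter (IsUp π A)).card = u) (hD : (Aᶜ).card = u)
    (hRv : Rv.card = R) (hRv2 : ∀ v ∈ Rv, (A.filter fun h => π h = v).card = 2)
    (hcard : A.card = u + (3 * R + 2 * k))
    (hroot : ∃ h, h ∉ A ∧ π h ∈ Rv)
    (hdeg : ∀ v, (A.filter fun h => π h = v).card ≤ Δ) (hR : Even R) (hR0 : 0 < R) :
    (u - 1)! * ((∏ i ∈ Finset.range k, (R + 2 * i - (Δ + Δ ^ 2))) * ((2 * R)‼ * (R - 2)‼)) ≤
      matchCount Finset.univ fun f => (IsConnOn π Finset.univ f ∧ IsSimpleOn π Finset.univ f) ∧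
        DeadDetermined π A Finset.univ f := by
  set U := Finset.univ.filter (IsUp π A) with hUdef
  have hUA : U ⊆ A := fun h hh => ((Finset.mem_filter.1 hh).2).1
  set C := A \ U with hC
  have hCcard : C.card = 3 * R + 2 * k := by
    rw [hC, Finset.card_sdiff_of_subset hUA, hU, hcard]; omega
  have hCup : ∀ h ∈ C, ∃ h' ∈ A, h' ≠ h ∧ π h' = π h := by
    intro h hh
    obtain ⟨h1, h2⟩ := Finset.mem_sdiff.1 hh
    by_contra! hcon
    refine h2 (Finset.mem_filter.2 ⟨Finset.mem_univ _, h1, fun h' hh' he => ?_⟩)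
    by_contra hne'
    exact hcon h' hh' hne' he
  have hCof : ∀ h ∈ A, ∀ h' ∈ A, h' ≠ h → π h' = π h → h ∈ C := by
    intro h hh h' hh' hn he
    exact Finset.mem_sdiff.2 ⟨hh, fun hu => hn ((Finset.mem_filter.1 hu).2.2 h' hh' he)⟩
  set Sr := A.filter fun h => π h ∈ Rv with hSr
  have hpair : ∀ h ∈ Sr, ∃ h' ∈ A, h' ≠ h ∧ π h' = π h ∧
      ∀ h'' ∈ A, π h'' = π h → h'' = h ∨ h'' = h' := by
    intro h hh
    obtain ⟨hA, hv⟩ := Finset.mem_filter.1 hh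
    obtain ⟨x, y, hxy, he⟩ := Finset.card_eq_two.1 (hRv2 _ hv)
    have hmem : ∀ z, (z ∈ A ∧ π z = π h) ↔ (z = x ∨ z = y) := by
      intro z
      have := Finset.ext_iff.1 he z
      simpa using this
    rcases (hmem h).1 ⟨hA, rfl⟩ with rfl | rfl
    · exact ⟨y, ((hmem y).2 (Or.inr rfl)).1, hxy.symm, ((hmem y).2 (Or.inr rfl)).2,
        fun z hz hzv => (hmem z).1 ⟨hz, hzv⟩⟩
    · exact ⟨x, ((hmem x).2 (Or.inl rfl)).1, hxy, ((hmem x).2 (Or.inl rfl)).2,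
        fun z hz hzv => ((hmem z).1 ⟨hz, hzv⟩).symm⟩
  choose! τ hτA hτne hτπ hτu using hpair
  have hSrA : ∀ h ∈ Sr, h ∈ A := fun h hh => (Finset.mem_filter.1 hh).1
  have hτS : ∀ h ∈ Sr, τ h ∈ Sr := fun h hh =>
    Finset.mem_filter.2 ⟨hτA h hh, by rw [hτπ h hh]; exact (Finset.mem_filter.1 hh).2⟩
  have hSrC : Sr ⊆ C := fun h hh => hCof h (hSrA h hh) (τ h) (hτA h hh) (hτne h hh) (hτπ h hh)
  have hSrcard : Sr.card = 2 * R := by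
    rw [Finset.card_eq_sum_card_fiberwise (s := Sr) (f := π) (t := Rv)
      (fun h hh => (Finset.mem_filter.1 (Finset.mem_coe.1 hh)).2)]
    rw [Finset.sum_congr rfl (g := fun _ => 2), Finset.sum_const, hRv, smul_eq_mul, mul_comm]
    intro v hv
    rw [← hRv2 v hv]
    congr 1
    ext h
    simp only [hSr, Finset.mem_filter]
    constructor
    · rintro ⟨⟨h1, -⟩, h2⟩; exact ⟨h1, h2⟩
    · rintro ⟨h1, rfl⟩; exact ⟨⟨h1, hv⟩, rfl⟩
  set Su := C \ Sr with hSu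
  have hSucard : Su.card = R + 2 * k := by
    rw [hSu, Finset.card_sdiff_of_subset hSrC, hSrcard, hCcard]; omega
  have hunion : Su ∪ Sr = C := Finset.sdiff_union_of_subset hSrC
  have hSuA : ∀ h ∈ Su, h ∈ A ∧ π h ∉ Rv := by
    intro h hh
    obtain ⟨h1, h2⟩ := Finset.mem_sdiff.1 hh
    have hA := (Finset.mem_sdiff.1 h1).1
    exact ⟨hA, fun hv => h2 (Finset.mem_filter.2 ⟨hA, hv⟩)⟩
  have hcore := le_matchCount_core π τ Δ R k Sr Su Finset.sdiff_disjoint ?_ ?_ ?_ ?_ ?_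
    hSrcard hSucard hR hR0
  · rw [hunion] at hcore
    have hall : C ∪ U ∪ Aᶜ = Finset.univ := by
      rw [hC, Finset.sdiff_union_of_subset hUA, Finset.union_compl]
    have := le_matchCount_of_forest (A := A) hcore u U Aᶜ ?_ hU
    · rwa [hall] at this
    refine ⟨fun h hh => (Finset.mem_filter.1 hh).2, ?_, fun h hh => Finset.mem_compl.1 hh, ?_,
      by rw [hU, hD], ?_⟩
    · intro h hh
      refine ⟨(Finset.mem_sdiff.1 hh).1, fun h' hup he => ?_⟩
      obtain ⟨h'', hA, hn, he'⟩ := hCup h hh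
      have e1 := hup.2 h (Finset.mem_sdiff.1 hh).1 he
      have e2 := hup.2 h'' hA (he'.trans he)
      exact hn (e2.trans e1.symm)
    · intro h hh
      obtain ⟨h', hA, he⟩ := hne h
      by_cases hu : h' ∈ U
      · exact Or.inl ⟨h', hu, he⟩
      · exact Or.inr ⟨h', Finset.mem_sdiff.2 ⟨hA, hu⟩, he⟩
    · intro _
      obtain ⟨h, hA, hv⟩ := hroot
      obtain ⟨h', hA', he⟩ := hne h
      exact ⟨h, Finset.mem_compl.2 hA, h', hSrC (Finset.mem_filter.2 ⟨hA', by rwa [he]⟩), he⟩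
  · intro h hh
    refine ⟨hτS h hh, hτne h hh, ?_, hτπ h hh⟩
    rcases hτu h hh _ (hτA _ (hτS h hh)) ((hτπ _ (hτS h hh)).trans (hτπ h hh)) with h1 | h1
    · exact h1
    · exact absurd h1 (hτne _ (hτS h hh))
  · intro h hh h' hh' he
    exact hτu h hh h' (hSrA h' hh') he.symm
  · intro h hh h' hh' he
    exact (hSuA h hh).2 (he ▸ (Finset.mem_filter.1 hh').2)
  · intro h hh
    obtain ⟨h', hA, hn, he⟩ := hCup h (Finset.mem_sdiff.1 hh).1
    refine ⟨h', Finset.mem_sdiff.2 ⟨hCof h' hA h (hSuA h hh).1 hn.symm he.symm, fun hs => ?_⟩, hn, he⟩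
    exact (hSuA h hh).2 (he ▸ (Finset.mem_filter.1 hs).2)
  · intro v
    refine (Finset.card_le_card ?_).trans (hdeg v)
    exact Finset.filter_subset_filter _ fun h hh => (hSuA h hh).1

end Labelled

section LabelledDegrees

open scoped Nat

lemma card_mul_le_cSc {V : Type*} [Fintype V] [DecidableEq V] (δ : V → ℕ) (m : ℕ →₀ ℕ)
    (hm : m = ∑ v, Finsupp.single (δ v) 1) (𝒮 : Finset (∀ v, Finset (Fin (δ v))))
    (Rv : Finset V) (Δ R k u : ℕ) (hpos : ∀ v, 0 < δ v)
    (hne : ∀ S ∈ 𝒮, ∀ v, (S v).Nonempty)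
    (hU : ∀ S ∈ 𝒮, (Finset.univ.filter fun v => (S v).card = 1).card = u)
    (hD : ∀ S ∈ 𝒮, ∑ v, (S v)ᶜ.card = u)
    (hRv : Rv.card = R) (hRv2 : ∀ S ∈ 𝒮, ∀ v ∈ Rv, (S v).card = 2)
    (hcard : ∑ v, δ v = 2 * u + (3 * R + 2 * k))
    (hroot : ∃ v ∈ Rv, 2 < δ v) (hdeg : ∀ v, δ v ≤ Δ) (hR : Even R) (hR0 : 0 < R) :
    𝒮.card * ((u - 1)! * ((∏ i ∈ Finset.range k, (R + 2 * i - (Δ + Δ ^ 2))) *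
      ((2 * R)‼ * (R - 2)‼))) ≤ cSc m := by
  classical
  rw [cSc_eq_matchCount δ hpos m hm]
  let AA : (∀ v, Finset (Fin (δ v))) → Finset (Σ v, Fin (δ v)) := fun S => Finset.univ.sigma S
  have hAA : ∀ S (h : Σ v, Fin (δ v)), h ∈ AA S ↔ h.2 ∈ S h.1 := by
    intro S h; simp [AA]
  have hinj : Function.Injective AA := by
    intro S S' h
    funext v
    ext i
    have := Finset.ext_iff.1 h ⟨v, i⟩
    rwa [hAA, hAA] at this
  rw [← Finset.card_map ⟨AA, hinj⟩]
  refine card_mul_le_matchCount_of_deadDetermined (π := Sigma.fst) _ ?_ ?_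
  · intro A hA h
    obtain ⟨S, hS, rfl⟩ := Finset.mem_map.1 hA
    obtain ⟨i, hi⟩ := hne S hS h.1
    exact ⟨⟨h.1, i⟩, (hAA S _).2 hi, rfl⟩
  intro A hA
  obtain ⟨S, hS, rfl⟩ := Finset.mem_map.1 hA
  simp only [Function.Embedding.coeFn_mk]
  have hfib : ∀ v, ((AA S).filter fun h => h.1 = v).card = (S v).card := by
    intro v
    rw [← Finset.card_map (⟨fun i => ⟨v, i⟩, fun i j h => eq_of_heq (Sigma.mk.inj h).2⟩ :
      Fin (δ v) ↪ Σ v, Fin (δ v)) (s := S v)]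
    congr 1
    ext ⟨w, i⟩
    simp only [Finset.mem_filter, hAA, Finset.mem_map]
    constructor
    · rintro ⟨h1, rfl⟩
      exact ⟨i, h1, rfl⟩
    · rintro ⟨j, hj, he⟩
      obtain ⟨rfl, h2⟩ := Sigma.mk.inj he
      rw [← eq_of_heq h2]
      exact ⟨hj, rfl⟩
  have hAcard : (AA S).card = ∑ v, (S v).card := Finset.card_sigma _ _
  have htot : (∑ v, (S v).card) + ∑ v, (S v)ᶜ.card = ∑ v, δ v := by
    rw [← Finset.sum_add_distrib]
    exact Finset.sum_congr rfl fun v _ => by rw [Finset.card_add_card_compl, Fintype.card_fin]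
  have hα : Fintype.card (Σ v, Fin (δ v)) = ∑ v, δ v := by simp
  refine le_matchCount_deadDetermined Sigma.fst (AA S) Rv Δ R k u ?_ ?_ ?_ hRv ?_ ?_ ?_ ?_ hR hR0
  · intro h
    obtain ⟨i, hi⟩ := hne S hS h.1
    exact ⟨⟨h.1, i⟩, (hAA S _).2 hi, rfl⟩
  · rw [← hU S hS]
    refine Finset.card_bij (fun h _ => h.1) ?_ ?_ ?_
    · intro h hh
      have hup := (Finset.mem_filter.1 hh).2
      refine Finset.mem_filter.2 ⟨Finset.mem_univ _, Finset.card_eq_one.2 ⟨h.2, ?_⟩⟩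
      refine Finset.eq_singleton_iff_unique_mem.2 ⟨(hAA S h).1 hup.1, fun i hi => ?_⟩
      have := hup.2 ⟨h.1, i⟩ ((hAA S _).2 hi) rfl
      obtain ⟨v, j⟩ := h
      exact eq_of_heq (Sigma.mk.inj this).2
    · intro h hh h' hh' he
      exact ((Finset.mem_filter.1 hh').2.2 h (Finset.mem_filter.1 hh).2.1 he)
    · intro v hv
      obtain ⟨i, hi⟩ := Finset.card_eq_one.1 (Finset.mem_filter.1 hv).2
      refine ⟨⟨v, i⟩, Finset.mem_filter.2 ⟨Finset.mem_univ _, (hAA S _).2 (by simp [hi]), ?_⟩, rfl⟩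
      rintro ⟨w, j⟩ hj rfl
      have : j ∈ S w := (hAA S _).1 hj
      rw [hi, Finset.mem_singleton] at this
      rw [this]
  · rw [Finset.card_compl, hα, ← htot, hAcard, ← hD S hS]
    omega
  · intro v hv
    rw [← hRv2 S hS v hv, ← hfib v]
    congr!
  · rw [hAcard]
    have := hD S hS
    omega
  · obtain ⟨v, hv, hv2⟩ := hroot
    have : (S v)ᶜ.Nonempty := by
      rw [← Finset.card_pos, Finset.card_compl, Fintype.card_fin, hRv2 S hS v hv]
      omega
    obtain ⟨i, hi⟩ := this
    refine ⟨⟨v, i⟩, ?_, hv⟩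
    rw [hAA]
    exact Finset.mem_compl.1 hi
  · intro v
    refine le_trans (le_of_eq (?_ : _ = (S v).card))
      ((Finset.card_le_univ _).trans (by rw [Fintype.card_fin]; exact hdeg v))
    rw [← hfib v]
    congr!

/-- The case in which some vertices are leaves; the labelling records the dead half-edges. -/
lemma card_mul_le_cSc_of_leaves {J : Type*} [Fintype J] [DecidableEq J] (δ : J → ℕ) (m : ℕ →₀ ℕ)
    (m₁ : ℕ) (hm : m = ∑ v, Finsupp.single (δ v) 1 + Finsupp.single 1 m₁)
    (𝒦 : Finset (∀ v, Finset (Fin (δ v)))) (Rv : Finset J) (Δ R k u : ℕ) (hpos : ∀ v, 0 < δ v)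
    (hne : ∀ K ∈ 𝒦, ∀ v, (K v).card < δ v)
    (hU : ∀ K ∈ 𝒦, (Finset.univ.filter fun v => (K v).card + 1 = δ v).card + m₁ = u)
    (hD : ∀ K ∈ 𝒦, ∑ v, (K v).card = u)
    (hRv : Rv.card = R) (hRv2 : ∀ K ∈ 𝒦, ∀ v ∈ Rv, (K v).card + 2 = δ v)
    (hcard : ∑ v, δ v + m₁ = 2 * u + (3 * R + 2 * k))
    (hroot : ∃ v ∈ Rv, 2 < δ v) (hΔ : 0 < Δ) (hdeg : ∀ v, δ v ≤ Δ) (hR : Even R) (hR0 : 0 < R) :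
    𝒦.card * ((u - 1)! * ((∏ i ∈ Finset.range k, (R + 2 * i - (Δ + Δ ^ 2))) *
      ((2 * R)‼ * (R - 2)‼))) ≤ cSc m := by
  classical
  let δ' : J ⊕ Fin m₁ → ℕ := Sum.elim δ fun _ => 1
  let SS : (∀ v, Finset (Fin (δ v))) → ∀ v, Finset (Fin (δ' v)) := fun K v =>
    match v with
    | Sum.inl j => (K j)ᶜ
    | Sum.inr _ => Finset.univ
  have hinj : Function.Injective SS := by
    intro K K' h
    funext j
    have : (K j)ᶜ = (K' j)ᶜ := congrFun h (Sum.inl j)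
    exact compl_injective this
  have hl : ∀ K j, (SS K (Sum.inl j)).card = δ j - (K j).card := fun K j => by
    change ((K j)ᶜ).card = _
    rw [Finset.card_compl, Fintype.card_fin]
  have hr : ∀ K i, (SS K (Sum.inr i)).card = 1 := fun K i => by
    change (Finset.univ : Finset (Fin 1)).card = 1
    simp
  have hlc : ∀ K j, ((SS K (Sum.inl j))ᶜ).card = (K j).card := fun K j => by
    change ((K j)ᶜᶜ).card = _
    rw [compl_compl]
  have hrc : ∀ K i, ((SS K (Sum.inr i))ᶜ).card = 0 := fun K i => by
    change ((Finset.univ : Finset (Fin 1))ᶜ).card = 0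
    simp
  rw [← Finset.card_map ⟨SS, hinj⟩]
  refine card_mul_le_cSc δ' m ?_ _ (Rv.map Function.Embedding.inl) Δ R k u ?_ ?_ ?_ ?_ ?_ ?_ ?_ ?_ ?_
    hR hR0
  · rw [hm, Fintype.sum_sum_type]
    simp only [δ', Sum.elim_inl, Sum.elim_inr, Finset.sum_const, Finset.card_univ,
      Fintype.card_fin, Finsupp.smul_single, smul_eq_mul, mul_one]
  · rintro (j | i)
    · exact hpos j
    · exact Nat.one_pos
  · intro S hS v
    obtain ⟨K, hK, rfl⟩ := Finset.mem_map.1 hS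
    rw [← Finset.card_pos]
    rcases v with j | i
    · have := hl K j
      have h2 := hne K hK j
      simp only [Function.Embedding.coeFn_mk]
      omega
    · exact (hr K i).symm ▸ Nat.one_pos
  · intro S hS
    obtain ⟨K, hK, rfl⟩ := Finset.mem_map.1 hS
    rw [← hU K hK, Finset.card_filter, Fintype.sum_sum_type, Finset.card_filter]
    congr 1
    · refine Finset.sum_congr rfl fun j _ => ?_
      have := hl K j
      have h2 := hne K hK j
      simp only [Function.Embedding.coeFn_mk, this]
      congr 1
      simp only [eq_iff_iff]
      omega
    · simp only [Function.Embedding.coeFn_mk, hr, if_true, Finset.sum_const, Finset.card_univ,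
        Fintype.card_fin, smul_eq_mul, mul_one]
  · intro S hS
    obtain ⟨K, hK, rfl⟩ := Finset.mem_map.1 hS
    rw [Fintype.sum_sum_type]
    simp only [Function.Embedding.coeFn_mk, hlc, hrc, Finset.sum_const_zero, add_zero]
    exact hD K hK
  · rw [Finset.card_map, hRv]
  · intro S hS v hv
    obtain ⟨K, hK, rfl⟩ := Finset.mem_map.1 hS
    obtain ⟨j, hj, rfl⟩ := Finset.mem_map.1 hv
    have := hl K j
    have h2 := hRv2 K hK j hj
    change (SS K (Sum.inl j)).card = 2
    omega
  · rw [Fintype.sum_sum_type]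
    simpa [δ'] using hcard
  · obtain ⟨v, hv, h2⟩ := hroot
    exact ⟨Sum.inl v, Finset.mem_map_of_mem _ hv, h2⟩
  · rintro (j | i)
    · exact hdeg j
    · exact hΔ

end LabelledDegrees

end PaperCM

namespace PaperCM

section LowerNumerics

open scoped Nat

lemma core_count_ge (R b k L : ℕ) (hR : Even R) (hb : 2 * b + 2 ≤ R) (hL : 3 * R + 2 * k ≤ L) :
    R ^ (2 * R) * (3 * R + 2 * k - 1)‼ ≤
      (∏ i ∈ Finset.range k, (R + 2 * i - b)) * ((2 * R)‼ * (R - 2)‼) *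
        ((10 * L) ^ (2 * R) * 6 ^ R) := by
  obtain ⟨r, rfl⟩ := hR.two_dvd
  have h1 := prod_greedy_ge (2 * r) (2 * (2 * r)) b k L hb le_rfl (by omega)
  have h2 := doubleFactorial_three_mul_le r (by omega)
  have h3 := doubleFactorial_odd_split (3 * r) k
  rw [show 3 * (2 * r) + 2 * k = 2 * (3 * r) + 2 * k by ring, h3]
  calc _ = ((2 * r) ^ (2 * (2 * r)) *
        ∏ i ∈ Finset.range k, (2 * r + 2 * (2 * r) + 2 * i + 1)) * (2 * (3 * r) - 1)‼ := by
        rw [← mul_assoc]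
        congr 2
        exact Finset.prod_congr rfl fun i _ => by ring
    _ ≤ _ := Nat.mul_le_mul h1 h2
    _ = _ := by ring

lemma doubleFactorial_le_choose (a u : ℕ) :
    (2 * a + 2 * u - 1)‼ ≤ 2 ^ u * (a + u).choose u * (u ! * (2 * a - 1)‼) := by
  rw [doubleFactorial_odd_split, ← mul_assoc]
  refine Nat.mul_le_mul_right _ ?_
  calc _ ≤ ∏ i ∈ Finset.range u, 2 * (a + 1 + i) := Finset.prod_le_prod' fun i _ => by omega
    _ = 2 ^ u * (u ! * (a + u).choose u) := by
      rw [Finset.prod_mul_distrib, Finset.prod_const, Finset.card_range,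
        ← Nat.ascFactorial_eq_prod_range, Nat.ascFactorial_eq_factorial_mul_choose]
    _ = _ := by ring

lemma doubleFactorial_mul_pow_le (a u : ℕ) {β : ℝ} (h0 : 0 ≤ β) (h1 : β ≤ 1) :
    ((2 * a + 2 * u - 1)‼ : ℝ) * (β ^ u * (1 - β) ^ a) ≤
      (u ! * (2 * a - 1)‼ : ℝ) * (1 + β) ^ (a + u) := by
  have hp : 0 < 1 + β := by linarith
  have h2 := choose_mul_pow_le_one a u (x := 2 * β / (1 + β)) (by positivity)
    (by rw [div_le_one hp]; linarith)
  rw [show 1 - 2 * β / (1 + β) = (1 - β) / (1 + β) by field_simp; ring, div_pow, div_pow,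
    mul_pow] at h2
  have h3 : ((2 * a + 2 * u - 1)‼ : ℝ) ≤ 2 ^ u * (a + u).choose u * (u ! * (2 * a - 1)‼) := by
    exact_mod_cast doubleFactorial_le_choose a u
  have h4 : ((a + u).choose u : ℝ) * (2 ^ u * β ^ u * (1 - β) ^ a) ≤ (1 + β) ^ (a + u) := by
    rw [pow_add]
    have e : ((a + u).choose u : ℝ) * (2 ^ u * β ^ u / (1 + β) ^ u) * ((1 - β) ^ a / (1 + β) ^ a) =
      ((a + u).choose u : ℝ) * (2 ^ u * β ^ u * (1 - β) ^ a) / ((1 + β) ^ a * (1 + β) ^ u) := by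
      field_simp
    rwa [e, div_le_one (by positivity)] at h2
  have hb : 0 ≤ 1 - β := by linarith
  calc _ ≤ 2 ^ u * (a + u).choose u * (u ! * (2 * a - 1)‼ : ℝ) * (β ^ u * (1 - β) ^ a) := by gcongr
    _ = (u ! * (2 * a - 1)‼ : ℝ) * (((a + u).choose u : ℝ) * (2 ^ u * β ^ u * (1 - β) ^ a)) := by
      ring
    _ ≤ _ := by gcongr

/-- Numerical form of the lower bound on connected simple configurations. -/
lemma connRatio_ge {J : Type*} [Fintype J] [DecidableEq J] (δ : J → ℕ) (m : ℕ →₀ ℕ)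
    (m₁ : ℕ) (hm : m = ∑ v, Finsupp.single (δ v) 1 + Finsupp.single 1 m₁)
    (𝒦 : Finset (∀ v, Finset (Fin (δ v)))) (Rv : Finset J) (Δ R k u : ℕ) (hpos : ∀ v, 0 < δ v)
    (hne : ∀ K ∈ 𝒦, ∀ v, (K v).card < δ v)
    (hU : ∀ K ∈ 𝒦, (Finset.univ.filter fun v => (K v).card + 1 = δ v).card + m₁ = u)
    (hD : ∀ K ∈ 𝒦, ∑ v, (K v).card = u)
    (hRv : Rv.card = R) (hRv2 : ∀ K ∈ 𝒦, ∀ v ∈ Rv, (K v).card + 2 = δ v)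
    (hcard : ∑ v, δ v + m₁ = 2 * u + (3 * R + 2 * k))
    (hroot : ∃ v ∈ Rv, 2 < δ v) (hdeg : ∀ v, δ v ≤ Δ) (hR : Even R)
    (hb : 2 * (Δ + Δ ^ 2) + 2 ≤ R) {β A B : ℝ} (h0 : 0 < β) (h1 : β < 1) (hB : 0 < B)
    (h𝒦 : (∏ v, (1 - β ^ δ v)) * A ≤ B * (𝒦.card * (β ^ u * (1 - β) ^ (∑ v, δ v - u)))) :
    (R : ℝ) ^ (2 * R) * ((∏ v, (1 - β ^ δ v)) * A * (1 - β) ^ m₁) * cC m ≤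
      B * ((totalDeg m : ℝ) * (10 * totalDeg m) ^ (2 * R) * 6 ^ R) *
        (1 - β ^ 2) ^ (totalDeg m / 2) * cSc m := by
  have hdegm : totalDeg m = ∑ v, δ v + m₁ := by
    rw [hm, totalDeg_add]
    congr 1
    · unfold totalDeg
      rw [← Finsupp.sum_finsetSum_index (by simp) (by intros; ring)]
      exact Finset.sum_congr rfl fun v _ => by simp
    · simp [totalDeg]
  have hΔ : 0 < Δ := by
    obtain ⟨v, -, hv⟩ := hroot
    have := hdeg v
    omega
  rcases 𝒦.eq_empty_or_nonempty with h𝒦e | ⟨K₀, hK₀⟩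
  · rw [h𝒦e] at h𝒦
    simp only [Finset.card_empty, Nat.cast_zero, zero_mul, mul_zero] at h𝒦
    have hb1 : 0 ≤ 1 - β := by linarith
    have hb2 : 0 ≤ 1 - β ^ 2 := by nlinarith
    refine le_trans (b := 0) ?_ (by positivity)
    rw [mul_assoc]
    refine mul_nonpos_of_nonneg_of_nonpos (by positivity) ?_
    exact mul_nonpos_of_nonpos_of_nonneg (mul_nonpos_of_nonpos_of_nonneg h𝒦 (by positivity))
      (by positivity)
  have hu0 : 0 < u := by
    obtain ⟨v, hv, hv2⟩ := hroot
    rw [← hD K₀ hK₀]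
    refine Finset.sum_pos' (fun _ _ => Nat.zero_le _) ⟨v, Finset.mem_univ _, ?_⟩
    have := hRv2 K₀ hK₀ v hv
    omega
  have huJ : u ≤ ∑ v, δ v := by
    rw [← hD K₀ hK₀]
    exact Finset.sum_le_sum fun v _ => (hne K₀ hK₀ v).le
  have hul : u ≤ totalDeg m := by omega
  have hmain := card_mul_le_cSc_of_leaves δ m m₁ hm 𝒦 Rv Δ R k u hpos hne hU hD hRv hRv2 hcard
    hroot hΔ hdeg hR (by omega)
  have hcore := core_count_ge R (Δ + Δ ^ 2) k (totalDeg m) hR hb (by omega)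
  obtain ⟨r, hr⟩ := hR.two_dvd
  set a := 3 * r + k with ha
  have h2a : 3 * R + 2 * k = 2 * a := by omega
  have hl : totalDeg m = 2 * a + 2 * u := by omega
  have hl2 : totalDeg m / 2 = a + u := by omega
  have hm0 : m 0 = 0 := by
    rw [hm]
    simp only [Finsupp.coe_add, Finsupp.coe_finsetSum, Pi.add_apply, Finset.sum_apply]
    rw [Finset.sum_eq_zero fun v _ => ?_]
    · simp
    · rw [Finsupp.single_apply, if_neg (hpos v).ne']
  have hC : cC m = (2 * a + 2 * u - 1)‼ := by
    rw [cC_of_even m hm0 (by rw [hl]; exact ⟨a + u, by ring⟩), hl]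
  have hdf := doubleFactorial_mul_pow_le a u h0.le h1.le
  rw [h2a] at hcore
  set core := (∏ i ∈ Finset.range k, (R + 2 * i - (Δ + Δ ^ 2))) * ((2 * R)‼ * (R - 2)‼) with hco
  set X : ℝ := (10 * totalDeg m : ℝ) ^ (2 * R) * 6 ^ R with hX
  have hcore' : (R : ℝ) ^ (2 * R) * ((2 * a - 1)‼ : ℕ) ≤ core * X := by
    rw [hX]; exact_mod_cast hcore
  have hmain' : (𝒦.card : ℝ) * ((u - 1)! * core) ≤ cSc m := by exact_mod_cast hmain
  have hfac : (u ! : ℝ) ≤ totalDeg m * (u - 1)! := by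
    rw [← Nat.mul_factorial_pred hu0.ne']
    push_cast
    gcongr
  set P : ℝ := ∏ v, (1 - β ^ δ v) with hP
  have hβ1 : 0 < 1 - β := by linarith
  have hβ2 : 0 < 1 + β := by linarith
  have hpw : (β ^ u * (1 - β) ^ (∑ v, δ v - u)) * (1 - β) ^ m₁ =
      (β ^ u * (1 - β) ^ a) * (1 - β) ^ (a + u) := by
    rw [mul_assoc, mul_assoc, ← pow_add, ← pow_add]
    congr 2
    omega
  have hsq : (1 - β ^ 2) ^ (totalDeg m / 2) = (1 + β) ^ (a + u) * (1 - β) ^ (a + u) := by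
    rw [hl2, ← mul_pow]
    congr 1
    ring
  rw [hC, hsq]
  calc (R : ℝ) ^ (2 * R) * (P * A * (1 - β) ^ m₁) * ((2 * a + 2 * u - 1)‼ : ℕ)
      ≤ (R : ℝ) ^ (2 * R) * (B * (𝒦.card * (β ^ u * (1 - β) ^ (∑ v, δ v - u))) *
          (1 - β) ^ m₁) * ((2 * a + 2 * u - 1)‼ : ℕ) := by gcongr
    _ = B * (R : ℝ) ^ (2 * R) * 𝒦.card * (1 - β) ^ (a + u) *
          (((2 * a + 2 * u - 1)‼ : ℕ) * (β ^ u * (1 - β) ^ a)) := by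
        rw [show B * (𝒦.card * (β ^ u * (1 - β) ^ (∑ v, δ v - u))) * (1 - β) ^ m₁ =
          B * 𝒦.card * ((β ^ u * (1 - β) ^ (∑ v, δ v - u)) * (1 - β) ^ m₁) by ring, hpw]
        ring
    _ ≤ B * (R : ℝ) ^ (2 * R) * 𝒦.card * (1 - β) ^ (a + u) *
          ((u ! * (2 * a - 1)‼ : ℝ) * (1 + β) ^ (a + u)) := by gcongr
    _ = B * (1 + β) ^ (a + u) * (1 - β) ^ (a + u) * 𝒦.card * u ! *
          ((R : ℝ) ^ (2 * R) * ((2 * a - 1)‼ : ℕ)) := by ring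
    _ ≤ B * (1 + β) ^ (a + u) * (1 - β) ^ (a + u) * 𝒦.card * (totalDeg m * (u - 1)!) *
          (core * X) := by gcongr
    _ = B * (1 + β) ^ (a + u) * (1 - β) ^ (a + u) * totalDeg m * X *
          ((𝒦.card : ℝ) * ((u - 1)! * core)) := by ring
    _ ≤ B * (1 + β) ^ (a + u) * (1 - β) ^ (a + u) * totalDeg m * X * cSc m := by gcongr
    _ = _ := by rw [hX]; ring

end LowerNumerics

end PaperCM

namespace PaperCM

section ProductWeights

variable {J : Type*} [Fintype J] [DecidableEq J] {Ω : J → Type*} [∀ j, Fintype (Ω j)]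

lemma sum_prod_weights (q : ∀ j, Ω j → ℝ) :
    ∑ ω : ∀ j, Ω j, ∏ j, q j (ω j) = ∏ j, ∑ x, q j x := by
  rw [Finset.prod_univ_sum, Fintype.piFinset_univ]

lemma sum_prod_weights_sq (q f : ∀ j, Ω j → ℝ) (hq : ∀ j, ∑ x, q j x = 1)
    (hf : ∀ j, ∑ x, q j x * f j x = 0) :
    ∑ ω : ∀ j, Ω j, (∏ j, q j (ω j)) * (∑ j, f j (ω j)) ^ 2 = ∑ j, ∑ x, q j x * f j x ^ 2 := by
  have key : ∀ i j, ∑ ω : ∀ j, Ω j, (∏ l, q l (ω l)) * (f i (ω i) * f j (ω j)) =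
      if i = j then ∑ x, q i x * f i x ^ 2 else 0 := by
    intro i j
    have e : ∀ ω : ∀ j, Ω j, (∏ l, q l (ω l)) * (f i (ω i) * f j (ω j)) =
        ∏ l, q l (ω l) * ((if l = i then f l (ω l) else 1) * (if l = j then f l (ω l) else 1)) := by
      intro ω
      rw [Finset.prod_mul_distrib, Finset.prod_mul_distrib]
      simp
    rw [Finset.sum_congr rfl fun ω _ => e ω,
      sum_prod_weights fun l x => q l x * ((if l = i then f l x else 1) * (if l = j then f l x else 1))]
    split_ifs with h
    · subst h
      rw [Finset.prod_eq_single i]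
      · simp [pow_two]
      · intro l _ hl
        simp [hl, hq]
      · simp
    · refine Finset.prod_eq_zero (Finset.mem_univ i) ?_
      simp [h, hf]
  have hx : ∀ ω : ∀ j, Ω j, (∏ j, q j (ω j)) * (∑ j, f j (ω j)) ^ 2 =
      ∑ i, ∑ j, (∏ l, q l (ω l)) * (f i (ω i) * f j (ω j)) := fun ω => by
    rw [pow_two, Finset.sum_mul_sum, Finset.mul_sum]
    simp only [Finset.mul_sum]
  rw [Finset.sum_congr rfl fun ω _ => hx ω, Finset.sum_comm]
  refine Finset.sum_congr rfl fun i _ => ?_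
  rw [Finset.sum_comm, Finset.sum_congr rfl fun j _ => key i j]
  simp

/-- Chebyshev's inequality, a parity coin and the pigeonhole principle. -/
lemma exists_large_class (q : ∀ j, Ω j → ℝ) (hq0 : ∀ j x, 0 ≤ q j x) (hq : ∀ j, ∑ x, q j x = 1)
    (ξ s : ∀ j, Ω j → ℕ) (D M c : ℕ) (hD : ∀ j x, ξ j x ≤ D)
    (hM : ∀ ω : ∀ j, Ω j, ∑ j, ξ j (ω j) ≤ M) (hM' : ∀ ω : ∀ j, Ω j, ∑ j, s j (ω j) ≤ M)
    (j₀ : J) (hj₀ : ∑ x, q j₀ x * (-1) ^ ξ j₀ x = 0) {T : ℝ} (hT0 : 0 < T)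
    (hT : 4 * (Fintype.card J * (D : ℝ) ^ 2) ≤ T ^ 2) :
    ∃ X u : ℕ, Even (c + X) ∧ |(X : ℝ) - ∑ j, ∑ x, q j x * ξ j x| ≤ T ∧
      1 / 4 ≤ ((M : ℝ) + 1) ^ 2 * ∑ ω : ∀ j, Ω j with ∑ j, ξ j (ω j) = X ∧ ∑ j, s j (ω j) = u,
        ∏ j, q j (ω j) := by
  classical
  set e : J → ℝ := fun j => ∑ x, q j x * ξ j x with he
  set W : (∀ j, Ω j) → ℝ := fun ω => ∏ j, q j (ω j) with hW
  have hW0 : ∀ ω, 0 ≤ W ω := fun ω => Finset.prod_nonneg fun j _ => hq0 j _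
  have htot : ∑ ω, W ω = 1 := by
    rw [hW, sum_prod_weights, Finset.prod_congr rfl fun j _ => hq j, Finset.prod_const_one]
  have hsign : ∑ ω, W ω * (-1) ^ (∑ j, ξ j (ω j)) = 0 := by
    have : ∀ ω, W ω * (-1) ^ (∑ j, ξ j (ω j)) = ∏ j, q j (ω j) * (-1) ^ ξ j (ω j) := fun ω => by
      rw [Finset.prod_mul_distrib, Finset.prod_pow_eq_pow_sum]
    rw [Finset.sum_congr rfl fun ω _ => this ω, sum_prod_weights fun j x => q j x * (-1) ^ ξ j x]
    exact Finset.prod_eq_zero (Finset.mem_univ j₀) hj₀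
  have hvar : ∑ ω, W ω * (∑ j, (ξ j (ω j) - e j)) ^ 2 ≤ Fintype.card J * (D : ℝ) ^ 2 := by
    rw [hW, sum_prod_weights_sq q (fun j x => ξ j x - e j) hq]
    · rw [← Finset.card_univ, ← nsmul_eq_mul]
      refine Finset.sum_le_card_nsmul _ _ _ fun j _ => ?_
      have h1 : ∑ x, q j x * ((ξ j x : ℝ) - e j) ^ 2 = ∑ x, q j x * (ξ j x : ℝ) ^ 2 - e j ^ 2 := by
        have : ∀ x, q j x * ((ξ j x : ℝ) - e j) ^ 2 =
          q j x * (ξ j x : ℝ) ^ 2 - 2 * e j * (q j x * ξ j x) + e j ^ 2 * q j x := fun x => by ring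
        simp only [this, Finset.sum_add_distrib, Finset.sum_sub_distrib, ← Finset.mul_sum, hq]
        rw [show ∑ x, q j x * (ξ j x : ℝ) = e j from rfl]
        ring
      rw [h1]
      have h2 : ∑ x, q j x * (ξ j x : ℝ) ^ 2 ≤ ∑ x, q j x * (D : ℝ) ^ 2 :=
        Finset.sum_le_sum fun x _ => by
          have := hq0 j x
          have := hD j x
          gcongr
      rw [← Finset.sum_mul, hq, one_mul] at h2
      nlinarith [sq_nonneg (e j)]
    · intro j
      simp only [mul_sub, Finset.sum_sub_distrib, ← Finset.sum_mul, hq, he]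
      ring
  set G : Finset (∀ j, Ω j) := Finset.univ.filter fun ω => Even (c + ∑ j, ξ j (ω j)) ∧
    |((∑ j, ξ j (ω j) : ℕ) : ℝ) - ∑ j, e j| ≤ T with hG
  have hGsum : 1 / 4 ≤ ∑ ω ∈ G, W ω := by
    have hpt : ∀ ω, W ω * (1 / 2) + (-1) ^ c / 2 * (W ω * (-1) ^ (∑ j, ξ j (ω j))) -
        W ω * (∑ j, (ξ j (ω j) - e j)) ^ 2 / T ^ 2 ≤ if ω ∈ G then W ω else 0 := by
      intro ω
      have hT2 : 0 < T ^ 2 := by positivity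
      have hnn : 0 ≤ W ω * (∑ j, ((ξ j (ω j) : ℝ) - e j)) ^ 2 / T ^ 2 :=
        div_nonneg (mul_nonneg (hW0 ω) (sq_nonneg _)) hT2.le
      have hs : W ω * (1 / 2) + (-1) ^ c / 2 * (W ω * (-1) ^ (∑ j, ξ j (ω j))) =
          if Even (c + ∑ j, ξ j (ω j)) then W ω else 0 := by
        rw [show (-1 : ℝ) ^ c / 2 * (W ω * (-1) ^ (∑ j, ξ j (ω j))) =
          W ω / 2 * (-1) ^ (c + ∑ j, ξ j (ω j)) by rw [pow_add]; ring]
        split_ifs with h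
        · rw [h.neg_one_pow]; ring
        · rw [(Nat.not_even_iff_odd.1 h).neg_one_pow]; ring
      rw [hs]
      by_cases h1 : Even (c + ∑ j, ξ j (ω j))
      · rw [if_pos h1]
        by_cases h2 : |((∑ j, ξ j (ω j) : ℕ) : ℝ) - ∑ j, e j| ≤ T
        · rw [if_pos (Finset.mem_filter.2 ⟨Finset.mem_univ _, h1, h2⟩)]
          linarith
        · rw [if_neg fun h => h2 (Finset.mem_filter.1 h).2.2]
          push Not at h2
          rw [sub_nonpos, le_div_iff₀ hT2]
          refine mul_le_mul_of_nonneg_left ?_ (hW0 ω)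
          rw [Finset.sum_sub_distrib, ← sq_abs (_ - _)]
          push_cast at h2
          exact pow_le_pow_left₀ hT0.le h2.le 2
      · rw [if_neg h1, if_neg fun h => h1 (Finset.mem_filter.1 h).2.1]
        linarith
    have hsum := Finset.sum_le_sum fun ω (_ : ω ∈ Finset.univ) => hpt ω
    rw [Finset.sum_sub_distrib, Finset.sum_add_distrib, ← Finset.sum_mul, htot, ← Finset.mul_sum,
      hsign, ← Finset.sum_div, ← Finset.sum_filter, Finset.filter_univ_mem] at hsum
    have : (∑ ω, W ω * (∑ j, ((ξ j (ω j) : ℝ) - e j)) ^ 2) / T ^ 2 ≤ 1 / 4 := by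
      rw [div_le_iff₀ (by positivity)]
      linarith
    linarith
  set I := Finset.range (M + 1) ×ˢ Finset.range (M + 1) with hI
  have hmaps : ∀ ω ∈ G, (∑ j, ξ j (ω j), ∑ j, s j (ω j)) ∈ I := fun ω _ =>
    Finset.mem_product.2 ⟨Finset.mem_range.2 (Nat.lt_succ_of_le (hM ω)),
      Finset.mem_range.2 (Nat.lt_succ_of_le (hM' ω))⟩
  rw [← Finset.sum_fiberwise_of_maps_to hmaps] at hGsum
  have hIcard : (I.card : ℝ) = ((M : ℝ) + 1) ^ 2 := by
    rw [hI, Finset.card_product, Finset.card_range]; push_cast; ring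
  obtain ⟨⟨X, u⟩, -, hXu⟩ : ∃ i ∈ I, 1 / 4 / ((M : ℝ) + 1) ^ 2 ≤
      ∑ ω ∈ G with (∑ j, ξ j (ω j), ∑ j, s j (ω j)) = i, W ω := by
    refine Finset.exists_le_of_sum_le ?_ (le_trans (le_of_eq ?_) hGsum)
    · exact ⟨(0, 0), by simp [hI]⟩
    · rw [Finset.sum_const, nsmul_eq_mul, hIcard]
      field_simp
  have hpos : (0 : ℝ) < 1 / 4 / ((M : ℝ) + 1) ^ 2 := by positivity
  obtain ⟨ω, hω, -⟩ := Finset.exists_ne_zero_of_sum_ne_zero (hpos.trans_le hXu).ne'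
  obtain ⟨hωG, hωe⟩ := Finset.mem_filter.1 hω
  obtain ⟨-, hE, hdev⟩ := Finset.mem_filter.1 hωG
  have hX : ∑ j, ξ j (ω j) = X := (Prod.mk.inj hωe).1
  rw [hX] at hE hdev
  refine ⟨X, u, hE, hdev, ?_⟩
  rw [div_le_iff₀ (by positivity), mul_comm] at hXu
  refine hXu.trans ?_
  gcongr ?_ * ?_
  refine Finset.sum_le_sum_of_subset_of_nonneg (fun ω hω => ?_) fun ω _ _ => hW0 ω
  have := Prod.mk.inj (Finset.mem_filter.1 hω).2
  exact Finset.mem_filter.2 ⟨Finset.mem_univ _, this⟩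

end ProductWeights

section DeadSets

/-- `k (x - x ^ (k - 1)) / (1 - x ^ k)`, written so that it extends continuously to `x = 1`. -/
noncomputable def gker (k : ℕ) (x : ℝ) : ℝ :=
  k * (∑ i ∈ Finset.range (k - 2), x ^ (i + 1)) / ∑ i ∈ Finset.range k, x ^ i

lemma gker_eq {k : ℕ} (hk : 2 ≤ k) {x : ℝ} (h1 : x < 1) :
    gker k x = k * (x - x ^ (k - 1)) / (1 - x ^ k) := by
  obtain ⟨j, rfl⟩ : ∃ j, k = j + 2 := ⟨k - 2, by omega⟩
  have hx : 0 < 1 - x := by linarith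
  have h2 : (∑ i ∈ Finset.range (j + 2), x ^ i) * (1 - x) = 1 - x ^ (j + 2) := geom_sum_mul_neg x _
  have h3 : (∑ i ∈ Finset.range j, x ^ (i + 1)) * (1 - x) = x - x ^ (j + 1) := by
    simp only [pow_succ]
    rw [← Finset.sum_mul, mul_right_comm, geom_sum_mul_neg]
    ring
  unfold gker
  rw [show j + 2 - 2 = j by omega, show j + 2 - 1 = j + 1 by omega, ← h2, ← h3, ← mul_assoc,
    mul_div_mul_right _ _ hx.ne']

lemma gker_nonneg (k : ℕ) {x : ℝ} (h0 : 0 ≤ x) : 0 ≤ gker k x := by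
  unfold gker; positivity

lemma gker_le (k : ℕ) {x : ℝ} (h0 : 0 ≤ x) : gker k x ≤ k := by
  unfold gker
  refine div_le_of_le_mul₀ (by positivity) (by positivity) ?_
  gcongr
  rcases k with _ | _ | k
  · simp
  · simp
  · rw [show k + 1 + 1 - 2 = k by omega, Finset.sum_range_succ, Finset.sum_range_succ']
    have : 0 ≤ x ^ (k + 1) := by positivity
    have : 0 ≤ x ^ 0 := by positivity
    linarith

/-- Dead degree minus the indicator of being left with a single alive half-edge. -/
def excess (d c : ℕ) : ℕ := c - if c + 1 = d then 1 else 0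

lemma excess_add {d c : ℕ} (hd : 2 ≤ d) : excess d c + (if c + 1 = d then 1 else 0) = c := by
  unfold excess; split_ifs <;> omega

lemma sum_finset_fin (d : ℕ) (f : ℕ → ℝ) :
    ∑ K : Finset (Fin d), f K.card = ∑ c ∈ Finset.range (d + 1), (d.choose c : ℝ) * f c := by
  have := Finset.sum_powerset_apply_card f (x := (Finset.univ : Finset (Fin d)))
  rw [Finset.powerset_univ, Finset.card_univ, Fintype.card_fin] at this
  rw [this]
  exact Finset.sum_congr rfl fun c _ => by rw [nsmul_eq_mul]

/-- Law of the dead set of a vertex of degree `d`, given that not every half-edge is dead. -/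
noncomputable def deadWt (d : ℕ) (β : ℝ) (c : ℕ) : ℝ :=
  if c < d then β ^ c * (1 - β) ^ (d - c) / (1 - β ^ d) else 0

lemma one_sub_pow_pos {d : ℕ} (hd : 2 ≤ d) {β : ℝ} (h0 : 0 < β) (h1 : β < 1) : 0 < 1 - β ^ d := by
  have := pow_lt_one₀ h0.le h1 (n := d) (by omega)
  linarith

lemma deadWt_nonneg {d : ℕ} (hd : 2 ≤ d) {β : ℝ} (h0 : 0 < β) (h1 : β < 1) (c : ℕ) :
    0 ≤ deadWt d β c := by
  unfold deadWt
  have := one_sub_pow_pos hd h0 h1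
  have : 0 < 1 - β := by linarith
  split_ifs <;> positivity

lemma sum_deadWt_mul {d : ℕ} (β : ℝ) (g : ℕ → ℝ) :
    ∑ K : Finset (Fin d), deadWt d β K.card * g K.card =
      (∑ c ∈ Finset.range d, (d.choose c : ℝ) * (β ^ c * (1 - β) ^ (d - c) * g c)) /
        (1 - β ^ d) := by
  rw [sum_finset_fin d fun c => deadWt d β c * g c, Finset.sum_range_succ]
  simp only [deadWt, lt_irrefl, if_false, zero_mul, mul_zero, add_zero]
  rw [Finset.sum_div]
  refine Finset.sum_congr rfl fun c hc => ?_
  rw [if_pos (Finset.mem_range.1 hc)]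
  ring

lemma sum_deadWt {d : ℕ} (hd : 2 ≤ d) {β : ℝ} (h0 : 0 < β) (h1 : β < 1) :
    ∑ K : Finset (Fin d), deadWt d β K.card = 1 := by
  have h := sum_deadWt_mul (d := d) β fun _ => 1
  simp only [mul_one] at h
  rw [h, div_eq_one_iff_eq (one_sub_pow_pos hd h0 h1).ne']
  have h2 := add_pow β (1 - β) d
  rw [Finset.sum_range_succ, add_sub_cancel, one_pow] at h2
  simp only [Nat.choose_self, Nat.sub_self, pow_zero, mul_one, Nat.cast_one] at h2
  refine eq_sub_of_add_eq (Eq.trans ?_ h2.symm)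
  congr 1
  exact Finset.sum_congr rfl fun c _ => by rw [mul_comm]

lemma sum_deadWt_mul_excess {d : ℕ} (hd : 2 ≤ d) {β : ℝ} (h1 : β < 1) :
    ∑ K : Finset (Fin d), deadWt d β K.card * excess d K.card = gker d β := by
  rw [sum_deadWt_mul β fun c => (excess d c : ℝ), gker_eq hd h1]
  congr 1
  have hb := congrArg (Polynomial.eval β) (bernsteinPolynomial.sum_smul ℝ d)
  rw [Polynomial.eval_finsetSum] at hb
  simp only [bernsteinPolynomial, nsmul_eq_mul, Polynomial.eval_mul, Polynomial.eval_natCast,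
    Polynomial.eval_pow, Polynomial.eval_X, Polynomial.eval_sub, Polynomial.eval_one] at hb
  obtain ⟨j, rfl⟩ : ∃ j, d = j + 2 := ⟨d - 2, by omega⟩
  rw [Finset.sum_range_succ, Finset.sum_range_succ] at hb
  rw [Finset.sum_range_succ]
  have he : ∀ c ∈ Finset.range (j + 1), ((j + 2).choose c : ℝ) *
      (β ^ c * (1 - β) ^ (j + 2 - c) * (excess (j + 2) c : ℝ)) =
      (c : ℝ) * (((j + 2).choose c : ℝ) * β ^ c * (1 - β) ^ (j + 2 - c)) := fun c hc => by
    have : excess (j + 2) c = c := by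
      unfold excess
      rw [if_neg (by have := Finset.mem_range.1 hc; omega), Nat.sub_zero]
    rw [this]; ring
  rw [Finset.sum_congr rfl he]
  have hex : excess (j + 2) (j + 1) = j := by unfold excess; simp
  rw [hex, show j + 2 - 1 = j + 1 by omega]
  simp only [Nat.choose_self, Nat.choose_succ_self_right, Nat.sub_self, pow_zero,
    show j + 2 - (j + 1) = 1 by omega, pow_one, Nat.cast_one] at hb ⊢
  push_cast at hb ⊢
  linear_combination hb

lemma exists_finset_fin {d c : ℕ} (h : c ≤ d) : ∃ K : Finset (Fin d), K.card = c := by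
  obtain ⟨K, -, hK⟩ := Finset.exists_subset_card_eq (s := (Finset.univ : Finset (Fin d)))
    (n := c) (by simpa using h)
  exact ⟨K, hK⟩

end DeadSets

section DeadClass

variable {J : Type*} [Fintype J] [DecidableEq J]

open Classical in
lemma exists_dead_class (δ : J → ℕ) (D k₀ : ℕ) {β : ℝ} (h0 : 0 < β) (h1 : β < 1)
    (h2 : ∀ v, 2 ≤ δ v) (hD : ∀ v, δ v ≤ D) (F : Finset J) (j₀ : J) (hj₀ : j₀ ∉ F)
    (hk₀ : 3 ≤ k₀) (hF : ∀ v ∈ F, δ v = k₀) (hδj₀ : δ j₀ = k₀) {T : ℝ} (hT0 : 0 < T)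
    (hT : 4 * (Fintype.card J * (D : ℝ) ^ 2) ≤ T ^ 2) :
    ∃ (X u : ℕ) (𝒦 : Finset (∀ v, Finset (Fin (δ v)))),
      (∀ K ∈ 𝒦, ∀ v, (K v).card < δ v) ∧
      (∀ K ∈ 𝒦, (Finset.univ.filter fun v => (K v).card + 1 = δ v).card + X = u) ∧
      (∀ K ∈ 𝒦, ∑ v, (K v).card = u) ∧
      (∀ K ∈ 𝒦, ∀ v ∈ F, (K v).card + 2 = δ v) ∧
      𝒦.Nonempty ∧
      Even (∑ v, δ v + X) ∧ |(X : ℝ) - ∑ v, gker (δ v) β| ≤ T + (F.card + 1) * D ∧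
      (∏ v, (1 - β ^ δ v)) * (1 / 4) ≤
        ((1 / (β * (1 - β)) ^ k₀) ^ (F.card + 1) * (((∑ v, δ v : ℕ) : ℝ) + 1) ^ 2) *
          (𝒦.card * (β ^ u * (1 - β) ^ (∑ v, δ v - u))) := by
  have hS2 : ∀ v, ∃ K : Finset (Fin (δ v)), K.card = δ v - 2 := fun v =>
    exists_finset_fin (Nat.sub_le _ _)
  have hS3 : ∀ v, ∃ K : Finset (Fin (δ v)), K.card = δ v - 3 := fun v =>
    exists_finset_fin (Nat.sub_le _ _)
  choose S₂ hS₂ using hS2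
  choose S₃ hS₃ using hS3
  have hj₀3 : 3 ≤ δ j₀ := hδj₀ ▸ hk₀
  have hS23 : S₂ j₀ ≠ S₃ j₀ := fun h => by
    have := hS₂ j₀
    rw [h, hS₃] at this
    omega
  let q : ∀ v, Finset (Fin (δ v)) → ℝ := fun v K =>
    if v = j₀ then (if K = S₂ v then 1 / 2 else 0) + (if K = S₃ v then 1 / 2 else 0)
    else if v ∈ F then (if K = S₂ v then 1 else 0)
    else deadWt (δ v) β K.card
  have hqj₀ : ∀ K, q j₀ K = (if K = S₂ j₀ then 1 / 2 else 0) + (if K = S₃ j₀ then 1 / 2 else 0) :=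
    fun K => if_pos rfl
  have hqF : ∀ v ∈ F, ∀ K, q v K = if K = S₂ v then 1 else 0 := fun v hv K => by
    simp only [q]
    rw [if_neg (fun h : v = j₀ => hj₀ (h ▸ hv)), if_pos hv]
  have hqo : ∀ v, v ≠ j₀ → v ∉ F → ∀ K, q v K = deadWt (δ v) β K.card := fun v h h' K => by
    simp only [q]
    rw [if_neg h, if_neg h']
  have hcases : ∀ v, v = j₀ ∨ v ∈ F ∨ (v ≠ j₀ ∧ v ∉ F) := fun v => by tauto
  have hq0 : ∀ v K, 0 ≤ q v K := by
    intro v K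
    rcases hcases v with rfl | h | ⟨h, h'⟩
    · rw [hqj₀]; positivity
    · rw [hqF v h]; positivity
    · rw [hqo v h h']; exact deadWt_nonneg (h2 v) h0 h1 _
  have hq : ∀ v, ∑ K, q v K = 1 := by
    intro v
    rcases hcases v with rfl | h | ⟨h, h'⟩
    · simp only [hqj₀, Finset.sum_add_distrib, Finset.sum_ite_eq', Finset.mem_univ, if_true]
      norm_num
    · simp [hqF v h]
    · simp only [hqo v h h']; exact sum_deadWt (h2 v) h0 h1
  have hEx : ∀ v K, excess (δ v) (Finset.card (α := Fin (δ v)) K) ≤ δ v := fun v K => by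
    have : K.card ≤ δ v := (Finset.card_le_univ K).trans (by simp)
    unfold excess; omega
  have hCd : ∀ v (K : Finset (Fin (δ v))), K.card ≤ δ v := fun v K =>
    (Finset.card_le_univ K).trans (by simp)
  obtain ⟨X, u, hE, hdev, hsum⟩ := exists_large_class (Ω := fun v => Finset (Fin (δ v))) q hq0 hq
    (fun v K => excess (δ v) K.card) (fun v K => K.card) D (∑ v, δ v) (∑ v, δ v)
    (fun v K => (hEx v K).trans (hD v)) (fun ω => Finset.sum_le_sum fun v _ => hEx v _)
    (fun ω => Finset.sum_le_sum fun v _ => hCd v _) j₀ (by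
      simp only [hqj₀, add_mul, ite_mul, zero_mul, Finset.sum_add_distrib, Finset.sum_ite_eq',
        Finset.mem_univ, if_true, hS₂, hS₃]
      have e2 : excess (δ j₀) (δ j₀ - 2) = excess (δ j₀) (δ j₀ - 3) + 1 := by
        unfold excess
        rw [if_neg (by omega), if_neg (by omega)]
        omega
      rw [e2, pow_succ]
      ring) hT0 hT
  set 𝒦 : Finset (∀ v, Finset (Fin (δ v))) := Finset.univ.filter fun K =>
    (∑ v, excess (δ v) (K v).card = X ∧ ∑ v, (K v).card = u) ∧ ∏ v, q v (K v) ≠ 0 with h𝒦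
  have hmem : ∀ K ∈ 𝒦, ∑ v, excess (δ v) (K v).card = X ∧ ∑ v, (K v).card = u ∧
      ∀ v, q v (K v) ≠ 0 := by
    intro K hK
    obtain ⟨-, ⟨h3, h4⟩, h5⟩ := Finset.mem_filter.1 hK
    exact ⟨h3, h4, fun v => Finset.prod_ne_zero_iff.1 h5 v (Finset.mem_univ v)⟩
  have hsupF : ∀ v ∈ F, ∀ K, q v K ≠ 0 → K = S₂ v := by
    intro v hv K hK
    by_contra h
    rw [hqF v hv, if_neg h] at hK
    exact hK rfl
  have hlt : ∀ v K, q v K ≠ 0 → Finset.card (α := Fin (δ v)) K < δ v := by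
    intro v K hK
    have h2v := h2 v
    rcases hcases v with rfl | h | ⟨h, h'⟩
    · by_cases h3 : K = S₂ v
      · rw [h3, hS₂]; omega
      · by_cases h4 : K = S₃ v
        · rw [h4, hS₃]; omega
        · rw [hqj₀, if_neg h3, if_neg h4] at hK
          simp at hK
    · rw [hsupF v h K hK, hS₂]; omega
    · by_contra h3
      rw [hqo v h h', deadWt, if_neg h3] at hK
      exact hK rfl
  have hβ : 0 < 1 - β := by linarith
  set B : ℝ := 1 / (β * (1 - β)) ^ k₀ with hB
  have hBpos : 0 < B := by positivity
  -- pointwise comparison of the weights with the product law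
  have hcmp : ∀ v K, q v K ≠ 0 → q v K ≤ (if v ∈ insert j₀ F then B else 1) *
      (β ^ (Finset.card (α := Fin (δ v)) K) * (1 - β) ^ (δ v - K.card) / (1 - β ^ δ v)) := by
    intro v K hK
    by_cases hv : v ∈ insert j₀ F
    · rw [if_pos hv]
      have hδv : δ v = k₀ := by
        rcases Finset.mem_insert.1 hv with rfl | hv
        · exact hδj₀
        · exact hF v hv
      have hq1 : q v K ≤ 1 := by
        rw [← hq v]
        exact Finset.single_le_sum (fun K _ => hq0 v K) (Finset.mem_univ K)
      refine hq1.trans ?_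
      have hd := one_sub_pow_pos (h2 v) h0 h1
      have hd1 : 1 - β ^ δ v ≤ 1 := by
        have : 0 ≤ β ^ δ v := by positivity
        linarith
      have hlow : (β * (1 - β)) ^ k₀ ≤ β ^ K.card * (1 - β) ^ (δ v - K.card) := by
        rw [mul_pow]
        refine mul_le_mul ?_ ?_ (by positivity) (by positivity)
        · exact pow_le_pow_of_le_one h0.le h1.le (by rw [← hδv]; exact hCd v K)
        · exact pow_le_pow_of_le_one hβ.le (by linarith) (by rw [← hδv]; exact Nat.sub_le _ _)
      rw [hB, one_div, ← div_eq_inv_mul, le_div_iff₀ (by positivity), one_mul, le_div_iff₀ hd]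
      calc _ ≤ (β * (1 - β)) ^ k₀ * 1 := by gcongr
        _ ≤ _ := by rw [mul_one]; exact hlow
    · rw [if_neg hv, one_mul]
      rw [Finset.mem_insert, not_or] at hv
      rw [hqo v hv.1 hv.2, deadWt, if_pos (hlt v K hK)]
  have hPpos : 0 < ∏ v, (1 - β ^ δ v) := Finset.prod_pos fun v _ => one_sub_pow_pos (h2 v) h0 h1
  have hprodB : ∏ v, (if v ∈ insert j₀ F then B else 1) = B ^ (F.card + 1) := by
    rw [← Finset.prod_filter, Finset.filter_univ_mem, Finset.prod_const,
      Finset.card_insert_of_notMem hj₀]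
  have hW : ∀ K ∈ 𝒦, ∏ v, q v (K v) ≤ B ^ (F.card + 1) *
      (β ^ u * (1 - β) ^ (∑ v, δ v - u)) / ∏ v, (1 - β ^ δ v) := by
    intro K hK
    obtain ⟨-, hu, hne⟩ := hmem K hK
    have hsub : ∑ v, (δ v - (K v).card) = ∑ v, δ v - u := by
      rw [← hu, Finset.sum_tsub_distrib _ fun v _ => hCd v _]
    refine (Finset.prod_le_prod (fun v _ => hq0 v _) fun v _ => hcmp v _ (hne v)).trans
      (le_of_eq ?_)
    rw [Finset.prod_mul_distrib, hprodB, Finset.prod_div_distrib, Finset.prod_mul_distrib,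
      Finset.prod_pow_eq_pow_sum, Finset.prod_pow_eq_pow_sum, hu, hsub]
    ring
  have hsum𝒦 : ∑ K : ∀ v, Finset (Fin (δ v)) with
      ∑ v, excess (δ v) (K v).card = X ∧ ∑ v, (K v).card = u, ∏ v, q v (K v) =
      ∑ K ∈ 𝒦, ∏ v, q v (K v) := by
    refine (Finset.sum_filter_ne_zero _).symm.trans ?_
    rw [Finset.filter_filter]
  have hsum' : 1 / 4 ≤ (((∑ v, δ v : ℕ) : ℝ) + 1) ^ 2 * ∑ K ∈ 𝒦, ∏ v, q v (K v) := by
    rw [← hsum𝒦]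
    convert hsum using 4
  refine ⟨X, u, 𝒦, fun K hK v => hlt v _ ((hmem K hK).2.2 v), ?_, fun K hK => (hmem K hK).2.1, ?_,
    ?_, hE, ?_, ?_⟩
  · intro K hK
    obtain ⟨hx, hu, -⟩ := hmem K hK
    rw [← hx, ← hu, Finset.card_filter, ← Finset.sum_add_distrib]
    exact Finset.sum_congr rfl fun v _ => by rw [add_comm, excess_add (h2 v)]
  · intro K hK v hv
    rw [hsupF v hv _ ((hmem K hK).2.2 v), hS₂]
    exact Nat.sub_add_cancel (h2 v)
  · rw [Finset.nonempty_iff_ne_empty]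
    intro h
    rw [h] at hsum'
    norm_num at hsum'
  · have hdiff : |∑ v, ∑ K, q v K * (excess (δ v) K.card : ℝ) - ∑ v, gker (δ v) β| ≤
        (F.card + 1) * D := by
      rw [← Finset.sum_sub_distrib]
      refine (Finset.abs_sum_le_sum_abs _ _).trans ?_
      have hterm : ∀ v, |∑ K, q v K * (excess (δ v) K.card : ℝ) - gker (δ v) β| ≤
          if v ∈ insert j₀ F then (D : ℝ) else 0 := by
        intro v
        split_ifs with hv
        · have hDv : (δ v : ℝ) ≤ D := by exact_mod_cast hD v
          have e1 : 0 ≤ ∑ K, q v K * (excess (δ v) K.card : ℝ) :=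
            Finset.sum_nonneg fun K _ => mul_nonneg (hq0 v K) (Nat.cast_nonneg _)
          have e2 : ∑ K, q v K * (excess (δ v) K.card : ℝ) ≤ δ v := by
            calc _ ≤ ∑ K, q v K * (δ v : ℝ) := Finset.sum_le_sum fun K _ =>
                  mul_le_mul_of_nonneg_left (by exact_mod_cast hEx v K) (hq0 v K)
              _ = δ v := by rw [← Finset.sum_mul, hq, one_mul]
          have e3 := gker_nonneg (δ v) h0.le
          have e4 := gker_le (δ v) h0.le
          rw [abs_le]
          constructor <;> linarith
        · rw [Finset.mem_insert, not_or] at hv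
          simp only [hqo v hv.1 hv.2]
          rw [sum_deadWt_mul_excess (h2 v) h1, sub_self, abs_zero]
      refine (Finset.sum_le_sum fun v _ => hterm v).trans (le_of_eq ?_)
      rw [← Finset.sum_filter, Finset.filter_univ_mem, Finset.sum_const,
        Finset.card_insert_of_notMem hj₀, nsmul_eq_mul]
      push_cast
      ring
    calc _ ≤ |(X : ℝ) - ∑ v, ∑ K, q v K * (excess (δ v) K.card : ℝ)| +
          |∑ v, ∑ K, q v K * (excess (δ v) K.card : ℝ) - ∑ v, gker (δ v) β| := abs_sub_le _ _ _
      _ ≤ _ := add_le_add hdev hdiff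
  · have h3 := hsum'.trans (mul_le_mul_of_nonneg_left (Finset.sum_le_card_nsmul _ _ _ hW)
      (by positivity))
    rw [nsmul_eq_mul] at h3
    have halg : ∀ P N c b w : ℝ, P ≠ 0 → P * (N * (c * (b * w / P))) = b * N * (c * w) :=
      fun P N c b w hP => by field_simp
    calc _ ≤ (∏ v, (1 - β ^ δ v)) * ((((∑ v, δ v : ℕ) : ℝ) + 1) ^ 2 * (𝒦.card *
          (B ^ (F.card + 1) * (β ^ u * (1 - β) ^ (∑ v, δ v - u)) / ∏ v, (1 - β ^ δ v)))) := by
          gcongr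
      _ = _ := halg _ _ _ _ _ hPpos.ne'

end DeadClass

section LowerCombined

variable {J : Type*} [Fintype J] [DecidableEq J]

lemma exists_connRatio_ge (δ : J → ℕ) (D k₀ R : ℕ) {β : ℝ} (h0 : 0 < β) (h1 : β < 1)
    (h2 : ∀ v, 2 ≤ δ v) (hD : ∀ v, δ v ≤ D) (F : Finset J) (j₀ : J) (hj₀ : j₀ ∉ F)
    (hk₀ : 3 ≤ k₀) (hF : ∀ v ∈ F, δ v = k₀) (hδj₀ : δ j₀ = k₀) (hFR : F.card = 2 * R)
    (hR : Even R) (hb : 2 * (D + D ^ 2) + 2 ≤ R) {T : ℝ} (hT0 : 0 < T)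
    (hT : 4 * (Fintype.card J * (D : ℝ) ^ 2) ≤ T ^ 2) :
    ∃ (X : ℕ) (m : ℕ →₀ ℕ), m = ∑ v, Finsupp.single (δ v) 1 + Finsupp.single 1 X ∧
      |(X : ℝ) - ∑ v, gker (δ v) β| ≤ T + (2 * R + 1) * D ∧
      Even (∑ v, δ v + X) ∧
      (R : ℝ) ^ (2 * R) * ((∏ v, (1 - β ^ δ v)) * (1 / 4) * (1 - β) ^ X) * cC m ≤
        ((1 / (β * (1 - β)) ^ k₀) ^ (2 * R + 1) * (((∑ v, δ v : ℕ) : ℝ) + 1) ^ 2) *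
          ((totalDeg m : ℝ) * (10 * totalDeg m) ^ (2 * R) * 6 ^ R) *
          (1 - β ^ 2) ^ (totalDeg m / 2) * cSc m := by
  obtain ⟨X, u, 𝒦, hne, hU, hDs, hKF, ⟨K₀, hK₀⟩, hE, hdev, hcount⟩ :=
    exists_dead_class δ D k₀ h0 h1 h2 hD F j₀ hj₀ hk₀ hF hδj₀ hT0 hT
  obtain ⟨Rv, hRvF, hRv⟩ := Finset.exists_subset_card_eq (s := F) (n := R) (by omega)
  have hsize : 2 * u + 4 * R ≤ ∑ v, δ v + X := by
    have hterm : ∀ v, (K₀ v).card + ((if (K₀ v).card + 1 = δ v then 1 else 0) +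
        (if v ∈ F then 2 else 0)) ≤ δ v := by
      intro v
      have e1 := hne K₀ hK₀ v
      have e2 := hKF K₀ hK₀ v
      split_ifs with h3 h4 h4
      · have := e2 h4
        omega
      · omega
      · have := e2 h4
        omega
      · omega
    have hs := Finset.sum_le_sum fun v (_ : v ∈ Finset.univ) => hterm v
    rw [Finset.sum_add_distrib, Finset.sum_add_distrib, hDs K₀ hK₀, ← Finset.card_filter,
      ← Finset.sum_filter, Finset.filter_univ_mem, Finset.sum_const, smul_eq_mul, hFR] at hs
    have h3 : (Finset.univ.filter fun v => (K₀ v).card + 1 = δ v).card + X = u := by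
      convert hU K₀ hK₀
    omega
  obtain ⟨k, hk⟩ : ∃ k, ∑ v, δ v + X = 2 * u + (3 * R + 2 * k) := by
    obtain ⟨a, ha⟩ := hE
    obtain ⟨b, hb'⟩ := hR
    exact ⟨a - u - 3 * b, by omega⟩
  have hRpos : 0 < R := by omega
  obtain ⟨v, hv⟩ := Finset.card_pos.1 (hRv ▸ hRpos)
  refine ⟨X, _, rfl, ?_, hE, ?_⟩
  · rw [hFR] at hdev
    push_cast at hdev
    exact hdev
  · rw [hFR] at hcount
    have hβ : 0 < β * (1 - β) := mul_pos h0 (by linarith)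
    refine connRatio_ge δ _ X rfl 𝒦 Rv D R k u (fun v => by have := h2 v; omega) hne ?_ hDs hRv
      (fun K hK v hv => hKF K hK v (hRvF hv)) hk ⟨v, hv, ?_⟩ hD hR hb h0 h1 (by positivity) hcount
    · intro K hK
      convert hU K hK
    · rw [hF v (hRvF hv)]; omega

end LowerCombined

section Beta

lemma gker_continuousOn (k : ℕ) : ContinuousOn (gker k) (Set.Icc 0 1) := by
  rcases k.eq_zero_or_pos with rfl | hk
  · have : gker 0 = fun _ => 0 := by funext x; simp [gker]
    rw [this]
    exact continuousOn_const
  · unfold gker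
    refine ContinuousOn.div (by fun_prop) (by fun_prop) fun x hx => ?_
    have : 0 < ∑ i ∈ Finset.range k, x ^ i :=
      Finset.sum_pos' (fun i _ => pow_nonneg hx.1 i) ⟨0, Finset.mem_range.2 hk, by simp⟩
    exact this.ne'

lemma gker_zero_right (k : ℕ) : gker k 0 = 0 := by simp [gker]

lemma gker_one_right (k : ℕ) : gker k 1 = ((k - 2 : ℕ) : ℝ) := by
  unfold gker
  rcases k.eq_zero_or_pos with rfl | hk
  · simp
  · have : (k : ℝ) ≠ 0 := by positivity
    simp only [one_pow, Finset.sum_const, Finset.card_range, nsmul_eq_mul, mul_one]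
    field_simp

variable {p : ℕ → ℝ}

lemma summable_of_summable_mul (hp0 : p 0 = 0) (hpnn : ∀ i, 0 ≤ p i)
    (hmom : Summable fun i : ℕ => (i : ℝ) * p i) : Summable p := by
  refine Summable.of_nonneg_of_le hpnn (fun i => ?_) hmom
  rcases i.eq_zero_or_pos with rfl | hi
  · simp [hp0]
  · have : (1 : ℝ) ≤ i := by exact_mod_cast hi
    nlinarith [hpnn i]

lemma summable_mul_gker (hpnn : ∀ i, 0 ≤ p i) (hmom : Summable fun i : ℕ => (i : ℝ) * p i)
    {x : ℝ} (hx : 0 ≤ x) : Summable fun k => p k * gker k x := by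
  refine Summable.of_nonneg_of_le (fun i => mul_nonneg (hpnn i) (gker_nonneg i hx)) (fun i => ?_)
    hmom
  rw [mul_comm]
  exact mul_le_mul_of_nonneg_right (gker_le i hx) (hpnn i)

lemma continuousOn_tsum_gker (hpnn : ∀ i, 0 ≤ p i) (hmom : Summable fun i : ℕ => (i : ℝ) * p i) :
    ContinuousOn (fun x => ∑' k, p k * gker k x) (Set.Icc 0 1) := by
  refine continuousOn_tsum (fun k => continuousOn_const.mul (gker_continuousOn k)) hmom
    fun k x hx => ?_
  rw [Real.norm_of_nonneg (mul_nonneg (hpnn k) (gker_nonneg k hx.1)), mul_comm]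
  exact mul_le_mul_of_nonneg_right (gker_le k hx.1) (hpnn k)

lemma fixed_point_iff (hp0 : p 0 = 0) (hpnn : ∀ i, 0 ≤ p i)
    (hmom : Summable fun i : ℕ => (i : ℝ) * p i) {x : ℝ} (hx0 : 0 < x) (hx1 : x < 1) :
    (∑' k : ℕ, (k : ℝ) * p k = (1 - x ^ 2) * ∑' k : ℕ, (k : ℝ) * p k / (1 - x ^ k)) ↔
      ∑' k, p k * gker k x = p 1 := by
  have hs2 : Summable fun k : ℕ => (k : ℝ) * p k / (1 - x ^ k) := by
    refine Summable.of_nonneg_of_le (fun k => ?_) (fun k => ?_) (hmom.div_const (1 - x))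
    · refine div_nonneg (mul_nonneg k.cast_nonneg (hpnn k)) ?_
      have := pow_le_one₀ hx0.le hx1.le (n := k)
      linarith
    · rcases k.eq_zero_or_pos with rfl | hk
      · simp [hp0]
      · have hle := pow_le_of_le_one hx0.le hx1.le hk.ne'
        have h1 : 0 < 1 - x := by linarith
        have := mul_nonneg (k.cast_nonneg (α := ℝ)) (hpnn k)
        gcongr
  have hterm : ∀ k : ℕ, (k : ℝ) * p k - (1 - x ^ 2) * ((k : ℝ) * p k / (1 - x ^ k)) =
      x * (p k * gker k x) - (if k = 1 then x * p 1 else 0) := by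
    intro k
    rcases k with _ | _ | k
    · simp [hp0]
    · have : 1 - x ≠ 0 := by linarith
      simp [gker]
      field_simp
      ring
    · have h := one_sub_pow_pos (d := k + 2) (by omega) hx0 hx1
      rw [gker_eq (by omega) hx1, if_neg (by omega)]
      rw [show k + 1 + 1 - 1 = k + 1 by omega]
      have h' : 1 - x ^ (k + 1 + 1) ≠ 0 := h.ne'
      field_simp
      ring
  have hsum : (∑' k : ℕ, (k : ℝ) * p k) - (1 - x ^ 2) * ∑' k : ℕ, (k : ℝ) * p k / (1 - x ^ k) =
      x * ((∑' k, p k * gker k x) - p 1) := by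
    rw [← tsum_mul_left, ← hmom.tsum_sub (hs2.mul_left _), tsum_congr hterm,
      Summable.tsum_sub ((summable_mul_gker hpnn hmom hx0.le).mul_left _)
        (hasSum_ite_eq 1 (x * p 1)).summable, tsum_ite_eq, tsum_mul_left]
    ring
  rw [← sub_eq_zero, hsum, mul_eq_zero, sub_eq_zero]
  exact or_iff_right hx0.ne'

lemma betaOf_spec (hp0 : p 0 = 0) (hpnn : ∀ i, 0 ≤ p i) (hpsum : ∑' i : ℕ, p i = 1)
    (hmom : Summable fun i : ℕ => (i : ℝ) * p i) (hP1 : 0 < p 1)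
    (hP2 : 2 < ∑' i : ℕ, (i : ℝ) * p i) :
    0 < betaOf p ∧ betaOf p < 1 ∧ ∑' k, p k * gker k (betaOf p) = p 1 ∧
      ∀ x, 0 ≤ x → x < betaOf p → ∑' k, p k * gker k x < p 1 := by
  set G : ℝ → ℝ := fun x => ∑' k, p k * gker k x with hG
  have hcont : ContinuousOn G (Set.Icc 0 1) := continuousOn_tsum_gker hpnn hmom
  have hG0 : G 0 = 0 := by simp [hG, gker_zero_right]
  have hsp := summable_of_summable_mul hp0 hpnn hmom
  have hG1 : p 1 < G 1 := by
    have hterm : ∀ k : ℕ, p k * gker k 1 = (k : ℝ) * p k - 2 * p k + (if k = 1 then p 1 else 0) := by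
      intro k
      rw [gker_one_right]
      rcases k with _ | _ | k
      · simp [hp0]
      · simp; ring
      · rw [show k + 1 + 1 - 2 = k by omega, if_neg (by omega)]
        push_cast
        ring
    have : G 1 = ∑' i : ℕ, (i : ℝ) * p i - 2 * 1 + p 1 := by
      rw [hG]
      simp only []
      rw [tsum_congr hterm, Summable.tsum_add (hmom.sub (hsp.mul_left 2))
        (hasSum_ite_eq 1 (p 1)).summable, hmom.tsum_sub (hsp.mul_left 2), tsum_mul_left, hpsum,
        tsum_ite_eq]
    rw [this]
    linarith
  set S : Set ℝ := {β : ℝ | β ∈ Set.Ioo 0 1 ∧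
    ∑' k : ℕ, (k : ℝ) * p k = (1 - β ^ 2) * ∑' k : ℕ, (k : ℝ) * p k / (1 - β ^ k)} with hS
  have hSeq : S = Set.Icc 0 1 ∩ G ⁻¹' {p 1} := by
    ext x
    simp only [hS, Set.mem_ofPred_eq, Set.mem_inter_iff, Set.mem_preimage, Set.mem_singleton_iff]
    constructor
    · rintro ⟨⟨h0, h1⟩, h⟩
      exact ⟨⟨h0.le, h1.le⟩, (fixed_point_iff hp0 hpnn hmom h0 h1).1 h⟩
    · rintro ⟨⟨h0, h1⟩, h⟩
      have h0' : 0 < x := lt_of_le_of_ne h0 fun e => by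
        rw [← e, hG0] at h; exact hP1.ne h
      have h1' : x < 1 := lt_of_le_of_ne h1 fun e => by
        rw [e] at h; exact hG1.ne' h
      exact ⟨⟨h0', h1'⟩, (fixed_point_iff hp0 hpnn hmom h0' h1').2 h⟩
  have hclosed : IsClosed S := by
    rw [hSeq]
    exact hcont.preimage_isClosed_of_isClosed isClosed_Icc isClosed_singleton
  have hne : S.Nonempty := by
    obtain ⟨x, hx, hxG⟩ := intermediate_value_Icc zero_le_one hcont (show p 1 ∈ Set.Icc (G 0) (G 1) from
      ⟨by rw [hG0]; exact hP1.le, hG1.le⟩)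
    exact ⟨x, by rw [hSeq]; exact ⟨hx, hxG⟩⟩
  have hbdd : BddBelow S := ⟨0, fun x hx => hx.1.1.le⟩
  have hmem : betaOf p ∈ S := hclosed.csInf_mem hne hbdd
  have hmem' := hmem
  rw [hSeq] at hmem'
  refine ⟨hmem.1.1, hmem.1.2, hmem'.2, fun x hx0 hx => ?_⟩
  by_contra! hcon
  have hsub : Set.Icc 0 x ⊆ Set.Icc (0 : ℝ) 1 := Set.Icc_subset_Icc_right (hx.le.trans hmem.1.2.le)
  obtain ⟨y, hy, hyG⟩ := intermediate_value_Icc hx0 (hcont.mono hsub)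
    (show p 1 ∈ Set.Icc (G 0) (G x) from ⟨by rw [hG0]; exact hP1.le, hcon⟩)
  have : y ∈ S := by rw [hSeq]; exact ⟨hsub hy, hyG⟩
  have := csInf_le hbdd this
  have h' : betaOf p ≤ y := this
  linarith [hy.2]

end Beta

section TypeOf

variable (d : (n : ℕ) → Fin n → ℕ) (n : ℕ)

lemma typeOf_apply (k : ℕ) : typeOf d n k = (Finset.univ.filter fun j => d n j = k).card := by
  unfold typeOf
  rw [Finsupp.coe_finsetSum, Finset.sum_apply, Finset.card_filter]
  exact Finset.sum_congr rfl fun j _ => Finsupp.single_apply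

lemma typeOf_zero (hd : ∀ j, 0 < d n j) : typeOf d n 0 = 0 := by
  rw [typeOf_apply, Finset.card_eq_zero, Finset.filter_eq_empty_iff]
  exact fun j _ => (hd j).ne'

lemma totalDeg_sum_single {J : Type*} [Fintype J] (δ : J → ℕ) :
    totalDeg (∑ v, Finsupp.single (δ v) 1) = ∑ v, δ v := by
  unfold totalDeg
  rw [← Finsupp.sum_finsetSum_index (by simp) (by intros; ring)]
  exact Finset.sum_congr rfl fun v _ => by simp

lemma totalDeg_typeOf : totalDeg (typeOf d n) = ℓTot d n := totalDeg_sum_single _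

lemma sum_filter_degree {M : Type*} [AddCommMonoid M] (s : Finset ℕ) (f : ℕ → M) :
    ∑ j with d n j ∈ s, f (d n j) = ∑ k ∈ s, typeOf d n k • f k := by
  rw [← Finset.sum_fiberwise_of_maps_to' (t := s) (g := d n)
    (fun j hj => (Finset.mem_filter.1 hj).2) f]
  refine Finset.sum_congr rfl fun k hk => ?_
  rw [Finset.sum_const, typeOf_apply, Finset.filter_filter]
  congr 2
  ext j
  simp only [Finset.mem_filter, Finset.mem_univ, true_and, and_iff_right_iff_imp]
  rintro rfl
  exact hk

lemma sum_subtype_degree {M : Type*} [AddCommMonoid M] (D : ℕ) (f : ℕ → M) :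
    ∑ v : {j : Fin n // 2 ≤ d n j ∧ d n j ≤ D}, f (d n v) =
      ∑ k ∈ Finset.Icc 2 D, typeOf d n k • f k := by
  rw [← sum_filter_degree]
  exact (Finset.sum_subtype _ (by simp) fun j => f (d n j)).symm

lemma exists_type_ge {D k₀ R : ℕ} {β T : ℝ} (h0 : 0 < β) (h1 : β < 1)
    (hk₀ : 3 ≤ k₀) (hkD : k₀ ≤ D) (hk : 2 * R + 1 ≤ typeOf d n k₀) (hR : Even R)
    (hb : 2 * (D + D ^ 2) + 2 ≤ R) (hT0 : 0 < T) (hT : 4 * ((n : ℝ) * (D : ℝ) ^ 2) ≤ T ^ 2)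
    (hX : ∑ k ∈ Finset.Icc 2 D, (typeOf d n k : ℝ) * gker k β + (T + (2 * R + 1) * D) ≤
      typeOf d n 1) :
    ∃ (X : ℕ) (m : ℕ →₀ ℕ), m ≤ typeOf d n ∧ X ≤ typeOf d n 1 ∧
      totalDeg m = ∑ k ∈ Finset.Icc 2 D, typeOf d n k * k + X ∧ Even (totalDeg m) ∧
      |(X : ℝ) - ∑ k ∈ Finset.Icc 2 D, (typeOf d n k : ℝ) * gker k β| ≤ T + (2 * R + 1) * D ∧
      (R : ℝ) ^ (2 * R) * ((∏ k ∈ Finset.Icc 2 D, (1 - β ^ k) ^ typeOf d n k) * (1 / 4) *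
        (1 - β) ^ X) * cC m ≤
      ((1 / (β * (1 - β)) ^ k₀) ^ (2 * R + 1) * ((ℓTot d n : ℝ) + 1) ^ 2) *
        ((ℓTot d n : ℝ) * (10 * ℓTot d n) ^ (2 * R) * 6 ^ R) *
        (1 - β ^ 2) ^ (totalDeg m / 2) * cSc m := by
  classical
  let J := {j : Fin n // 2 ≤ d n j ∧ d n j ≤ D}
  let δ : J → ℕ := fun v => d n v
  obtain ⟨A, hAs, hAc⟩ : ∃ A ⊆ (Finset.univ : Finset J).filter (fun v => δ v = k₀),
      A.card = 2 * R + 1 := by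
    refine Finset.exists_subset_card_eq (hk.trans ?_)
    rw [typeOf_apply]
    refine Finset.card_le_card_of_surjOn (fun v : J => (v : Fin n)) ?_
    intro j hj
    have hj : d n j = k₀ := by simpa using hj
    exact ⟨⟨j, by omega, by omega⟩, by simpa [δ] using hj, rfl⟩
  have hA : ∀ v ∈ A, δ v = k₀ := fun v hv => (Finset.mem_filter.1 (hAs hv)).2
  obtain ⟨j₀, hj₀⟩ : A.Nonempty := Finset.card_pos.1 (by omega)
  have hcard : Fintype.card J ≤ n := by
    simpa using Fintype.card_subtype_le fun j : Fin n => 2 ≤ d n j ∧ d n j ≤ D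
  obtain ⟨X, m, hm, hXs, hev, hmain⟩ := exists_connRatio_ge δ D k₀ R h0 h1 (fun v => v.2.1)
    (fun v => v.2.2) (A.erase j₀) j₀ (Finset.notMem_erase _ _) hk₀
    (fun v hv => hA v (Finset.mem_of_mem_erase hv)) (hA _ hj₀)
    (by rw [Finset.card_erase_of_mem hj₀, hAc]; omega) hR hb hT0
    (le_trans (by gcongr) hT)
  have hgk : ∑ v, gker (δ v) β = ∑ k ∈ Finset.Icc 2 D, (typeOf d n k : ℝ) * gker k β := by
    simpa using sum_subtype_degree d n D fun k => gker k β
  have hdeg : ∑ v, δ v = ∑ k ∈ Finset.Icc 2 D, typeOf d n k * k := by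
    simpa using sum_subtype_degree d n D fun k => k
  have hprod : ∏ v, (1 - β ^ δ v) = ∏ k ∈ Finset.Icc 2 D, (1 - β ^ k) ^ typeOf d n k := by
    have := sum_subtype_degree d n D fun k => Additive.ofMul (1 - β ^ k)
    simpa using congrArg Additive.toMul this
  rw [hgk] at hXs
  have hX1 : X ≤ typeOf d n 1 := by
    have := (abs_le.1 hXs).2
    exact_mod_cast (by linarith : (X : ℝ) ≤ typeOf d n 1)
  have htd : totalDeg m = ∑ k ∈ Finset.Icc 2 D, typeOf d n k * k + X := by
    rw [hm, totalDeg_add, totalDeg_sum_single, hdeg]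
    simp [totalDeg]
  have hmle : m ≤ typeOf d n := by
    intro k
    rw [hm, Finsupp.add_apply, Finsupp.coe_finsetSum, Finset.sum_apply]
    simp only [Finsupp.single_apply]
    rw [← Finset.card_filter]
    rcases eq_or_ne k 1 with rfl | hk1
    · rw [Finset.filter_eq_empty_iff.2 fun v _ => ?_]
      · simpa using hX1
      · have := v.2.1
        simp only [δ]
        omega
    · rw [if_neg hk1.symm, add_zero, typeOf_apply]
      exact Finset.card_le_card_of_injOn (fun v : J => (v : Fin n))
        (fun v hv => by simpa [δ] using hv) (fun a _ b _ h => Subtype.ext h)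
  have hℓ : totalDeg m ≤ ℓTot d n := by
    rw [← totalDeg_typeOf]
    obtain ⟨c, hc⟩ := le_iff_exists_add.1 hmle
    rw [hc, totalDeg_add]
    omega
  refine ⟨X, m, hmle, hX1, htd, ?_, hXs, ?_⟩
  · rw [htd, ← hdeg]
    exact hev
  · rw [hprod] at hmain
    refine hmain.trans ?_
    have hδℓ : ∑ v, δ v ≤ ℓTot d n := by omega
    have hβ : 0 < β * (1 - β) := mul_pos h0 (by linarith)
    have hβ2 : 0 ≤ 1 - β ^ 2 := by nlinarith
    gcongr

end TypeOf

/-- The logarithmic error in the lower bound on the probability of connectedness. -/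
noncomputable def rateErr (k₀ R ℓ : ℕ) (β : ℝ) : ℝ :=
  Real.log 4 + 3 * Real.log (ℓ + 1) - (2 * R + 1) * (k₀ * Real.log (β * (1 - β))) +
    (2 * R * (Real.log (10 * ℓ) - Real.log R) + R * Real.log 6)

lemma exists_log_connRatio_ge (d : (n : ℕ) → Fin n → ℕ) (n : ℕ) (hd : ∀ j, 0 < d n j)
    {D k₀ R : ℕ} {β T : ℝ} (h0 : 0 < β) (h1 : β < 1)
    (hk₀ : 3 ≤ k₀) (hkD : k₀ ≤ D) (hk : 2 * R + 1 ≤ typeOf d n k₀) (hR : Even R)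
    (hb : 2 * (D + D ^ 2) + 2 ≤ R) (hT0 : 0 < T) (hT : 4 * ((n : ℝ) * (D : ℝ) ^ 2) ≤ T ^ 2)
    (hX : ∑ k ∈ Finset.Icc 2 D, (typeOf d n k : ℝ) * gker k β + (T + (2 * R + 1) * D) ≤
      typeOf d n 1) :
    ∃ (X : ℕ) (m : ℕ →₀ ℕ), m ≤ typeOf d n ∧ X ≤ typeOf d n 1 ∧
      totalDeg m = ∑ k ∈ Finset.Icc 2 D, typeOf d n k * k + X ∧
      |(X : ℝ) - ∑ k ∈ Finset.Icc 2 D, (typeOf d n k : ℝ) * gker k β| ≤ T + (2 * R + 1) * D ∧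
      0 < cSc m ∧
      ∑ k ∈ Finset.Icc 2 D, (typeOf d n k : ℝ) * Real.log (1 - β ^ k) + X * Real.log (1 - β) -
        (totalDeg m : ℝ) / 2 * Real.log (1 - β ^ 2) - rateErr k₀ R (ℓTot d n) β ≤
        Real.log ((cSc m : ℝ) / cC m) := by
  obtain ⟨X, m, hm, hX1, htd, hev, hXs, hmain⟩ :=
    exists_type_ge d n h0 h1 hk₀ hkD hk hR hb hT0 hT hX
  refine ⟨X, m, hm, hX1, htd, hXs, ?_⟩
  have hm0 : m 0 = 0 := by simpa [typeOf_zero d n hd] using hm 0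
  have hC : 0 < cC m := by
    rw [cC_of_even m hm0 hev]
    exact Nat.doubleFactorial_pos _
  have hR0 : 0 < R := by omega
  have hβ : 0 < β * (1 - β) := mul_pos h0 (by linarith)
  have hβ2 : 0 < 1 - β ^ 2 := by nlinarith
  have hβ1 : 0 < 1 - β := by linarith
  have hprod : 0 < ∏ k ∈ Finset.Icc 2 D, (1 - β ^ k) ^ typeOf d n k :=
    Finset.prod_pos fun k hk => pow_pos (one_sub_pow_pos (Finset.mem_Icc.1 hk).1 h0 h1) _
  have hℓ : 0 < ℓTot d n := by
    have h3 : totalDeg m ≤ ℓTot d n := by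
      rw [← totalDeg_typeOf]
      obtain ⟨c, hc⟩ := le_iff_exists_add.1 hm
      rw [hc, totalDeg_add]
      omega
    have h4 : typeOf d n k₀ * k₀ ≤ totalDeg m := by
      rw [htd]
      exact (Finset.single_le_sum (f := fun k => typeOf d n k * k) (fun _ _ => Nat.zero_le _)
        (Finset.mem_Icc.2 ⟨by omega, hkD⟩)).trans (Nat.le_add_right _ _)
    have : 0 < typeOf d n k₀ * k₀ := Nat.mul_pos (by omega) (by omega)
    omega
  have hS : 0 < cSc m := by
    by_contra h
    obtain h : cSc m = 0 := by omega
    rw [h, Nat.cast_zero, mul_zero] at hmain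
    have : 0 < (R : ℝ) ^ (2 * R) * ((∏ k ∈ Finset.Icc 2 D, (1 - β ^ k) ^ typeOf d n k) * (1 / 4) *
        (1 - β) ^ X) * cC m := by positivity
    linarith
  refine ⟨hS, ?_⟩
  have hlog := Real.log_le_log (by positivity) hmain
  have hRr : (0 : ℝ) < R := by exact_mod_cast hR0
  have hCr : (0 : ℝ) < cC m := by exact_mod_cast hC
  have hSr : (0 : ℝ) < cSc m := by exact_mod_cast hS
  have hℓr : (0 : ℝ) < ℓTot d n := by exact_mod_cast hℓ
  have hB : 0 < (β * (1 - β)) ^ k₀ := by positivity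
  have hlp : Real.log (∏ k ∈ Finset.Icc 2 D, (1 - β ^ k) ^ typeOf d n k) =
      ∑ k ∈ Finset.Icc 2 D, (typeOf d n k : ℝ) * Real.log (1 - β ^ k) := by
    rw [Real.log_prod fun k hk =>
      (pow_pos (one_sub_pow_pos (Finset.mem_Icc.1 hk).1 h0 h1) _).ne']
    simp [Real.log_pow]
  have hdiv : ((totalDeg m / 2 : ℕ) : ℝ) = (totalDeg m : ℝ) / 2 := by
    rw [Nat.cast_div hev.two_dvd (by norm_num)]
    norm_num
  have e1 : Real.log ((R : ℝ) ^ (2 * R) * ((∏ k ∈ Finset.Icc 2 D, (1 - β ^ k) ^ typeOf d n k) *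
      (1 / 4) * (1 - β) ^ X) * cC m) = 2 * R * Real.log R +
      (∑ k ∈ Finset.Icc 2 D, (typeOf d n k : ℝ) * Real.log (1 - β ^ k) - Real.log 4 +
        X * Real.log (1 - β)) + Real.log (cC m) := by
    rw [Real.log_mul (by positivity) (by positivity), Real.log_mul (by positivity) (by positivity),
      Real.log_mul (by positivity) (by positivity), Real.log_mul (by positivity) (by positivity),
      hlp, Real.log_pow, Real.log_pow, one_div, Real.log_inv]
    push_cast
    ring
  have e2 : Real.log (((1 / (β * (1 - β)) ^ k₀) ^ (2 * R + 1) * ((ℓTot d n : ℝ) + 1) ^ 2) *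
        ((ℓTot d n : ℝ) * (10 * ℓTot d n) ^ (2 * R) * 6 ^ R) *
        (1 - β ^ 2) ^ (totalDeg m / 2) * cSc m) =
      (-(2 * R + 1) * (k₀ * Real.log (β * (1 - β))) + 2 * Real.log (ℓTot d n + 1)) +
      (Real.log (ℓTot d n) + 2 * R * Real.log (10 * ℓTot d n) + R * Real.log 6) +
      (totalDeg m : ℝ) / 2 * Real.log (1 - β ^ 2) + Real.log (cSc m) := by
    rw [Real.log_mul (by positivity) (by positivity), Real.log_mul (by positivity) (by positivity),
      Real.log_mul (by positivity) (by positivity), Real.log_mul (by positivity) (by positivity),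
      Real.log_mul (by positivity) (by positivity), Real.log_mul (by positivity) (by positivity),
      Real.log_pow, Real.log_pow, Real.log_pow, Real.log_pow, Real.log_pow, one_div, Real.log_inv,
      Real.log_pow, hdiv]
    push_cast
    ring
  rw [e1, e2] at hlog
  rw [Real.log_div hSr.ne' hCr.ne', rateErr]
  have : Real.log (ℓTot d n) ≤ Real.log (ℓTot d n + 1) := Real.log_le_log hℓr (by linarith)
  linarith

end PaperCM

namespace PaperCM

open Filter Topology

section Asymptotics

variable {d : (n : ℕ) → Fin n → ℕ} {p : ℕ → ℝ}

lemma tendsto_sum_typeOf_mul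
    (ha : ∀ i : ℕ, Tendsto (fun n : ℕ => (typeOf d n i : ℝ) / (n : ℝ)) atTop (𝓝 (p i)))
    (s : Finset ℕ) (c : ℕ → ℝ) :
    Tendsto (fun n : ℕ => (∑ k ∈ s, (typeOf d n k : ℝ) * c k) / (n : ℝ)) atTop
      (𝓝 (∑ k ∈ s, p k * c k)) := by
  have := tendsto_finsetSum s fun k _ => (ha k).mul_const (c k)
  refine this.congr fun n => ?_
  rw [Finset.sum_div]
  exact Finset.sum_congr rfl fun k _ => by ring

lemma tendsto_floor_div {ρ : ℝ} (hρ : 0 ≤ ρ) :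
    Tendsto (fun n : ℕ => ((⌊ρ * n⌋₊ : ℕ) : ℝ) / (n : ℝ)) atTop (𝓝 ρ) :=
  (tendsto_nat_floor_mul_div_atTop hρ).comp tendsto_natCast_atTop_atTop

lemma tendsto_log_div_nat {a : ℕ → ℝ} {μ : ℝ} (hμ : 0 < μ)
    (h : Tendsto (fun n : ℕ => a n / (n : ℝ)) atTop (𝓝 μ)) :
    Tendsto (fun n : ℕ => Real.log (a n + 1) / (n : ℝ)) atTop (𝓝 0) := by
  have h1 : Tendsto (fun n : ℕ => Real.log (n : ℝ) / (n : ℝ)) atTop (𝓝 0) := by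
    have := Real.isLittleO_log_id_atTop.tendsto_div_nhds_zero
    exact this.comp tendsto_natCast_atTop_atTop
  have h2 : Tendsto (fun n : ℕ => a n / (n : ℝ) + 1 / (n : ℝ)) atTop (𝓝 (μ + 0)) :=
    h.add tendsto_one_div_atTop_nhds_zero_nat
  have h3 := (h2.log (by simpa using hμ.ne')).mul tendsto_one_div_atTop_nhds_zero_nat
  have h4 := h1.add h3
  simp only [mul_zero, add_zero] at h4
  refine h4.congr' ?_
  have hpos := h2.eventually_const_lt (show 0 < μ + 0 by linarith)
  filter_upwards [hpos, eventually_gt_atTop 0] with n hn hn0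
  have hn0 : (0 : ℝ) < n := by exact_mod_cast hn0
  rw [← add_div] at hn ⊢
  have : 0 < a n + 1 := by
    rcases div_pos_iff.1 hn with h | h
    · exact h.1
    · linarith [h.2]
  rw [Real.log_div this.ne' hn0.ne']
  field_simp
  ring

lemma tendsto_rateErr
    (k₀ : ℕ) {β ρ μ : ℝ} (hρ : 0 < ρ) (hμ : 0 < μ)
    (hb : Tendsto (fun n : ℕ => (ℓTot d n : ℝ) / (n : ℝ)) atTop (𝓝 μ)) :
    Tendsto (fun n : ℕ => rateErr k₀ (2 * ⌊ρ * n⌋₊) (ℓTot d n) β / (n : ℝ)) atTop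
      (𝓝 (0 + 3 * 0 - (2 * (2 * ρ) + 0) * (k₀ * Real.log (β * (1 - β))) +
        (2 * (2 * ρ) * Real.log (10 * μ / (2 * ρ)) + 2 * ρ * Real.log 6))) := by
  have hf := (tendsto_floor_div hρ.le).const_mul 2
  have h0 : Tendsto (fun n : ℕ => 1 / (n : ℝ)) atTop (𝓝 0) := tendsto_one_div_atTop_nhds_zero_nat
  have h4 : Tendsto (fun n : ℕ => Real.log 4 * (1 / (n : ℝ))) atTop (𝓝 0) := by
    simpa using h0.const_mul (Real.log 4)
  have hl := ((hb.const_mul 10).div hf (by positivity)).log (by positivity)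
  have hd := (((hf.const_mul 2).add h0).mul_const (k₀ * Real.log (β * (1 - β))))
  have he := ((hf.const_mul 2).mul hl).add (hf.mul_const (Real.log 6))
  refine (((h4.add ((tendsto_log_div_nat hμ hb).const_mul 3)).sub hd).add he).congr' ?_
  filter_upwards [hb.eventually_const_lt hμ, hf.eventually_const_lt (show 0 < 2 * ρ by linarith),
    eventually_gt_atTop 0] with n h1 h2 h3
  have h3 : (0 : ℝ) < n := by exact_mod_cast h3
  have h1 : (ℓTot d n : ℝ) ≠ 0 := fun h => by simp [h] at h1
  have h2 : ((⌊ρ * n⌋₊ : ℕ) : ℝ) ≠ 0 := fun h => by simp [h] at h2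
  have : 10 * ((ℓTot d n : ℝ) / n) / (2 * ((⌊ρ * n⌋₊ : ℕ) / n)) =
      10 * (ℓTot d n : ℝ) / (2 * (⌊ρ * n⌋₊ : ℕ)) := by field_simp
  simp only [Pi.div_apply]
  rw [this, Real.log_div (by positivity) (by positivity), rateErr]
  push_cast
  field_simp

lemma tendsto_rateErr_limit (k₀ : ℕ) (β : ℝ) {μ : ℝ} (hμ : 0 < μ) :
    Tendsto (fun ρ : ℝ => 0 + 3 * 0 - (2 * (2 * ρ) + 0) * (k₀ * Real.log (β * (1 - β))) +
        (2 * (2 * ρ) * Real.log (10 * μ / (2 * ρ)) + 2 * ρ * Real.log 6)) (𝓝[>] 0) (𝓝 0) := by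
  have h0 : Tendsto (fun ρ : ℝ => ρ) (𝓝[>] 0) (𝓝 0) := tendsto_nhdsWithin_of_tendsto_nhds tendsto_id
  have h1 : Tendsto (fun ρ : ℝ => Real.log ρ * ρ) (𝓝[>] 0) (𝓝 0) := by
    have := tendsto_log_mul_rpow_nhdsGT_zero (r := 1) one_pos
    simpa using this
  have h2 := ((h0.mul_const (-4 * (k₀ * Real.log (β * (1 - β))) + 4 * Real.log (5 * μ) +
    2 * Real.log 6)).sub (h1.const_mul 4))
  simp only [zero_mul, mul_zero, sub_zero] at h2
  refine h2.congr' ?_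
  filter_upwards [self_mem_nhdsWithin] with ρ hρ
  have hρ : 0 < ρ := hρ
  rw [show 10 * μ / (2 * ρ) = 5 * μ / ρ by field_simp; norm_num,
    Real.log_div (by positivity) hρ.ne']
  ring

end Asymptotics

section Parameters

variable {p : ℕ → ℝ}

lemma log_one_sub_pow_nonpos {x : ℝ} (h0 : 0 ≤ x) (h1 : x < 1) (k : ℕ) :
    Real.log (1 - x ^ k) ≤ 0 := by
  apply Real.log_nonpos
  · have := pow_le_one₀ (n := k) h0 h1.le
    linarith
  · have := pow_nonneg h0 k
    linarith

lemma log_one_sub_pow_antitone {x y : ℝ} (h0 : 0 ≤ x) (hxy : x ≤ y) (h1 : y < 1) (k : ℕ) :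
    Real.log (1 - y ^ k) ≤ Real.log (1 - x ^ k) := by
  rcases Nat.eq_zero_or_pos k with rfl | hk
  · simp
  · have h2 : y ^ k < 1 := pow_lt_one₀ (h0.trans hxy) h1 hk.ne'
    have h3 : x ^ k ≤ y ^ k := pow_le_pow_left₀ h0 hxy k
    exact Real.log_le_log (by linarith) (by linarith)

lemma log_one_sub_le_log_one_sub_pow {x : ℝ} (h0 : 0 ≤ x) (h1 : x < 1) (k : ℕ) :
    Real.log (1 - x) ≤ Real.log (1 - x ^ k) := by
  rcases Nat.eq_zero_or_pos k with rfl | hk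
  · simpa using log_one_sub_pow_nonpos h0 h1 1
  · have : x ^ k ≤ x := pow_le_of_le_one h0 h1.le hk.ne'
    exact Real.log_le_log (by linarith) (by linarith)

lemma summable_mul_log (hp0 : p 0 = 0) (hpnn : ∀ i, 0 ≤ p i)
    (hmom : Summable fun i : ℕ => (i : ℝ) * p i) {x : ℝ} (h0 : 0 ≤ x) (h1 : x < 1) :
    Summable fun k => p k * Real.log (1 - x ^ k) := by
  have hs := (summable_of_summable_mul hp0 hpnn hmom).mul_right (-Real.log (1 - x))
  refine Summable.of_norm_bounded hs fun k => ?_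
  rw [norm_mul, Real.norm_of_nonneg (hpnn k), Real.norm_of_nonpos (log_one_sub_pow_nonpos h0 h1 k)]
  exact mul_le_mul_of_nonneg_left (neg_le_neg (log_one_sub_le_log_one_sub_pow h0 h1 k)) (hpnn k)

lemma tendsto_sum_Icc {f : ℕ → ℝ} (hf : Summable f) (a : ℕ) :
    Tendsto (fun D => ∑ k ∈ Finset.Icc a D, f k) atTop
      (𝓝 (∑' k, f k - ∑ k ∈ Finset.range a, f k)) := by
  have h := (hf.hasSum.tendsto_sum_nat.comp (tendsto_add_atTop_nat 1)).sub_const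
    (∑ k ∈ Finset.range a, f k)
  refine h.congr' ?_
  filter_upwards [eventually_ge_atTop a] with D hD
  have : Finset.Icc a D = Finset.Ico a (D + 1) := by
    ext
    simp only [Finset.mem_Icc, Finset.mem_Ico]
    omega
  rw [this, Finset.sum_Ico_eq_sub _ (by omega)]
  rfl

lemma exists_three_le (hpsum : ∑' i : ℕ, p i = 1) (hp0 : p 0 = 0) (hpnn : ∀ i, 0 ≤ p i)
    (hmom : Summable fun i : ℕ => (i : ℝ) * p i) (hP2 : 2 < ∑' i : ℕ, (i : ℝ) * p i) :
    ∃ k, 3 ≤ k ∧ 0 < p k := by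
  by_contra! h
  have hs := summable_of_summable_mul hp0 hpnn hmom
  have : ∑' i : ℕ, (i : ℝ) * p i ≤ ∑' i, 2 * p i := by
    refine hmom.tsum_le_tsum (fun i => ?_) (hs.mul_left 2)
    by_cases hi : 3 ≤ i
    · have := le_antisymm (h i hi) (hpnn i)
      simp [this]
    · have : (i : ℝ) ≤ 2 := by exact_mod_cast (by omega : i ≤ 2)
      exact mul_le_mul_of_nonneg_right this (hpnn i)
  rw [tsum_mul_left, hpsum] at this
  linarith

lemma exists_parameters (hp0 : p 0 = 0) (hpnn : ∀ i, 0 ≤ p i) (hpsum : ∑' i : ℕ, p i = 1)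
    (hmom : Summable fun i : ℕ => (i : ℝ) * p i) (hP1 : 0 < p 1)
    (hP2 : 2 < ∑' i : ℕ, (i : ℝ) * p i) {ε η : ℝ} (hε : 0 < ε) (hη : 0 < η) (k₀ : ℕ) :
    ∃ β, 0 < β ∧ β < betaOf p ∧ ∃ D, k₀ ≤ D ∧
      ∑ k ∈ Finset.Icc 2 D, p k * gker k β < p 1 ∧
      (1 - ε) * ∑' k : ℕ, (k : ℝ) * p k <
        ∑ k ∈ Finset.Icc 2 D, p k * k + ∑ k ∈ Finset.Icc 2 D, p k * gker k β ∧
      -Kof p - η < ∑' k, p k * Real.log (1 - betaOf p ^ k) -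
        (∑ k ∈ Finset.Icc 2 D, p k * k + ∑ k ∈ Finset.Icc 2 D, p k * gker k β) / 2 *
          Real.log (1 - β ^ 2) := by
  obtain ⟨hb0, hb1, hbeq, hblt⟩ := betaOf_spec hp0 hpnn hpsum hmom hP1 hP2
  set b := betaOf p with hbdef
  set μ := ∑' k : ℕ, (k : ℝ) * p k with hμ
  have hmom' : Summable fun k : ℕ => p k * k := by simpa [mul_comm] using hmom
  have hμ' : ∑' k : ℕ, p k * k = μ := by simp only [mul_comm, hμ]
  have hG : Tendsto (fun x => ∑' k, p k * gker k x) (𝓝[<] b) (𝓝 (p 1)) := by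
    rw [← hbeq]
    have h1 : ContinuousAt (fun x => ∑' k, p k * gker k x) b :=
      (continuousOn_tsum_gker hpnn hmom).continuousAt (Icc_mem_nhds hb0 hb1)
    exact tendsto_nhdsWithin_of_tendsto_nhds h1
  have hL : Tendsto (fun x : ℝ => Real.log (1 - x ^ 2)) (𝓝[<] b) (𝓝 (Real.log (1 - b ^ 2))) := by
    have h1 : ContinuousAt (fun x : ℝ => Real.log (1 - x ^ 2)) b := by
      refine ContinuousAt.log (by fun_prop) ?_
      nlinarith
    exact tendsto_nhdsWithin_of_tendsto_nhds h1
  have hK : -Kof p = ∑' k, p k * Real.log (1 - b ^ k) -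
      (μ - p 1 + p 1) / 2 * Real.log (1 - b ^ 2) := by
    rw [Kof, ← hbdef, ← hμ]
    ring
  have hμpos : 0 < μ := by linarith
  have c1 := (hG.const_add (μ - p 1)).eventually_const_lt
    (show (1 - ε) * μ < μ - p 1 + p 1 by nlinarith)
  have c2 := ((((hG.const_add (μ - p 1)).div_const 2).mul hL).const_sub
    (∑' k, p k * Real.log (1 - b ^ k))).eventually_const_lt
    (show -Kof p - η < ∑' k, p k * Real.log (1 - b ^ k) -
      (μ - p 1 + p 1) / 2 * Real.log (1 - b ^ 2) by linarith)
  have c3 : ∀ᶠ x in 𝓝[<] b, x ∈ Set.Ioo 0 b := Ioo_mem_nhdsLT hb0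
  obtain ⟨β, h1, h2, hβ0, hβb⟩ := (c1.and (c2.and c3)).exists
  refine ⟨β, hβ0, hβb, ?_⟩
  have hS := hblt β hβ0.le hβb
  have t1 : Tendsto (fun D => ∑ k ∈ Finset.Icc 2 D, p k * (k : ℝ)) atTop (𝓝 (μ - p 1)) := by
    have := tendsto_sum_Icc hmom' 2
    rw [hμ'] at this
    simpa [Finset.sum_range_succ] using this
  have t2 : Tendsto (fun D => ∑ k ∈ Finset.Icc 2 D, p k * gker k β) atTop
      (𝓝 (∑' k, p k * gker k β)) := by
    have := tendsto_sum_Icc (summable_mul_gker hpnn hmom hβ0.le) 2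
    simpa [Finset.sum_range_succ, gker] using this
  have e1 := t2.eventually_lt_const hS
  have e2 := (t1.add t2).eventually_const_lt h1
  have e3 := ((((t1.add t2).div_const 2).mul_const (Real.log (1 - β ^ 2))).const_sub
    (∑' k, p k * Real.log (1 - b ^ k))).eventually_const_lt h2
  obtain ⟨D, hD⟩ := ((eventually_ge_atTop k₀).and (e1.and (e2.and e3))).exists
  exact ⟨D, hD⟩

end Parameters

lemma tsum_le_sum_of_nonpos {f : ℕ → ℝ} (hf : Summable f) (h : ∀ k, f k ≤ 0) (s : Finset ℕ) :
    ∑' k, f k ≤ ∑ k ∈ s, f k := by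
  have := hf.neg.sum_le_tsum s fun k _ => neg_nonneg.2 (h k)
  rw [tsum_neg, Finset.sum_neg_distrib] at this
  linarith

lemma rate_mul_eq {n : ℝ} (hn : 0 < n) (V Q S ρ t D A E : ℝ) :
    (V / n - (Q / n + S / n - (ρ + t / n * D)) / 2 * A - E / n) * n =
      V - (Q + S - (ρ * n + t * D)) / 2 * A - E := by
  field_simp

lemma eventually_exists_connRatio_ge {d : (n : ℕ) → Fin n → ℕ} {p : ℕ → ℝ}
    (hdpos : ∀ n j, 0 < d n j)
    (hp0 : p 0 = 0) (hpnn : ∀ i, 0 ≤ p i) (hpsum : ∑' i : ℕ, p i = 1)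
    (ha : ∀ i : ℕ, Tendsto (fun n : ℕ => (typeOf d n i : ℝ) / (n : ℝ)) atTop (𝓝 (p i)))
    (hmom : Summable fun i : ℕ => (i : ℝ) * p i)
    (hb : Tendsto (fun n : ℕ => (ℓTot d n : ℝ) / (n : ℝ)) atTop
      (𝓝 (∑' i : ℕ, (i : ℝ) * p i)))
    (hP1 : 0 < p 1) (hP2 : 2 < ∑' i : ℕ, (i : ℝ) * p i) {ε η : ℝ} (hε : 0 < ε) (hη : 0 < η) :
    ∀ᶠ n : ℕ in atTop, ∃ m ∈ Neps ε (typeOf d n), 0 < cSc m ∧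
      (-Kof p - η) * n < Real.log ((cSc m : ℝ) / cC m) := by
  obtain ⟨k₀, hk₀, hpk⟩ := exists_three_le hpsum hp0 hpnn hmom hP2
  obtain ⟨β, hβ0, hβb, D, hkD, q1, q2, q3⟩ :=
    exists_parameters hp0 hpnn hpsum hmom hP1 hP2 hε hη k₀
  obtain ⟨hb0, hb1, -, -⟩ := betaOf_spec hp0 hpnn hpsum hmom hP1 hP2
  set b := betaOf p
  set μ := ∑' k : ℕ, (k : ℝ) * p k
  set S := ∑ k ∈ Finset.Icc 2 D, p k * gker k β with hS
  set Q := ∑ k ∈ Finset.Icc 2 D, p k * (k : ℝ) with hQ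
  set A := Real.log (1 - β ^ 2)
  have hβ1 : β < 1 := hβb.trans hb1
  have hA : A ≤ 0 := log_one_sub_pow_nonpos hβ0.le hβ1 2
  have hμ : 0 < μ := by linarith
  have hD : (0 : ℝ) < D := by exact_mod_cast (by omega : 0 < D)
  -- the slack coming from `ρ`
  have hid : Tendsto (fun ρ : ℝ => ρ) (𝓝[>] 0) (𝓝 0) :=
    tendsto_nhdsWithin_of_tendsto_nhds tendsto_id
  have hs : Tendsto (fun ρ : ℝ => ρ + (2 * (2 * ρ) + 0) * D) (𝓝[>] 0) (𝓝 0) := by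
    simpa using hid.add ((((hid.const_mul 2).const_mul 2).add_const 0).mul_const (D : ℝ))
  have r1 := (hs.const_add S).eventually_lt_const (by simpa using q1)
  have r2 := (hs.const_sub (Q + S)).eventually_const_lt (by simpa using q2)
  have r3 := ((((hs.const_sub (Q + S)).div_const 2).mul_const A).const_sub
    (∑' k, p k * Real.log (1 - b ^ k))).sub (tendsto_rateErr_limit k₀ β hμ)
    |>.eventually_const_lt (by simpa using q3)
  have r4 := ((hid.const_mul 2).const_mul 2).add_const 0 |>.eventually_lt_const
    (by simpa using hpk)
  obtain ⟨ρ, ⟨hr1, hr2, hr3, hr4⟩, hρ⟩ :=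
    ((r1.and (r2.and (r3.and r4))).and self_mem_nhdsWithin).exists
  have hρ : 0 < ρ := hρ
  set R : ℕ → ℕ := fun n => 2 * ⌊ρ * n⌋₊ with hR
  have tR : Tendsto (fun n : ℕ => (2 * (R n : ℝ) + 1) / n) atTop (𝓝 (2 * (2 * ρ) + 0)) := by
    have := (((tendsto_floor_div hρ.le).const_mul 2).const_mul 2).add
      (tendsto_one_div_atTop_nhds_zero_nat (𝕜 := ℝ))
    refine this.congr fun n => ?_
    simp only [hR]
    push_cast
    ring
  have tsl : Tendsto (fun n : ℕ => ρ + (2 * (R n : ℝ) + 1) / n * D) atTop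
      (𝓝 (ρ + (2 * (2 * ρ) + 0) * D)) := (tR.mul_const _).const_add _
  have tS := tendsto_sum_typeOf_mul ha (Finset.Icc 2 D) fun k => gker k β
  have tQ := tendsto_sum_typeOf_mul ha (Finset.Icc 2 D) fun k => (k : ℝ)
  have tV := tendsto_sum_typeOf_mul ha (Finset.Icc 1 D) fun k => Real.log (1 - b ^ k)
  have tE : Tendsto (fun n : ℕ => rateErr k₀ (R n) (ℓTot d n) β / (n : ℝ)) _ _ :=
    tendsto_rateErr k₀ (β := β) hρ hμ hb
  have hV : ∑' k, p k * Real.log (1 - b ^ k) ≤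
      ∑ k ∈ Finset.Icc 1 D, p k * Real.log (1 - b ^ k) :=
    tsum_le_sum_of_nonpos (summable_mul_log hp0 hpnn hmom hb0.le hb1) (fun k =>
      mul_nonpos_of_nonneg_of_nonpos (hpnn k) (log_one_sub_pow_nonpos hb0.le hb1 k)) _
  have n1 := (tS.add tsl).eventually_lt (ha 1) hr1
  have n2 := (hb.const_mul (1 - ε)).eventually_lt ((tQ.add tS).sub tsl) hr2
  have n3 := ((tV.sub ((((tQ.add tS).sub tsl).div_const 2).mul_const A)).sub tE).eventually_const_lt
    (lt_of_lt_of_le hr3 (by linarith))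
  have n4 := tR.eventually_lt (ha k₀) hr4
  have n5 : ∀ᶠ n : ℕ in atTop, 2 * (D + D ^ 2) + 2 ≤ R n := by
    have : Tendsto (fun n : ℕ => ⌊ρ * n⌋₊) atTop atTop :=
      tendsto_nat_floor_atTop.comp (tendsto_natCast_atTop_atTop.const_mul_atTop hρ)
    filter_upwards [this.eventually_ge_atTop (2 * (D + D ^ 2) + 2)] with n hn
    simp only [hR]
    omega
  have n6 : ∀ᶠ n : ℕ in atTop, 4 * (D : ℝ) ^ 2 ≤ ρ ^ 2 * n :=
    (tendsto_natCast_atTop_atTop.const_mul_atTop (by positivity)).eventually_ge_atTop _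
  filter_upwards [n1, n2, n3, n4, n5, n6, eventually_gt_atTop 0] with n h1 h2 h3 h4 h5 h6 h7
  have hn : (0 : ℝ) < n := by exact_mod_cast h7
  have hk : 2 * R n + 1 ≤ typeOf d n k₀ := by
    rw [div_lt_div_iff_of_pos_right hn] at h4
    exact_mod_cast h4.le
  have hT : 4 * ((n : ℝ) * (D : ℝ) ^ 2) ≤ (ρ * n) ^ 2 := by
    linarith [mul_le_mul_of_nonneg_left h6 hn.le]
  have hX : ∑ k ∈ Finset.Icc 2 D, (typeOf d n k : ℝ) * gker k β +
      (ρ * n + (2 * (R n : ℝ) + 1) * D) ≤ typeOf d n 1 := by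
    have := mul_le_mul_of_nonneg_right h1.le hn.le
    field_simp at this
    linarith
  obtain ⟨X, m, hm, hX1, htd, hXs, hpos, hlog⟩ := exists_log_connRatio_ge d n (hdpos n) hβ0 hβ1
    hk₀ hkD hk ((even_two_mul _)) h5 (mul_pos hρ hn) hT hX
  set Sn := ∑ k ∈ Finset.Icc 2 D, (typeOf d n k : ℝ) * gker k β
  set Qn := ∑ k ∈ Finset.Icc 2 D, (typeOf d n k : ℝ) * (k : ℝ) with hQn
  have htd' : (totalDeg m : ℝ) = Qn + X := by
    rw [htd, hQn]
    push_cast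
    rfl
  have hXl := (abs_le.1 hXs).1
  have hdeg : Qn + Sn - (ρ * n + (2 * (R n : ℝ) + 1) * D) ≤ totalDeg m := by
    rw [htd']
    linarith
  refine ⟨m, ⟨hm, ?_⟩, hpos, ?_⟩
  · rw [totalDeg_typeOf]
    have := mul_lt_mul_of_pos_right h2 hn
    field_simp at this
    linarith
  · have hsum : ∑ k ∈ Finset.Icc 1 D, (typeOf d n k : ℝ) * Real.log (1 - b ^ k) ≤
        ∑ k ∈ Finset.Icc 2 D, (typeOf d n k : ℝ) * Real.log (1 - β ^ k) +
          X * Real.log (1 - β) := by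
      rw [← Finset.add_sum_Ioc_eq_sum_Icc (by omega : 1 ≤ D), add_comm]
      refine add_le_add (Finset.sum_le_sum fun k _ => mul_le_mul_of_nonneg_left
        (log_one_sub_pow_antitone hβ0.le hβb.le hb1 k) (Nat.cast_nonneg _)) ?_
      have e1 := log_one_sub_pow_antitone hβ0.le hβb.le hb1 1
      have e2 := log_one_sub_pow_nonpos hb0.le hb1 1
      simp only [pow_one] at e1 e2 ⊢
      have e3 : (X : ℝ) ≤ typeOf d n 1 := by exact_mod_cast hX1
      have e4 : (0 : ℝ) ≤ X := Nat.cast_nonneg _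
      exact (mul_le_mul_of_nonpos_right e3 e2).trans (mul_le_mul_of_nonneg_left e1 e4)
    have h3' := mul_lt_mul_of_pos_right h3 hn
    have hA' := mul_le_mul_of_nonpos_right hdeg hA
    refine lt_of_lt_of_le ?_ hlog
    refine h3'.trans_le ?_
    rw [rate_mul_eq hn]
    linarith

lemma totalDeg_le_of_le {m N : ℕ →₀ ℕ} (h : m ≤ N) : totalDeg m ≤ totalDeg N := by
  obtain ⟨c, rfl⟩ := le_iff_exists_add.1 h
  rw [totalDeg_add]
  omega

lemma mul_apply_le_totalDeg (c : ℕ →₀ ℕ) (k : ℕ) : k * c k ≤ totalDeg c := by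
  by_cases hk : k ∈ c.support
  · exact Finset.single_le_sum (f := fun k => k * c k) (fun _ _ => Nat.zero_le _) hk
  · simp [Finsupp.notMem_support_iff.1 hk]

lemma sub_le_apply_of_mem_Neps {ε : ℝ} {m N : ℕ →₀ ℕ} (h : m ∈ Neps ε N) {k : ℕ} (hk : 1 ≤ k) :
    (N k : ℝ) - ε * totalDeg N ≤ m k := by
  obtain ⟨hm, hd⟩ := h
  obtain ⟨c, rfl⟩ := le_iff_exists_add.1 hm
  have h1 : c k ≤ totalDeg c := (Nat.le_mul_of_pos_left _ hk).trans (mul_apply_le_totalDeg c k)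
  have h2 : (c k : ℝ) ≤ totalDeg c := by exact_mod_cast h1
  rw [totalDeg_add] at hd ⊢
  rw [Finsupp.add_apply]
  push_cast at hd ⊢
  linarith

lemma connRatio_le_exp {d : (n : ℕ) → Fin n → ℕ} {n : ℕ} (hd : ∀ j, 0 < d n j) {D : ℕ}
    {β₁ β₂ C ε : ℝ} (h1 : 0 < β₁) (h12 : β₁ < β₂) (h2 : β₂ < 1) (hC : 0 < C)
    (hbound : ∀ m, m ≠ 0 → m 0 = 0 → (cCc m : ℝ) / cC m * (1 - β₂ ^ 2) ^ (totalDeg m / 2) ≤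
      C * (totalDeg m + 1) * ∏ i ∈ Finset.range D, (1 - β₁ ^ (i + 1)) ^ (m (i + 1) + 1))
    (hε : ε < 1) {m : ℕ →₀ ℕ} (hm : m ∈ Neps ε (typeOf d n)) :
    (cCc m : ℝ) / cC m ≤ Real.exp (Real.log C + Real.log (ℓTot d n + 1) +
      ∑ i ∈ Finset.range D, ((typeOf d n (i + 1) : ℝ) - ε * ℓTot d n) *
        Real.log (1 - β₁ ^ (i + 1)) - (ℓTot d n : ℝ) / 2 * Real.log (1 - β₂ ^ 2)) := by
  have hm0 : m 0 = 0 := by simpa [typeOf_zero d n hd] using hm.1 0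
  have hdl : totalDeg m ≤ ℓTot d n := by
    rw [← totalDeg_typeOf]
    exact totalDeg_le_of_le hm.1
  have hne : m ≠ 0 := by
    rintro rfl
    have := hm.2
    have h3 : (0 : ℝ) ≤ (1 - ε) * totalDeg (typeOf d n) :=
      mul_nonneg (by linarith) (Nat.cast_nonneg _)
    simp only [totalDeg, Finsupp.sum_zero_index, Nat.cast_zero] at this h3
    linarith
  have hβ₂ : 0 < 1 - β₂ ^ 2 := by nlinarith
  have hpos : ∀ i : ℕ, 0 < 1 - β₁ ^ (i + 1) := fun i => by
    have := pow_lt_one₀ h1.le (h12.trans h2) (n := i + 1) (by omega)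
    linarith
  have hprod : ∏ i ∈ Finset.range D, (1 - β₁ ^ (i + 1)) ^ (m (i + 1) + 1) ≤
      Real.exp (∑ i ∈ Finset.range D, ((typeOf d n (i + 1) : ℝ) - ε * ℓTot d n) *
        Real.log (1 - β₁ ^ (i + 1))) := by
    rw [Real.exp_sum]
    refine Finset.prod_le_prod (fun i _ => (pow_pos (hpos i) _).le) fun i _ => ?_
    rw [← Real.exp_log (pow_pos (hpos i) (m (i + 1) + 1)), Real.log_pow]
    refine Real.exp_le_exp.2 (mul_le_mul_of_nonpos_right ?_
      (log_one_sub_pow_nonpos h1.le (h12.trans h2) _))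
    have := sub_le_apply_of_mem_Neps hm (k := i + 1) (by omega)
    rw [totalDeg_typeOf] at this
    push_cast
    linarith
  have hq : Real.exp ((ℓTot d n : ℝ) / 2 * Real.log (1 - β₂ ^ 2)) ≤
      (1 - β₂ ^ 2) ^ (totalDeg m / 2) := by
    rw [← Real.exp_log (pow_pos hβ₂ (totalDeg m / 2)), Real.log_pow]
    refine Real.exp_le_exp.2 (mul_le_mul_of_nonpos_right ?_
      (log_one_sub_pow_nonpos (h1.trans h12).le h2 _))
    refine Nat.cast_div_le.trans ?_
    have : (totalDeg m : ℝ) ≤ ℓTot d n := by exact_mod_cast hdl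
    push_cast
    linarith
  rw [Real.exp_sub, Real.exp_add, Real.exp_add, Real.exp_log hC, Real.exp_log (by positivity),
    le_div_iff₀ (Real.exp_pos _)]
  calc (cCc m : ℝ) / cC m * Real.exp ((ℓTot d n : ℝ) / 2 * Real.log (1 - β₂ ^ 2))
      ≤ (cCc m : ℝ) / cC m * (1 - β₂ ^ 2) ^ (totalDeg m / 2) := by gcongr
    _ ≤ _ := hbound m hne hm0
    _ ≤ _ := by
      have := Finset.prod_nonneg (s := Finset.range D)
        fun i _ => (pow_pos (hpos i) (m (i + 1) + 1)).le
      gcongr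

lemma exists_connRatio_upper {d : (n : ℕ) → Fin n → ℕ} {p : ℕ → ℝ}
    (hdpos : ∀ n j, 0 < d n j)
    (hp0 : p 0 = 0) (hpnn : ∀ i, 0 ≤ p i) (hpsum : ∑' i : ℕ, p i = 1)
    (ha : ∀ i : ℕ, Tendsto (fun n : ℕ => (typeOf d n i : ℝ) / (n : ℝ)) atTop (𝓝 (p i)))
    (hmom : Summable fun i : ℕ => (i : ℝ) * p i)
    (hb : Tendsto (fun n : ℕ => (ℓTot d n : ℝ) / (n : ℝ)) atTop
      (𝓝 (∑' i : ℕ, (i : ℝ) * p i)))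
    (hP1 : 0 < p 1) (hP2 : 2 < ∑' i : ℕ, (i : ℝ) * p i) {η : ℝ} (hη : 0 < η) :
    ∃ ε₀ : ℝ, 0 < ε₀ ∧ ∀ ε, ε < ε₀ → ∀ᶠ n : ℕ in atTop, ∀ m ∈ Neps ε (typeOf d n),
      (cCc m : ℝ) / cC m ≤ Real.exp ((-Kof p + η) * n) := by
  obtain ⟨hb0, hb1, -, -⟩ := betaOf_spec hp0 hpnn hpsum hmom hP1 hP2
  set b := betaOf p with hbdef
  set μ := ∑' k : ℕ, (k : ℝ) * p k with hμ
  have hμpos : 0 < μ := by linarith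
  have hK : -Kof p = ∑' k, p k * Real.log (1 - b ^ k) - μ / 2 * Real.log (1 - b ^ 2) := by
    rw [Kof, ← hbdef, ← hμ]
    ring
  have hL : Tendsto (fun x : ℝ => ∑' k, p k * Real.log (1 - b ^ k) -
      μ / 2 * Real.log (1 - x ^ 2)) (𝓝[>] b)
      (𝓝 (∑' k, p k * Real.log (1 - b ^ k) - μ / 2 * Real.log (1 - b ^ 2))) := by
    have h1 : ContinuousAt (fun x : ℝ => Real.log (1 - x ^ 2)) b := by
      refine ContinuousAt.log (by fun_prop) ?_
      nlinarith
    exact (Tendsto.const_mul _ (tendsto_nhdsWithin_of_tendsto_nhds h1)).const_sub _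
  obtain ⟨β₂, hβ, hbβ, hβ1⟩ := ((hL.eventually_lt_const (show _ < -Kof p + η by linarith)).and
    (Ioo_mem_nhdsGT hb1)).exists
  have hsum := (summable_mul_log hp0 hpnn hmom hb0.le hb1).hasSum.tendsto_sum_nat.comp
    (tendsto_add_atTop_nat 1)
  obtain ⟨D, hD⟩ := ((hsum.sub_const (μ / 2 * Real.log (1 - β₂ ^ 2))).eventually_lt_const hβ).exists
  rw [Function.comp, Finset.sum_range_succ'] at hD
  simp only [pow_zero, sub_self, Real.log_zero, mul_zero, add_zero] at hD
  obtain ⟨C, hC, hbound⟩ := exists_connRatio_le D hb0 hbβ hβ1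
  have hlim : ∀ ε : ℝ, Tendsto (fun n : ℕ => (Real.log C + Real.log (ℓTot d n + 1) +
      ∑ i ∈ Finset.range D, ((typeOf d n (i + 1) : ℝ) - ε * ℓTot d n) *
        Real.log (1 - b ^ (i + 1)) - (ℓTot d n : ℝ) / 2 * Real.log (1 - β₂ ^ 2)) / n) atTop
      (𝓝 (0 + 0 + ∑ i ∈ Finset.range D, (p (i + 1) - ε * μ) * Real.log (1 - b ^ (i + 1)) -
        μ / 2 * Real.log (1 - β₂ ^ 2))) := by
    intro ε
    have t1 : Tendsto (fun n : ℕ => Real.log C / (n : ℝ)) atTop (𝓝 0) :=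
      tendsto_const_nhds.div_atTop tendsto_natCast_atTop_atTop
    have t2 := tendsto_finsetSum (Finset.range D) fun i _ =>
      ((ha (i + 1)).sub (hb.const_mul ε)).mul_const (Real.log (1 - b ^ (i + 1)))
    refine (((t1.add (tendsto_log_div_nat hμpos hb)).add t2).sub
      ((hb.div_const 2).mul_const (Real.log (1 - β₂ ^ 2)))).congr fun n => ?_
    rw [sub_div, add_div, add_div, Finset.sum_div]
    congr 1
    · congr 1
      exact Finset.sum_congr rfl fun i _ => by ring
    · ring
  have hεlim : Tendsto (fun ε : ℝ => 0 + 0 + ∑ i ∈ Finset.range D, (p (i + 1) - ε * μ) *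
      Real.log (1 - b ^ (i + 1)) - μ / 2 * Real.log (1 - β₂ ^ 2)) (𝓝[>] 0)
      (𝓝 (0 + 0 + ∑ i ∈ Finset.range D, (p (i + 1) - 0 * μ) *
      Real.log (1 - b ^ (i + 1)) - μ / 2 * Real.log (1 - β₂ ^ 2))) :=
    (Continuous.tendsto (by fun_prop) 0).mono_left nhdsWithin_le_nhds
  obtain ⟨ε₀, he, he0, he1⟩ := ((hεlim.eventually_lt_const (show _ < -Kof p + η by
    simpa using hD)).and (Ioo_mem_nhdsGT one_pos)).exists
  refine ⟨ε₀, he0, fun ε hε => ?_⟩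
  filter_upwards [(hlim ε₀).eventually_lt_const he, eventually_gt_atTop 0] with n hn hn0 m hm
  have hn0 : (0 : ℝ) < n := by exact_mod_cast hn0
  have hm' : m ∈ Neps ε₀ (typeOf d n) :=
    ⟨hm.1, lt_of_le_of_lt (mul_le_mul_of_nonneg_right (by linarith) (Nat.cast_nonneg _)) hm.2⟩
  refine (connRatio_le_exp (hdpos n) hb0 hbβ hβ1 hC hbound he1 hm').trans ?_
  exact Real.exp_le_exp.2 ((div_lt_iff₀ hn0).1 hn).le

section Counting

variable {d : (n : ℕ) → Fin n → ℕ}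

lemma typeOf_le (d : (n : ℕ) → Fin n → ℕ) (n k : ℕ) : typeOf d n k ≤ n := by
  rw [typeOf_apply]
  simpa using Finset.card_filter_le (Finset.univ : Finset (Fin n)) fun j => d n j = k

lemma card_Iic_typeOf_le (d : (n : ℕ) → Fin n → ℕ) (n : ℕ) {M : ℕ} (hM : 0 < M) :
    ((Finset.Iic (typeOf d n)).card : ℝ) ≤
      Real.exp ((M + 1) * Real.log (n + 1) + (ℓTot d n : ℝ) / M) := by
  have hM' : (0 : ℝ) < M := by exact_mod_cast hM
  have hlog : 0 ≤ Real.log ((n : ℝ) + 1) := Real.log_nonneg (by linarith [n.cast_nonneg (α := ℝ)])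
  have hterm : ∀ k, Real.log ((typeOf d n k : ℝ) + 1) ≤
      (if k ∈ Finset.range (M + 1) then Real.log ((n : ℝ) + 1) else 0) +
        ((k * typeOf d n k : ℕ) : ℝ) / M := by
    intro k
    split_ifs with h
    · have : (typeOf d n k : ℝ) ≤ n := by exact_mod_cast typeOf_le d n k
      have := Real.log_le_log (by positivity) (by linarith : (typeOf d n k : ℝ) + 1 ≤ n + 1)
      have : 0 ≤ ((k * typeOf d n k : ℕ) : ℝ) / M := by positivity
      linarith
    · have h : (M : ℝ) ≤ k := by
        have : M ≤ k := by
          rw [Finset.mem_range] at h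
          omega
        exact_mod_cast this
      have h3 := Real.log_le_sub_one_of_pos (by positivity : (0 : ℝ) < (typeOf d n k : ℝ) + 1)
      rw [zero_add, le_div_iff₀ hM']
      push_cast
      have h4 : (0 : ℝ) ≤ typeOf d n k := Nat.cast_nonneg _
      nlinarith
  have hcard : ((Finset.Iic (typeOf d n)).card : ℝ) =
      ∏ k ∈ (typeOf d n).support, ((typeOf d n k : ℝ) + 1) := by
    rw [Finsupp.card_Iic]
    push_cast [Nat.card_Iic]
    rfl
  rw [hcard, ← Real.exp_log (Finset.prod_pos fun k _ => by positivity),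
    Real.log_prod fun k _ => by positivity]
  refine Real.exp_le_exp.2 ((Finset.sum_le_sum fun k _ => hterm k).trans ?_)
  rw [Finset.sum_add_distrib, ← Finset.sum_div, ← Nat.cast_sum]
  refine add_le_add ?_ ?_
  · rw [← Finset.sum_filter, Finset.sum_const, nsmul_eq_mul]
    refine mul_le_mul_of_nonneg_right ?_ hlog
    have : ((typeOf d n).support.filter (· ∈ Finset.range (M + 1))).card ≤ M + 1 := by
      refine (Finset.card_le_card ?_).trans (Finset.card_range (M + 1)).le
      intro k hk
      exact (Finset.mem_filter.1 hk).2
    exact_mod_cast this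
  · rw [← totalDeg_typeOf]
    rfl

lemma eventually_card_Iic_le {μ : ℝ}
    (hb : Tendsto (fun n : ℕ => (ℓTot d n : ℝ) / (n : ℝ)) atTop (𝓝 μ)) {η : ℝ} (hη : 0 < η) :
    ∀ᶠ n : ℕ in atTop, ((Finset.Iic (typeOf d n)).card : ℝ) ≤ Real.exp (η * n) := by
  obtain ⟨M, hM, hM0⟩ := ((((tendsto_const_nhds (x := μ)).div_atTop
    tendsto_natCast_atTop_atTop).eventually_lt_const hη).and (eventually_gt_atTop 0)).exists
  have h1 : Tendsto (fun n : ℕ => (n : ℝ) / n) atTop (𝓝 1) := by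
    refine tendsto_const_nhds.congr' ?_
    filter_upwards [eventually_gt_atTop 0] with n hn
    have : (n : ℝ) ≠ 0 := by exact_mod_cast hn.ne'
    rw [div_self this]
  have hlim := ((tendsto_log_div_nat one_pos h1).const_mul ((M : ℝ) + 1)).add (hb.div_const M)
  filter_upwards [hlim.eventually_lt_const (by simpa using hM), eventually_gt_atTop 0] with n hn hn0
  have hn0 : (0 : ℝ) < n := by exact_mod_cast hn0
  refine (card_Iic_typeOf_le d n hM0).trans (Real.exp_le_exp.2 ?_)
  have := mul_le_mul_of_nonneg_right hn.le hn0.le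
  refine le_of_eq_of_le ?_ this
  field_simp

lemma eventually_degree_sq_le {p : ℕ → ℝ}
    (ha : ∀ i : ℕ, Tendsto (fun n : ℕ => (typeOf d n i : ℝ) / (n : ℝ)) atTop (𝓝 (p i)))
    (hsq : Summable fun i : ℕ => (i : ℝ) ^ 2 * p i)
    (hc : Tendsto (fun n : ℕ => (∑ j : Fin n, (d n j : ℝ) ^ 2) / (n : ℝ)) atTop
      (𝓝 (∑' i : ℕ, (i : ℝ) ^ 2 * p i))) {δ : ℝ} (hδ : 0 < δ) :
    ∀ᶠ n : ℕ in atTop, ∀ j, (d n j : ℝ) ^ 2 ≤ δ * n := by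
  obtain ⟨M, hM⟩ := ((hsq.hasSum.tendsto_sum_nat).eventually_const_lt
    (show ∑' i : ℕ, (i : ℝ) ^ 2 * p i - δ < _ by linarith)).exists
  have ht := tendsto_sum_typeOf_mul ha (Finset.range M) fun k => (k : ℝ) ^ 2
  have hlim := (hc.sub ht).eventually_lt_const (show _ < δ by simp only [mul_comm (p _)]; linarith)
  filter_upwards [hlim, eventually_gt_atTop 0,
    (tendsto_natCast_atTop_atTop.const_mul_atTop hδ).eventually_ge_atTop ((M : ℝ) ^ 2)]
    with n hn hn0 hnM j
  have hn0 : (0 : ℝ) < n := by exact_mod_cast hn0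
  by_cases hj : d n j ∈ Finset.range M
  · refine le_trans ?_ hnM
    have : (d n j : ℝ) ≤ M := by exact_mod_cast (Finset.mem_range.1 hj).le
    gcongr
  · rw [← sub_div, div_lt_iff₀ hn0] at hn
    refine le_trans ?_ hn.le
    have h1 := sum_filter_degree d n (Finset.range M) fun k => (k : ℝ) ^ 2
    simp only [nsmul_eq_mul] at h1
    rw [← h1, le_sub_iff_add_le, ← Finset.sum_filter_add_sum_filter_not Finset.univ
      (fun j => d n j ∈ Finset.range M), add_comm]
    refine add_le_add le_rfl ?_
    exact Finset.single_le_sum (f := fun j => (d n j : ℝ) ^ 2) (fun _ _ => sq_nonneg _)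
      (Finset.mem_filter.2 ⟨Finset.mem_univ j, hj⟩)

end Counting

lemma exists_simple_scale {μ c : ℝ} (hμ : 0 < μ) (hc : 0 < c) {η : ℝ} (hη : 0 < η) :
    ∃ ρ : ℝ, 0 < ρ ∧ ρ < c ∧ 2 * ρ * Real.log (20 * μ / ρ) < η := by
  have h0 : Tendsto (fun ρ : ℝ => ρ) (𝓝[>] 0) (𝓝 0) := tendsto_nhdsWithin_of_tendsto_nhds tendsto_id
  have h1 : Tendsto (fun ρ : ℝ => Real.log ρ * ρ) (𝓝[>] 0) (𝓝 0) := by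
    simpa using tendsto_log_mul_rpow_nhdsGT_zero (r := 1) one_pos
  have h2 := (h0.mul_const (2 * Real.log (20 * μ))).sub (h1.const_mul 2)
  simp only [zero_mul, mul_zero, sub_zero] at h2
  obtain ⟨ρ, hρ, h3, h4⟩ := ((h2.eventually_lt_const hη).and (Ioo_mem_nhdsGT hc)).exists
  refine ⟨ρ, h3, h4, ?_⟩
  rw [Real.log_div (by positivity) h3.ne']
  linarith

lemma simpleRatio_le {d : (n : ℕ) → Fin n → ℕ} {n : ℕ} (hd : ∀ j, 0 < d n j) {m : ℕ →₀ ℕ}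
    (hm : m ≤ typeOf d n) {Δ R : ℕ} (hΔ : ∀ j, d n j ≤ Δ) (hR : R ≤ m 1)
    (hb : 2 * (Δ + Δ ^ 2) + 2 ≤ R) (hL : 2 * R ≤ totalDeg m) :
    (cSc m : ℝ) / cS m ≤ Real.exp (2 * R * Real.log (20 * ℓTot d n / R)) * (cCc m / cC m) := by
  have hm0 : m 0 = 0 := by simpa [typeOf_zero d n hd] using hm 0
  have hsupp : ∀ k ∈ m.support, k ≤ Δ := by
    intro k hk
    have h1 : 0 < typeOf d n k :=
      lt_of_lt_of_le (Nat.pos_of_ne_zero (Finsupp.mem_support_iff.1 hk)) (hm k)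
    rw [typeOf_apply, Finset.card_pos] at h1
    obtain ⟨j, hj⟩ := h1
    rw [← (Finset.mem_filter.1 hj).2]
    exact hΔ j
  have hmain := cC_le_cS m hm0 Δ R hsupp hR hb hL
  have hR0 : (0 : ℝ) < R := by exact_mod_cast (by omega : 0 < R)
  have hdl : (totalDeg m : ℝ) ≤ ℓTot d n := by
    rw [← totalDeg_typeOf]
    exact_mod_cast totalDeg_le_of_le hm
  have hℓ : (0 : ℝ) < ℓTot d n :=
    lt_of_lt_of_le (by exact_mod_cast (by omega : 0 < totalDeg m)) hdl
  have hexp : Real.exp (2 * R * Real.log (20 * ℓTot d n / R)) =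
      (20 * ℓTot d n / R : ℝ) ^ (2 * R) := by
    rw [← Real.exp_log (pow_pos (by positivity : (0 : ℝ) < 20 * ℓTot d n / R) (2 * R)),
      Real.log_pow]
    push_cast
    rfl
  have hCS : (cC m : ℝ) ≤ (20 * ℓTot d n / R : ℝ) ^ (2 * R) * cS m := by
    have h1 : (R : ℝ) ^ (2 * R) * cC m ≤ (20 * totalDeg m) ^ (2 * R) * cS m := by
      exact_mod_cast hmain
    rw [div_pow, div_mul_eq_mul_div, le_div_iff₀ (by positivity), mul_comm]
    refine h1.trans ?_
    gcongr
  rw [hexp]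
  rcases Nat.eq_zero_or_pos (cC m) with h | h
  · have : cSc m = 0 := by
      have := cSc_le_cCc m
      have := cCc_le_cC m
      omega
    simp [this, h]
  · have hC : (0 : ℝ) < cC m := by exact_mod_cast h
    have hW : (0 : ℝ) < (20 * ℓTot d n / R : ℝ) ^ (2 * R) := by positivity
    have hS : (0 : ℝ) < cS m := pos_of_mul_pos_right (hC.trans_le hCS) hW.le
    have hc : (cSc m : ℝ) ≤ cCc m := by exact_mod_cast cSc_le_cCc m
    rw [mul_div_assoc', div_le_div_iff₀ hS hC]
    calc (cSc m : ℝ) * cC m ≤ cCc m * ((20 * ℓTot d n / R : ℝ) ^ (2 * R) * cS m) := by gcongr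
      _ = _ := by ring

lemma eventually_simpleRatio_le {d : (n : ℕ) → Fin n → ℕ} {p : ℕ → ℝ} {μ : ℝ}
    (hdpos : ∀ n j, 0 < d n j)
    (ha : ∀ i : ℕ, Tendsto (fun n : ℕ => (typeOf d n i : ℝ) / (n : ℝ)) atTop (𝓝 (p i)))
    (hb : Tendsto (fun n : ℕ => (ℓTot d n : ℝ) / (n : ℝ)) atTop (𝓝 μ)) (hμ : 0 < μ)
    (hsq : Summable fun i : ℕ => (i : ℝ) ^ 2 * p i)
    (hc : Tendsto (fun n : ℕ => (∑ j : Fin n, (d n j : ℝ) ^ 2) / (n : ℝ)) atTop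
      (𝓝 (∑' i : ℕ, (i : ℝ) ^ 2 * p i)))
    {ε η : ℝ} (hε1 : ε * μ < p 1) (hε2 : ε < 1) (hη : 0 < η) :
    ∀ᶠ n : ℕ in atTop, ∀ m ∈ Neps ε (typeOf d n),
      (cSc m : ℝ) / cS m ≤ Real.exp (η * n) * (cCc m / cC m) := by
  obtain ⟨ρ, hρ, hρc, hρη⟩ := exists_simple_scale hμ
    (c := min (p 1 - ε * μ) ((1 - ε) * μ / 2))
    (lt_min (by linarith) (div_pos (mul_pos (by linarith) hμ) two_pos)) hη
  have hρ1 := hρc.trans_le (min_le_left _ _)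
  have hρ2 := hρc.trans_le (min_le_right _ _)
  have tR := tendsto_floor_div hρ.le
  have n1 := tR.eventually_lt ((ha 1).sub (hb.const_mul ε)) hρ1
  have n2 := (tR.const_mul 2).eventually_lt (hb.const_mul (1 - ε)) (by linarith)
  have n3 := ((tR.const_mul 2).mul (((hb.const_mul 20).div tR hρ.ne').log
    (by positivity))).eventually_lt_const hρη
  have n4 := eventually_degree_sq_le ha hsq hc (δ := ρ / 8) (by positivity)
  have n5 := (tendsto_natCast_atTop_atTop.const_mul_atTop
    (show 0 < ρ / 2 by linarith)).eventually_ge_atTop (3 : ℝ)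
  filter_upwards [n1, n2, n3, n4, n5, eventually_gt_atTop 0] with n h1 h2 h3 h4 h5 hn m hm
  have hn : (0 : ℝ) < n := by exact_mod_cast hn
  set R := ⌊ρ * n⌋₊
  have hmd := hm.2
  rw [totalDeg_typeOf] at hmd
  have hm1 := sub_le_apply_of_mem_Neps hm le_rfl
  rw [totalDeg_typeOf] at hm1
  have hR1 : R ≤ m 1 := by
    have := mul_lt_mul_of_pos_right h1 hn
    field_simp at this
    exact_mod_cast (by linarith : (R : ℝ) ≤ m 1)
  have hR2 : 2 * R ≤ totalDeg m := by
    have := mul_lt_mul_of_pos_right h2 hn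
    field_simp at this
    exact_mod_cast (by linarith : 2 * (R : ℝ) ≤ totalDeg m)
  have hΔ : 2 * (Finset.univ.sup (d n) + Finset.univ.sup (d n) ^ 2) + 2 ≤ R := by
    have hsup : ((Finset.univ.sup (d n) : ℕ) : ℝ) ^ 2 ≤ ρ / 8 * n := by
      rcases (Finset.univ : Finset (Fin n)).eq_empty_or_nonempty with he | he
      · rw [he]
        rw [Finset.sup_empty, bot_eq_zero, Nat.cast_zero, zero_pow two_ne_zero]
        positivity
      · obtain ⟨j, -, hj⟩ := Finset.exists_mem_eq_sup _ he (d n)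
        rw [hj]
        exact h4 j
    have hle : Finset.univ.sup (d n) ≤ Finset.univ.sup (d n) ^ 2 := Nat.le_self_pow (by norm_num) _
    have hR : ρ * n < R + 1 := Nat.lt_floor_add_one _
    have : (4 * (Finset.univ.sup (d n) : ℕ) ^ 2 + 2 : ℝ) ≤ R := by linarith
    have : 4 * Finset.univ.sup (d n) ^ 2 + 2 ≤ R := by exact_mod_cast this
    omega
  refine (simpleRatio_le (hdpos n) hm.1 (fun j => Finset.le_sup (Finset.mem_univ j)) hR1 hΔ
    hR2).trans (mul_le_mul_of_nonneg_right (Real.exp_le_exp.2 ?_) (by positivity))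
  have hRpos : (0 : ℝ) < R := by exact_mod_cast (by omega : 0 < R)
  have := mul_le_mul_of_nonneg_right h3.le hn.le
  refine le_of_eq_of_le ?_ this
  simp only [Pi.div_apply]
  rw [show 20 * ((ℓTot d n : ℝ) / n) / ((R : ℝ) / n) = 20 * ℓTot d n / R by field_simp]
  field_simp

lemma abs_log_finsum_add_le {α : Type*} [PartialOrder α] [OrderBot α] [LocallyFiniteOrder α]
    {s : Set α} {N : α} (hs : ∀ m ∈ s, m ≤ N)
    (r : α → ℝ) (hr : ∀ m, 0 ≤ r m) {K a n : ℝ} (hn : 0 < n)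
    (hcard : ((Finset.Iic N).card : ℝ) ≤ Real.exp (a * n))
    (hup : ∀ m ∈ s, r m ≤ Real.exp ((-K + 2 * a) * n))
    (hlow : ∃ m ∈ s, 0 < r m ∧ (-K - a) * n ≤ Real.log (r m)) (ha : 0 < a) :
    |1 / n * Real.log (∑ᶠ m ∈ s, r m) + K| ≤ 3 * a := by
  classical
  have hsub : s ⊆ (Finset.Iic N : Set α) := fun m hm => by simpa using hs m hm
  have hfin : s.Finite := (Finset.Iic N).finite_toSet.subset hsub
  rw [finsum_mem_eq_finite_toFinset_sum _ hfin]
  obtain ⟨m₀, hm₀, hpos, hl⟩ := hlow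
  have h1 : r m₀ ≤ ∑ m ∈ hfin.toFinset, r m :=
    Finset.single_le_sum (fun m _ => hr m) (hfin.mem_toFinset.2 hm₀)
  have h2 : ∑ m ∈ hfin.toFinset, r m ≤ Real.exp (a * n) * Real.exp ((-K + 2 * a) * n) := by
    refine (Finset.sum_le_card_nsmul _ _ _ fun m hm => hup m (hfin.mem_toFinset.1 hm)).trans ?_
    rw [nsmul_eq_mul]
    refine mul_le_mul_of_nonneg_right (le_trans ?_ hcard) (Real.exp_pos _).le
    have : hfin.toFinset ⊆ Finset.Iic N := fun m hm => by
      simpa using hs m (hfin.mem_toFinset.1 hm)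
    exact_mod_cast Finset.card_le_card this
  have h3 := Real.log_le_log hpos h1
  have h4 := Real.log_le_log (hpos.trans_le h1) h2
  rw [← Real.exp_add, Real.log_exp] at h4
  set L := Real.log (∑ m ∈ hfin.toFinset, r m)
  have h5 : 1 / n * L + K = (L + K * n) / n := by field_simp
  rw [h5, abs_le, le_div_iff₀ hn, div_le_iff₀ hn]
  have : 0 < a * n := mul_pos ha hn
  constructor <;> linarith

theorem sum_of_connectivity_ratios_rate
    (d : (n : ℕ) → Fin n → ℕ) (p : ℕ → ℝ)
    (hdpos : ∀ n j, 0 < d n j) (hdeven : ∀ n, Even (ℓTot d n))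
    (hp0 : p 0 = 0) (hpnn : ∀ i, 0 ≤ p i) (hpsum : ∑' i : ℕ, p i = 1)
    (ha : ∀ i : ℕ, Filter.Tendsto (fun n : ℕ => (typeOf d n i : ℝ) / (n : ℝ))
      Filter.atTop (nhds (p i)))
    (hmom : Summable fun i : ℕ => (i : ℝ) * p i)
    (hb : Filter.Tendsto (fun n : ℕ => (ℓTot d n : ℝ) / (n : ℝ)) Filter.atTop
      (nhds (∑' i : ℕ, (i : ℝ) * p i)))
    (hP1 : 0 < p 1) (hP2 : 2 < ∑' i : ℕ, (i : ℝ) * p i) :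
    ∀ η : ℝ, 0 < η → ∃ ε₀ : ℝ, 0 < ε₀ ∧ ∀ ε : ℝ, 0 < ε → ε < ε₀ →
      (Filter.limsup (fun n : ℕ =>
          |(1 / (n : ℝ)) * Real.log
              (∑ᶠ m ∈ Neps ε (typeOf d n), ((cCc m : ℝ) / (cC m : ℝ)))
            + Kof p|) Filter.atTop ≤ η)
      ∧ ((Summable fun i : ℕ => (i : ℝ) ^ 2 * p i) →
          Filter.Tendsto (fun n : ℕ => (∑ j : Fin n, (d n j : ℝ) ^ 2) / (n : ℝ))
            Filter.atTop (nhds (∑' i : ℕ, (i : ℝ) ^ 2 * p i)) →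
          Filter.limsup (fun n : ℕ =>
            |(1 / (n : ℝ)) * Real.log
                (∑ᶠ m ∈ Neps ε (typeOf d n), ((cSc m : ℝ) / (cS m : ℝ)))
              + Kof p|) Filter.atTop ≤ η) := by
  intro η hη
  have hμ : 0 < ∑' i : ℕ, (i : ℝ) * p i := by linarith
  have hη3 : 0 < η / 3 := by linarith
  obtain ⟨ε₁, hε₁, hup⟩ :=
    exists_connRatio_upper hdpos hp0 hpnn hpsum ha hmom hb hP1 hP2 hη3
  refine ⟨min ε₁ (min 1 (p 1 / ∑' i : ℕ, (i : ℝ) * p i)),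
    lt_min hε₁ (lt_min one_pos (div_pos hP1 hμ)), fun ε hε hεlt => ?_⟩
  have hε1 := hεlt.trans_le (min_le_left _ _)
  have hε2 := hεlt.trans_le ((min_le_right _ _).trans (min_le_left _ _))
  have hε3 := hεlt.trans_le ((min_le_right _ _).trans (min_le_right _ _))
  rw [lt_div_iff₀ hμ] at hε3
  have hlow := eventually_exists_connRatio_ge hdpos hp0 hpnn hpsum ha hmom hb hP1 hP2 hε hη3
  have hcard := eventually_card_Iic_le hb hη3
  have hη' : 3 * (η / 3) = η := by ring
  refine ⟨?_, fun hsq hc => ?_⟩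
  · refine limsup_le_of_le (isCoboundedUnder_le_of_le atTop fun n => abs_nonneg _) ?_
    filter_upwards [hup ε hε1, hlow, hcard, eventually_gt_atTop 0] with n h1 h2 h3 hn
    have hn : (0 : ℝ) < n := by exact_mod_cast hn
    rw [← hη']
    refine abs_log_finsum_add_le (fun m hm => hm.1) _ (fun m => by positivity) hn h3
      (fun m hm => (h1 m hm).trans (Real.exp_le_exp.2 (by nlinarith))) ?_ hη3
    obtain ⟨m, hm, hS, hl⟩ := h2
    have hSc : (0 : ℝ) < cSc m := by exact_mod_cast hS
    have hle : (cSc m : ℝ) ≤ cCc m := by exact_mod_cast cSc_le_cCc m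
    have hC : (0 : ℝ) < cC m := hSc.trans_le (hle.trans (by exact_mod_cast cCc_le_cC m))
    exact ⟨m, hm, div_pos (hSc.trans_le hle) hC,
      hl.le.trans (Real.log_le_log (div_pos hSc hC) (by gcongr))⟩
  · refine limsup_le_of_le (isCoboundedUnder_le_of_le atTop fun n => abs_nonneg _) ?_
    filter_upwards [hup ε hε1, hlow, hcard, eventually_gt_atTop 0,
      eventually_simpleRatio_le hdpos ha hb hμ hsq hc hε3 hε2 hη3] with n h1 h2 h3 hn h4
    have hn : (0 : ℝ) < n := by exact_mod_cast hn
    rw [← hη']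
    refine abs_log_finsum_add_le (fun m hm => hm.1) _ (fun m => by positivity) hn h3
      (fun m hm => ?_) ?_ hη3
    · refine (h4 m hm).trans ((mul_le_mul_of_nonneg_left (h1 m hm) (Real.exp_pos _).le).trans ?_)
      rw [← Real.exp_add]
      exact Real.exp_le_exp.2 (by linarith)
    · obtain ⟨m, hm, hS, hl⟩ := h2
      have hSc : (0 : ℝ) < cSc m := by exact_mod_cast hS
      have hSS : (0 : ℝ) < cS m := hSc.trans_le (by exact_mod_cast cSc_le_cS m)
      have hle : (cS m : ℝ) ≤ cC m := by exact_mod_cast cS_le_cC m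
      exact ⟨m, hm, div_pos hSc hSS,
        hl.le.trans (Real.log_le_log (div_pos hSc (hSS.trans_le hle)) (by gcongr))⟩

end PaperCM
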